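/- Snake Lemma for the Siegel disk. There is an absolute constant C > 0 such that the following holds for every λ > 2, every irrational θ ∈ (0,1) of bounded type with Siegel linearization data H, and all disjoint closed arcs I, J ⊆ ∂Z together with a complementary arc L of ∂Z between I and J such that the total combinatorial length |I| + |L| + |J| ≤ 1/2. Set K := W°_L(I, J) − W⁺(I, J). If K ≥ C·log λ, then there exist disjoint closed arcs J₁, I₁ ⊆ L, positioned so that J₁ lies between I and I₁ and I₁ lies between J₁ and J along L, such that |J₁| < dist(I, J₁)/λ, |I₁| < dist(I₁, J)/λ, and W°_{L_a}(I, J₁) ⊕ W°_{L_b}(I₁, J) ≥ K − C·log λ, where L_a ⊆ L is the arc between I and J₁, L_b ⊆ L is the arc between I₁ and J, a ⊕ b := (a⁻¹ + b⁻¹)⁻¹ is the harmonic sum, and all lengths and distances are combinatorial. -/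

import Mathlib

noncomputable section

open MeasureTheory Set Metric Bornology
open scoped ENNReal NNReal

/-- A curve: continuous on `[0,1]` and continuously differentiable on `(0,1)`. -/
def IsCurve (γ : ℝ → ℂ) : Prop :=
  ContinuousOn γ (Icc 0 1) ∧ ContDiffOn ℝ 1 γ (Ioo 0 1)

/-- The extremal width of a family of curves: the infimum of `∫ ρ² dA` over all Borel
measurable metrics `ρ : ℂ → [0,∞]` that give every curve of the family length at least `1`
(the infimum over the empty set being `∞`). -/
def extremalWidth (F : Set (ℝ → ℂ)) : ℝ≥0∞ :=
  ⨅ ρ ∈ {ρ : ℂ → ℝ≥0∞ | Measurable ρ ∧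
      ∀ γ ∈ F, 1 ≤ ∫⁻ t in Ioo (0:ℝ) 1, ρ (γ t) * (‖deriv γ t‖₊ : ℝ≥0∞)},
    ∫⁻ z, ρ z ^ 2

/-- The curves contained in `S`, starting in `X` and ending in `Y`. -/
def curveFamily (S X Y : Set ℂ) : Set (ℝ → ℂ) :=
  {γ : ℝ → ℂ | IsCurve γ ∧ (∀ t ∈ Icc (0:ℝ) 1, γ t ∈ S) ∧ γ 0 ∈ X ∧ γ 1 ∈ Y}

/-- The extremal width `W_S(X, Y)`. -/
def widthIn (S X Y : Set ℂ) : ℝ≥0∞ := extremalWidth (curveFamily S X Y)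

/-- The point `e^{2πit}` of the unit circle. -/
def unitCirc (t : ℝ) : ℂ := Complex.exp (2 * Real.pi * Complex.I * t)

/-- The Gauss map `x ↦ {1/x}`. -/
def gaussMap (x : ℝ) : ℝ := Int.fract x⁻¹

/-- `partialQuot θ k` is the partial quotient `a_{k+1}` of `θ = [0; a₁, a₂, …]`. -/
def partialQuot (θ : ℝ) (k : ℕ) : ℕ := (⌊(gaussMap^[k] θ)⁻¹⌋).toNat

/-- Numerators `pₙ` of the convergents: `p₀ = 0`, `p₁ = 1`, `pₙ₊₁ = aₙ₊₁ pₙ + pₙ₋₁`. -/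
def convP (θ : ℝ) : ℕ → ℤ
  | 0 => 0
  | 1 => 1
  | n + 2 => (partialQuot θ (n + 1) : ℤ) * convP θ (n + 1) + convP θ n

/-- Denominators `qₙ` of the convergents: `q₀ = 1`, `q₁ = a₁`, `qₙ₊₁ = aₙ₊₁ qₙ + qₙ₋₁`. -/
def convQ (θ : ℝ) : ℕ → ℤ
  | 0 => 1
  | 1 => (partialQuot θ 0 : ℤ)
  | n + 2 => (partialQuot θ (n + 1) : ℤ) * convQ θ (n + 1) + convQ θ n

/-- `θₙ = qₙ·θ − pₙ`. -/
def thetaN (θ : ℝ) (n : ℕ) : ℝ := (convQ θ n : ℝ) * θ - (convP θ n : ℝ)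

/-- `ℓₙ = |θₙ|`. -/
def ellN (θ : ℝ) (n : ℕ) : ℝ := |thetaN θ n|

/-- `θ` is an irrational number in `(0,1)` of bounded type. -/
def BoundedType (θ : ℝ) : Prop :=
  Irrational θ ∧ θ ∈ Ioo (0:ℝ) 1 ∧ ∃ M : ℕ, ∀ k, partialQuot θ k ≤ M

/-- The quadratic polynomial `f_θ(z) = e^{2πiθ} z + z²`. -/
def fTheta (θ : ℝ) (z : ℂ) : ℂ := Complex.exp (2 * Real.pi * Complex.I * θ) * z + z ^ 2

/-- The filled Julia set of `f_θ`. -/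
def filledJulia (θ : ℝ) : Set ℂ :=
  {z | IsBounded (Set.range fun n : ℕ => (fTheta θ)^[n] z)}

/-- The Siegel disk of `f_θ`: the connected component of the interior of the filled
Julia set containing `0`. -/
def siegelDisk (θ : ℝ) : Set ℂ := connectedComponentIn (interior (filledJulia θ)) 0

/-- The boundary `∂Z` of the Siegel disk. -/
def bdryZ (θ : ℝ) : Set ℂ := closure (siegelDisk θ) \ siegelDisk θ

/-- Siegel linearization data for `f_θ`: a continuous injective map from the closed unit
disk onto the closure of the Siegel disk, biholomorphic from the open disk onto the Siegel
disk, conjugating the rigid rotation to `f_θ`. -/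
structure SiegelData (θ : ℝ) where
  H : ℂ → ℂ
  contOn : ContinuousOn H (closedBall 0 1)
  injOn : Set.InjOn H (closedBall 0 1)
  holo : DifferentiableOn ℂ H (ball 0 1)
  image_ball : H '' ball 0 1 = siegelDisk θ
  image_closedBall : H '' closedBall 0 1 = closure (siegelDisk θ)
  map_zero : H 0 = 0
  semiconj : ∀ w ∈ closedBall (0:ℂ) 1,
      H (Complex.exp (2 * Real.pi * Complex.I * θ) * w) = fTheta θ (H w)

/-- The closed arc `H({e^{2πit} : t ∈ [u, v]})` of `∂Z`. -/
def arcOn (θ : ℝ) (S : SiegelData θ) (u v : ℝ) : Set ℂ := S.H '' (unitCirc '' Icc u v)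

/-- The outer width `W⁺(X, Y) = W_{ℂ∖Z}(X, Y)`. -/
def wPlus (θ : ℝ) (X Y : Set ℂ) : ℝ≥0∞ := widthIn (siegelDisk θ)ᶜ X Y

/-- The family `ℱ°_L(I, J)`: curves landing on the outer side of `∂Z` at `γ(0) ∈ I` and at
`γ(1) ∈ J`, whose interior avoids `I ∪ J ∪ (∂Z ∖ (I ∪ L ∪ J))`. -/
def circFam (θ : ℝ) (I L J : Set ℂ) : Set (ℝ → ℂ) :=
  {γ : ℝ → ℂ | IsCurve γ ∧ γ 0 ∈ I ∧ γ 1 ∈ J ∧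
      (∃ ε > 0, ∀ t ∈ Ioo (0:ℝ) ε, γ t ∉ siegelDisk θ) ∧
      (∃ ε > 0, ∀ t ∈ Ioo (1 - ε) (1:ℝ), γ t ∉ siegelDisk θ) ∧
      ∀ t ∈ Ioo (0:ℝ) 1, γ t ∉ I ∪ J ∪ (bdryZ θ \ (I ∪ L ∪ J))}

/-- `W°_L(I, J)`. -/
def circWidth (θ : ℝ) (I L J : Set ℂ) : ℝ≥0∞ := extremalWidth (circFam θ I L J)

/-- The harmonic sum `a ⊕ b = (a⁻¹ + b⁻¹)⁻¹`. -/
def hsum (x y : ℝ≥0∞) : ℝ≥0∞ := (x⁻¹ + y⁻¹)⁻¹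

namespace Snk

/-- length of a piece of a curve in the metric `ρ` -/
def Lr (ρ : ℂ → ℝ≥0∞) (γ : ℝ → ℂ) (a b : ℝ) : ℝ≥0∞ :=
  ∫⁻ t in Ioo a b, ρ (γ t) * (‖deriv γ t‖₊ : ℝ≥0∞)

/-- squared mass -/
def mass (ρ : ℂ → ℝ≥0∞) : ℝ≥0∞ := ∫⁻ z, ρ z ^ 2

def Adm (F : Set (ℝ → ℂ)) (ρ : ℂ → ℝ≥0∞) : Prop := Measurable ρ ∧ ∀ γ ∈ F, 1 ≤ Lr ρ γ 0 1

lemma width_eq (F : Set (ℝ → ℂ)) : extremalWidth F = ⨅ ρ, ⨅ (_ : Adm F ρ), mass ρ := rfl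

lemma width_le {F : Set (ℝ → ℂ)} {ρ : ℂ → ℝ≥0∞} (h : Adm F ρ) : extremalWidth F ≤ mass ρ := by
  rw [width_eq]; exact iInf₂_le ρ h

lemma exists_adm_of_lt {F : Set (ℝ → ℂ)} {x : ℝ≥0∞} (h : extremalWidth F < x) :
    ∃ ρ, Adm F ρ ∧ mass ρ < x := by
  rw [width_eq] at h
  obtain ⟨ρ, h⟩ := iInf_lt_iff.1 h
  obtain ⟨h1, h⟩ := iInf_lt_iff.1 h
  exact ⟨ρ, h1, h⟩

lemma le_width {F : Set (ℝ → ℂ)} {x : ℝ≥0∞} (h : ∀ ρ, Adm F ρ → x ≤ mass ρ) :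
    x ≤ extremalWidth F := by
  rw [width_eq]; exact le_iInf₂ h

lemma width_mono {F G : Set (ℝ → ℂ)} (h : F ⊆ G) : extremalWidth F ≤ extremalWidth G :=
  le_width fun _ hρ => width_le ⟨hρ.1, fun γ hγ => hρ.2 γ (h hγ)⟩

lemma Lr_mono {ρ ρ' : ℂ → ℝ≥0∞} (h : ∀ z, ρ z ≤ ρ' z) (γ : ℝ → ℂ) (a b : ℝ) :
    Lr ρ γ a b ≤ Lr ρ' γ a b :=
  lintegral_mono fun t => by gcongr; exact h _

lemma Lr_mono_set (ρ : ℂ → ℝ≥0∞) (γ : ℝ → ℂ) {a b a' b' : ℝ} (h : a' ≤ a) (h' : b ≤ b') :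
    Lr ρ γ a b ≤ Lr ρ γ a' b' :=
  lintegral_mono_set (Ioo_subset_Ioo h h')

lemma Lr_split (ρ : ℂ → ℝ≥0∞) (γ : ℝ → ℂ) {a s b : ℝ} (h : a ≤ s) (h' : s ≤ b) :
    Lr ρ γ a b = Lr ρ γ a s + Lr ρ γ s b := by
  unfold Lr
  rw [← setLIntegral_congr (Ioc_ae_eq_Icc.trans Ioo_ae_eq_Icc.symm : Ioc a b =ᵐ[volume] Ioo a b),
    ← setLIntegral_congr (Ioc_ae_eq_Icc.trans Ioo_ae_eq_Icc.symm : Ioc a s =ᵐ[volume] Ioo a s),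
    ← setLIntegral_congr (Ioc_ae_eq_Icc.trans Ioo_ae_eq_Icc.symm : Ioc s b =ᵐ[volume] Ioo s b),
    ← lintegral_union measurableSet_Ioc (Ioc_disjoint_Ioc_of_le le_rfl), Ioc_union_Ioc_eq_Ioc h h']

lemma Lr_add (ρ ρ' : ℂ → ℝ≥0∞) (γ : ℝ → ℂ) (a b : ℝ) :
    Lr ρ γ a b + Lr ρ' γ a b ≤ Lr (fun z => ρ z + ρ' z) γ a b := by
  unfold Lr
  refine (le_lintegral_add _ _).trans (lintegral_mono fun t => ?_)
  simp only [add_mul]; exact le_rfl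

lemma Lr_const_mul {k : ℝ≥0∞} (hk : k ≠ ∞) (ρ : ℂ → ℝ≥0∞) (γ : ℝ → ℂ) (a b : ℝ) :
    Lr (fun z => k * ρ z) γ a b = k * Lr ρ γ a b := by
  unfold Lr
  rw [← lintegral_const_mul' _ _ hk]
  simp only [mul_assoc]

lemma mass_sup_le {ρ ρ' : ℂ → ℝ≥0∞} (h : Measurable ρ) :
    mass (fun z => max (ρ z) (ρ' z)) ≤ mass ρ + mass ρ' := by
  unfold mass
  rw [← lintegral_add_left (h.pow_const 2)]
  refine lintegral_mono fun z => ?_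
  rcases le_total (ρ z) (ρ' z) with h | h
  · simp [max_eq_right h]
  · simp [max_eq_left h]

lemma mass_const_mul (k : ℝ≥0∞) {ρ : ℂ → ℝ≥0∞} (h : Measurable ρ) :
    mass (fun z => k * ρ z) = k ^ 2 * mass ρ := by
  unfold mass
  rw [← lintegral_const_mul _ (h.pow_const 2)]
  simp only [mul_pow]

lemma width_union (A B : Set (ℝ → ℂ)) :
    extremalWidth (A ∪ B) ≤ extremalWidth A + extremalWidth B := by
  refine ENNReal.le_of_forall_pos_le_add fun ε hε hfin => ?_
  have hA : extremalWidth A ≠ ∞ := fun h => by simp [h] at hfin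
  have hB : extremalWidth B ≠ ∞ := fun h => by simp [h] at hfin
  have hε2 : (ε / 2 : ℝ≥0∞) ≠ 0 := by simp [hε.ne']
  obtain ⟨ρ, h1, h2⟩ := exists_adm_of_lt (ENNReal.lt_add_right hA hε2)
  obtain ⟨ρ', h1', h2'⟩ := exists_adm_of_lt (ENNReal.lt_add_right hB hε2)
  have : Adm (A ∪ B) (fun z => max (ρ z) (ρ' z)) := by
    refine ⟨h1.1.max h1'.1, ?_⟩
    rintro γ (h | h)
    · exact (h1.2 γ h).trans (Lr_mono (fun z => le_max_left _ _) _ _ _)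
    · exact (h1'.2 γ h).trans (Lr_mono (fun z => le_max_right _ _) _ _ _)
  refine (width_le this).trans ((mass_sup_le h1.1).trans ((add_le_add h2.le h2'.le).trans ?_))
  rw [add_add_add_comm, ENNReal.add_halves]

lemma width_empty : extremalWidth ∅ = 0 := by
  have : Adm ∅ (fun _ => 0) := ⟨measurable_const, by simp⟩
  simpa [mass] using width_le this

lemma width_biUnion (A : ℕ → Set (ℝ → ℂ)) (M : ℝ≥0∞) (h : ∀ k, extremalWidth (A k) ≤ M) (n : ℕ) :
    extremalWidth (⋃ k ∈ Finset.range n, A k) ≤ n * M := by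
  induction n with
  | zero => simp [width_empty]
  | succ n ih =>
    rw [Finset.range_add_one, Finset.set_biUnion_insert]
    refine (width_union _ _).trans ((add_le_add (h n) ih).trans ?_)
    push_cast; rw [add_mul, one_mul, add_comm]

/-- Series law. -/
lemma width_series {F A B : Set (ℝ → ℂ)}
    (h : ∀ γ ∈ F, ∃ s₁ s₂ : ℝ, 0 ≤ s₁ ∧ s₁ ≤ s₂ ∧ s₂ ≤ 1 ∧
      (∀ ρ, Adm A ρ → 1 ≤ Lr ρ γ 0 s₁) ∧ (∀ ρ, Adm B ρ → 1 ≤ Lr ρ γ s₂ 1)) :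
    extremalWidth F ≤ hsum (extremalWidth A) (extremalWidth B) := by
  have key : ∀ ρ, Adm A ρ → ∀ ρ', Adm B ρ' → (mass ρ)⁻¹ + (mass ρ')⁻¹ ≤ (extremalWidth F)⁻¹ := by
    intro ρ hρ ρ' hρ'
    have hA : extremalWidth F ≤ mass ρ := width_le ⟨hρ.1, fun γ hγ => by
      obtain ⟨s₁, s₂, h0, h1, h2, h3, h4⟩ := h γ hγ
      exact (h3 ρ hρ).trans (Lr_mono_set _ _ le_rfl (h1.trans h2))⟩
    have hB : extremalWidth F ≤ mass ρ' := width_le ⟨hρ'.1, fun γ hγ => by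
      obtain ⟨s₁, s₂, h0, h1, h2, h3, h4⟩ := h γ hγ
      exact (h4 ρ' hρ').trans (Lr_mono_set _ _ (h0.trans h1) le_rfl)⟩
    by_cases hA0 : mass ρ = 0
    · have : extremalWidth F = 0 := by simpa [hA0] using hA
      simp [this]
    by_cases hB0 : mass ρ' = 0
    · have : extremalWidth F = 0 := by simpa [hB0] using hB
      simp [this]
    by_cases hAt : mass ρ = ∞
    · simp only [hAt, ENNReal.inv_top, zero_add]; exact ENNReal.inv_le_inv.2 hB
    by_cases hBt : mass ρ' = ∞
    · simp only [hBt, ENNReal.inv_top, add_zero]; exact ENNReal.inv_le_inv.2 hA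
    set x := (mass ρ).toReal with hx
    set y := (mass ρ').toReal with hy
    have hx0 : 0 < x := ENNReal.toReal_pos hA0 hAt
    have hy0 : 0 < y := ENNReal.toReal_pos hB0 hBt
    have ex : mass ρ = ENNReal.ofReal x := (ENNReal.ofReal_toReal hAt).symm
    have ey : mass ρ' = ENNReal.ofReal y := (ENNReal.ofReal_toReal hBt).symm
    set t := ENNReal.ofReal (y / (x + y)) with ht
    set t' := ENNReal.ofReal (x / (x + y)) with ht'
    have htt : t + t' = 1 := by
      rw [ht, ht', ← ENNReal.ofReal_add (by positivity) (by positivity), ← add_div, add_comm y x,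
        div_self (by positivity), ENNReal.ofReal_one]
    have hadm : Adm F (fun z => max (t * ρ z) (t' * ρ' z)) := by
      refine ⟨(hρ.1.const_mul t).max (hρ'.1.const_mul t'), fun γ hγ => ?_⟩
      obtain ⟨s₁, s₂, h0, h1, h2, h3, h4⟩ := h γ hγ
      rw [Lr_split _ _ h0 (h1.trans h2), Lr_split _ _ h1 h2, ← htt]
      refine add_le_add ?_ (le_add_left ?_)
      · refine le_trans ?_ (Lr_mono (fun z => le_max_left _ _) _ _ _)
        rw [Lr_const_mul ENNReal.ofReal_ne_top]
        exact le_mul_of_one_le_right zero_le (h3 ρ hρ)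
      · refine le_trans ?_ (Lr_mono (fun z => le_max_right _ _) _ _ _)
        rw [Lr_const_mul ENNReal.ofReal_ne_top]
        exact le_mul_of_one_le_right zero_le (h4 ρ' hρ')
    have h5 := (width_le hadm).trans (mass_sup_le (hρ.1.const_mul t))
    rw [mass_const_mul _ hρ.1, mass_const_mul _ hρ'.1, ex, ey, ht, ht',
      ← ENNReal.ofReal_pow (by positivity), ← ENNReal.ofReal_pow (by positivity),
      ← ENNReal.ofReal_mul (by positivity), ← ENNReal.ofReal_mul (by positivity),
      ← ENNReal.ofReal_add (by positivity) (by positivity)] at h5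
    rw [ex, ey, ← ENNReal.ofReal_inv_of_pos hx0, ← ENNReal.ofReal_inv_of_pos hy0,
      ← ENNReal.ofReal_add (by positivity) (by positivity)]
    refine le_trans ?_ (ENNReal.inv_le_inv.2 h5)
    rw [← ENNReal.ofReal_inv_of_pos (by positivity)]
    apply ENNReal.ofReal_le_ofReal
    apply le_of_eq
    field_simp
    ring
  unfold hsum
  rw [ENNReal.le_inv_iff_le_inv]
  rw [width_eq A, width_eq B]
  simp only [ENNReal.inv_iInf]
  have step1 : ∀ ρ', Adm B ρ' →
      (⨆ ρ, ⨆ (_ : Adm A ρ), (mass ρ)⁻¹) + (mass ρ')⁻¹ ≤ (extremalWidth F)⁻¹ := by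
    intro ρ' hρ'
    by_cases hAe : ∃ ρ, Adm A ρ
    · rw [ENNReal.biSup_add' hAe]
      exact iSup₂_le fun ρ hρ => key ρ hρ ρ' hρ'
    · have : (⨆ ρ, ⨆ (_ : Adm A ρ), (mass ρ)⁻¹) = 0 := by
        simp only [ENNReal.iSup_eq_zero]
        exact fun ρ hρ => absurd ⟨ρ, hρ⟩ hAe
      rw [this, zero_add]
      refine ENNReal.inv_le_inv.2 (width_le ⟨hρ'.1, fun γ hγ => ?_⟩)
      obtain ⟨s₁, s₂, h0, h1, h2, h3, h4⟩ := h γ hγ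
      exact (h4 ρ' hρ').trans (Lr_mono_set _ _ (h0.trans h1) le_rfl)
  by_cases hBe : ∃ ρ, Adm B ρ
  · rw [ENNReal.add_biSup' hBe]
    exact iSup₂_le fun ρ hρ => step1 ρ hρ
  · have : (⨆ ρ, ⨆ (_ : Adm B ρ), (mass ρ)⁻¹) = 0 := by
      simp only [ENNReal.iSup_eq_zero]
      exact fun ρ hρ => absurd ⟨ρ, hρ⟩ hBe
    rw [this, add_zero]
    refine iSup₂_le fun ρ hρ => ENNReal.inv_le_inv.2 (width_le ⟨hρ.1, fun γ hγ => ?_⟩)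
    obtain ⟨s₁, s₂, h0, h1, h2, h3, h4⟩ := h γ hγ
    exact (h3 ρ hρ).trans (Lr_mono_set _ _ le_rfl (h1.trans h2))

end Snk

namespace Snk

/-- `d` is the increment of a continuous logarithm of `f` along `[0,1]`. -/
def HasInc (f : ℝ → ℂ) (d : ℂ) : Prop :=
  ∃ Λ : ℝ → ℂ, ContinuousOn Λ (Icc 0 1) ∧ (∀ t ∈ Icc (0:ℝ) 1, Complex.exp (Λ t) = f t) ∧
    d = Λ 1 - Λ 0

lemma HasInc.congr {f g : ℝ → ℂ} {d : ℂ} (h : HasInc f d) (e : ∀ t ∈ Icc (0:ℝ) 1, f t = g t) :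
    HasInc g d := by
  obtain ⟨Λ, h1, h2, h3⟩ := h
  exact ⟨Λ, h1, fun t ht => by rw [h2 t ht, e t ht], h3⟩

lemma HasInc.mul {f g : ℝ → ℂ} {d e : ℂ} (h : HasInc f d) (h' : HasInc g e) :
    HasInc (fun t => f t * g t) (d + e) := by
  obtain ⟨Λ, h1, h2, h3⟩ := h
  obtain ⟨M, h1', h2', h3'⟩ := h'
  refine ⟨fun t => Λ t + M t, h1.add h1', fun t ht => ?_, ?_⟩
  · rw [Complex.exp_add, h2 t ht, h2' t ht]
  · rw [h3, h3']; ring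

lemma HasInc.neg {f : ℝ → ℂ} {d : ℂ} (h : HasInc f d) : HasInc (fun t => - f t) d := by
  obtain ⟨Λ, h1, h2, h3⟩ := h
  refine ⟨fun t => Λ t + Real.pi * Complex.I, h1.add continuousOn_const, fun t ht => ?_, ?_⟩
  · rw [Complex.exp_add, h2 t ht, Complex.exp_pi_mul_I]; ring
  · rw [h3]; ring

lemma HasInc.unique {f : ℝ → ℂ} {d e : ℂ} (h : HasInc f d) (h' : HasInc f e) : d = e := by
  obtain ⟨Λ, h1, h2, h3⟩ := h
  obtain ⟨M, h1', h2', h3'⟩ := h'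
  have z0 : (0:ℝ) ∈ Icc (0:ℝ) 1 := by simp
  have z1 : (1:ℝ) ∈ Icc (0:ℝ) 1 := by simp
  have key : Set.EqOn Λ (fun t => M t + (Λ 0 - M 0)) (Icc 0 1) := by
    refine Complex.isCoveringMap_exp.eqOn_of_comp_eqOn isPreconnected_Icc h1
      (h1'.add continuousOn_const) ?_ z0 (by simp)
    intro t ht
    apply Subtype.ext
    have : Complex.exp (Λ 0 - M 0) = 1 := by
      rw [Complex.exp_sub, h2 0 z0, h2' 0 z0, div_self]
      rw [← h2 0 z0]; exact Complex.exp_ne_zero _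
    simp only [Function.comp]
    rw [Complex.exp_add, this, mul_one, h2 t ht, h2' t ht]
  have := key z1
  simp only at this
  rw [h3, h3', this]; ring

/-- The square lemma. -/
lemma square {D : ℝ → ℝ → ℂ}
    (hc : ContinuousOn (fun p : ℝ × ℝ => D p.1 p.2) (Icc 0 1 ×ˢ Icc 0 1))
    (h0 : ∀ s ∈ Icc (0:ℝ) 1, ∀ t ∈ Icc (0:ℝ) 1, D s t ≠ 0) :
    ∃ dl dt db dr, HasInc (fun t => D 0 t) dl ∧ HasInc (fun s => D s 1) dt ∧
      HasInc (fun s => D s 0) db ∧ HasInc (fun t => D 1 t) dr ∧ dl + dt = db + dr := by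
  let pr : ℝ → ℝ := fun t => (projIcc (0:ℝ) 1 zero_le_one t : ℝ)
  have prc : Continuous pr := continuous_subtype_val.comp continuous_projIcc
  have prm : ∀ t, pr t ∈ Icc (0:ℝ) 1 := fun t => (projIcc (0:ℝ) 1 zero_le_one t).2
  have pre : ∀ t ∈ Icc (0:ℝ) 1, pr t = t := fun t ht => by
    simp only [pr, projIcc_of_mem zero_le_one ht]
  let g : ℝ × ℝ → ℂ := fun p => D (pr p.1) (pr p.2)
  have gc : Continuous g :=
    hc.comp_continuous ((prc.comp continuous_fst).prodMk (prc.comp continuous_snd))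
      (fun p => ⟨prm _, prm _⟩)
  have hsc : IsSimplyConnected (univ : Set (ℝ × ℝ)) := by
    haveI := (convex_univ (𝕜 := ℝ) (E := ℝ × ℝ)).contractibleSpace univ_nonempty
    unfold IsSimplyConnected; infer_instance
  obtain ⟨Λ, hΛ, hE⟩ := Complex.exists_continuousOn_eqOn_exp_comp hsc isOpen_univ
    (g := g) gc.continuousOn (by rintro ⟨p, -, hp⟩; exact h0 _ (prm _) _ (prm _) hp)
  rw [continuousOn_univ] at hΛ
  have hE' : ∀ s ∈ Icc (0:ℝ) 1, ∀ t ∈ Icc (0:ℝ) 1, Complex.exp (Λ (s, t)) = D s t := by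
    intro s hs t ht
    have := hE (mem_univ (s, t))
    simpa [g, pre s hs, pre t ht] using this
  have z0 : (0:ℝ) ∈ Icc (0:ℝ) 1 := by simp
  have z1 : (1:ℝ) ∈ Icc (0:ℝ) 1 := by simp
  refine ⟨_, _, _, _, ⟨fun t => Λ (0, t), ?_, fun t ht => hE' 0 z0 t ht, rfl⟩,
    ⟨fun s => Λ (s, 1), ?_, fun s hs => hE' s hs 1 z1, rfl⟩,
    ⟨fun s => Λ (s, 0), ?_, fun s hs => hE' s hs 0 z0, rfl⟩,
    ⟨fun t => Λ (1, t), ?_, fun t ht => hE' 1 z1 t ht, rfl⟩, by ring⟩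
  all_goals exact (hΛ.comp (by fun_prop)).continuousOn

lemma HasInc.exists {f : ℝ → ℂ} (hf : ContinuousOn f (Icc 0 1)) (h0 : ∀ t ∈ Icc (0:ℝ) 1, f t ≠ 0) :
    ∃ d, HasInc f d := by
  obtain ⟨d, _, _, _, h, _⟩ := square (D := fun _ t => f t)
    (hf.comp continuous_snd.continuousOn (fun p hp => hp.2)) (fun _ _ => h0)
  exact ⟨d, h⟩

lemma unitCirc_add (x y : ℝ) : unitCirc (x + y) = unitCirc x * unitCirc y := by
  unfold unitCirc; rw [← Complex.exp_add]; congr 1; push_cast; ring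

lemma norm_unitCirc (x : ℝ) : ‖unitCirc x‖ = 1 := by
  unfold unitCirc
  have : (2 * Real.pi * Complex.I * x : ℂ) = ((2 * Real.pi * x : ℝ) : ℂ) * Complex.I := by
    push_cast; ring
  rw [this, Complex.norm_exp_ofReal_mul_I]

lemma unitCirc_ne_zero (x : ℝ) : unitCirc x ≠ 0 := by unfold unitCirc; exact Complex.exp_ne_zero _

lemma unitCirc_sub (x y : ℝ) : unitCirc (x - y) = unitCirc x / unitCirc y := by
  rw [eq_div_iff (unitCirc_ne_zero y), ← unitCirc_add]; congr 1; ring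

lemma one_sub_unitCirc (φ : ℝ) : 1 - unitCirc φ =
    ((2 * Real.sin (Real.pi * φ) : ℝ) : ℂ) *
      (Complex.cos ((Real.pi * φ - Real.pi / 2 : ℝ) : ℂ) +
        Complex.sin ((Real.pi * φ - Real.pi / 2 : ℝ) : ℂ) * Complex.I) := by
  have e : (2 * Real.pi * Complex.I * φ : ℂ) = ((2 * (Real.pi * φ) : ℝ) : ℂ) * Complex.I := by
    push_cast; ring
  unfold unitCirc
  rw [e, Complex.exp_mul_I]
  rw [← Complex.ofReal_cos, ← Complex.ofReal_sin, ← Complex.ofReal_cos, ← Complex.ofReal_sin,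
    Real.cos_sub_pi_div_two, Real.sin_sub_pi_div_two, Real.cos_two_mul, Real.sin_two_mul]
  have := Real.sin_sq_add_cos_sq (Real.pi * φ)
  generalize Real.sin (Real.pi * φ) = x at *
  generalize Real.cos (Real.pi * φ) = y at *
  have h2 : (x : ℂ) ^ 2 + (y : ℂ) ^ 2 = 1 := by exact_mod_cast this
  push_cast
  linear_combination -2 * h2

lemma arg_one_sub {φ : ℝ} (h0 : 0 < φ) (h1 : φ < 1) :
    (1 - unitCirc φ).arg = Real.pi * φ - Real.pi / 2 := by
  rw [one_sub_unitCirc]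
  have hp := Real.pi_pos
  have : 0 < Real.sin (Real.pi * φ) := Real.sin_pos_of_pos_of_lt_pi (by positivity) (by nlinarith)
  rw [Complex.arg_mul_cos_add_sin_mul_I (by positivity)]
  constructor <;> nlinarith

lemma unitCirc_add_one (x : ℝ) : unitCirc (x + 1) = unitCirc x := by
  have : unitCirc 1 = 1 := by
    unfold unitCirc
    rw [show (2 * Real.pi * Complex.I * (1:ℝ) : ℂ) = 2 * Real.pi * Complex.I by push_cast; ring]
    exact Complex.exp_two_pi_mul_I
  rw [unitCirc_add, this, mul_one]

lemma continuous_unitCirc : Continuous unitCirc := by unfold unitCirc; fun_prop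

lemma inc_disc {X : ℝ → ℂ} (hX : ContinuousOn X (Icc 0 1)) (hn : ∀ t ∈ Icc (0:ℝ) 1, ‖X t‖ ≤ 1)
    {β α₀ α₁ : ℝ} (hb : ∀ t ∈ Icc (0:ℝ) 1, X t ≠ unitCirc β)
    (e0 : X 0 = unitCirc α₀) (e1 : X 1 = unitCirc α₁)
    (h0 : β < α₀) (h0' : α₀ < β + 1) (h1 : β < α₁) (h1' : α₁ < β + 1) {d : ℂ}
    (hd : HasInc (fun t => unitCirc β - X t) d) : d.im = Real.pi * (α₁ - α₀) := by
  set p := unitCirc β with hp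
  have p0 : p ≠ 0 := unitCirc_ne_zero β
  have pn : ‖p‖ = 1 := norm_unitCirc β
  have hre : ∀ t ∈ Icc (0:ℝ) 1, 0 < (1 - X t / p).re := by
    intro t ht
    have hq : ‖X t / p‖ ≤ 1 := by rw [norm_div, pn, div_one]; exact hn t ht
    have hne : X t / p ≠ 1 := fun h => hb t ht ((div_eq_one_iff_eq p0).1 h)
    rw [Complex.sub_re, Complex.one_re, sub_pos]
    by_contra hcon
    push Not at hcon
    apply hne
    have h3 := Complex.sq_norm (X t / p)
    rw [Complex.normSq_apply] at h3
    have h4 : ‖X t / p‖ ^ 2 ≤ 1 := by nlinarith [norm_nonneg (X t / p)]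
    have him : (X t / p).im = 0 := by nlinarith [sq_nonneg ((X t / p).im)]
    have hre1 : (X t / p).re = 1 := by nlinarith
    exact Complex.ext (by simpa using hre1) (by simpa using him)
  have hL : HasInc (fun t => p - X t) (Complex.log (1 - X 1 / p) - Complex.log (1 - X 0 / p)) := by
    refine ⟨fun t => Complex.log (1 - X t / p) + Complex.log p, ?_, ?_, by ring⟩
    · refine ContinuousOn.add (ContinuousOn.clog ?_ ?_) continuousOn_const
      · exact continuousOn_const.sub (hX.div_const p)
      · intro t ht; exact Or.inl (hre t ht)
    · intro t ht
      rw [Complex.exp_add, Complex.exp_log, Complex.exp_log p0]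
      · field_simp
      · intro h; have := hre t ht; rw [h] at this; simp at this
  rw [hd.unique hL, e0, e1, hp, ← unitCirc_sub, ← unitCirc_sub, Complex.sub_im, Complex.log_im,
    Complex.log_im, arg_one_sub (by linarith) (by linarith),
    arg_one_sub (by linarith) (by linarith)]
  ring

lemma inc_contra {X Y : ℝ → ℂ} (hX : ContinuousOn X (Icc 0 1)) (hY : ContinuousOn Y (Icc 0 1))
    (nX : ∀ t ∈ Icc (0:ℝ) 1, ‖X t‖ ≤ 1) (nY : ∀ t ∈ Icc (0:ℝ) 1, ‖Y t‖ ≤ 1)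
    {a b c d : ℝ} (hab : a < b) (hbc : b < c) (hcd : c < d) (hda : d < a + 1)
    (X0 : X 0 = unitCirc a) (X1 : X 1 = unitCirc c) (Y0 : Y 0 = unitCirc b) (Y1 : Y 1 = unitCirc d)
    (ha : ∀ t ∈ Icc (0:ℝ) 1, Y t ≠ X 0) (hc : ∀ t ∈ Icc (0:ℝ) 1, Y t ≠ X 1)
    (hb : ∀ t ∈ Icc (0:ℝ) 1, X t ≠ Y 0) (hd : ∀ t ∈ Icc (0:ℝ) 1, X t ≠ Y 1)
    {dl dt db dr : ℂ} (hl : HasInc (fun t => X 0 - Y t) dl) (ht : HasInc (fun s => X s - Y 1) dt)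
    (hb' : HasInc (fun s => X s - Y 0) db) (hr : HasInc (fun t => X 1 - Y t) dr) :
    dl + dt ≠ db + dr := by
  have e1 := inc_disc hY nY (β := a) (by rwa [← X0]) Y0 Y1 hab (by linarith) (by linarith)
    hda (by rwa [← X0])
  have e2 := inc_disc hY nY (β := c) (α₀ := b + 1) (by rwa [← X1]) (by rw [unitCirc_add_one, Y0]) Y1
    (by linarith) (by linarith) hcd (by linarith) (by rwa [← X1])
  have e3 := inc_disc hX nX (β := b) (α₀ := a + 1) (by rwa [← Y0]) (by rw [unitCirc_add_one, X0]) X1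
    (by linarith) (by linarith) hbc (by linarith) (by rw [← Y0]; exact hb'.neg.congr (by simp))
  have e4 := inc_disc hX nX (β := d) (α₀ := a + 1) (α₁ := c + 1) (by rwa [← Y1])
    (by rw [unitCirc_add_one, X0]) (by rw [unitCirc_add_one, X1])
    (by linarith) (by linarith) (by linarith) (by linarith)
    (by rw [← Y1]; exact ht.neg.congr (by simp))
  intro h
  have := congrArg Complex.im h
  rw [Complex.add_im, Complex.add_im, e1, e2, e3, e4] at this
  nlinarith [Real.pi_pos]

lemma sub_sq_cont {X Y : ℝ → ℂ} (hX : ContinuousOn X (Icc 0 1)) (hY : ContinuousOn Y (Icc 0 1)) :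
    ContinuousOn (fun p : ℝ × ℝ => X p.1 - Y p.2) (Icc 0 1 ×ˢ Icc 0 1) :=
  (hX.comp continuous_fst.continuousOn (fun _ hp => hp.1)).sub
    (hY.comp continuous_snd.continuousOn (fun _ hp => hp.2))

/-- Disc crossing. -/
lemma disc_cross {X Y : ℝ → ℂ} (hX : ContinuousOn X (Icc 0 1)) (hY : ContinuousOn Y (Icc 0 1))
    (nX : ∀ t ∈ Icc (0:ℝ) 1, ‖X t‖ ≤ 1) (nY : ∀ t ∈ Icc (0:ℝ) 1, ‖Y t‖ ≤ 1)
    {a b c d : ℝ} (hab : a < b) (hbc : b < c) (hcd : c < d) (hda : d < a + 1)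
    (X0 : X 0 = unitCirc a) (X1 : X 1 = unitCirc c) (Y0 : Y 0 = unitCirc b)
    (Y1 : Y 1 = unitCirc d) : ∃ s ∈ Icc (0:ℝ) 1, ∃ t ∈ Icc (0:ℝ) 1, X s = Y t := by
  by_contra hcon
  push Not at hcon
  have z0 : (0:ℝ) ∈ Icc (0:ℝ) 1 := by simp
  have z1 : (1:ℝ) ∈ Icc (0:ℝ) 1 := by simp
  obtain ⟨dl, dt, db, dr, h1, h2, h3, h4, h5⟩ := square (D := fun s t => X s - Y t)
    (sub_sq_cont hX hY) (fun s hs t ht => sub_ne_zero.2 (hcon s hs t ht))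
  exact inc_contra hX hY nX nY hab hbc hcd hda X0 X1 Y0 Y1 (fun t ht => (hcon 0 z0 t ht).symm)
    (fun t ht => (hcon 1 z1 t ht).symm) (fun t ht => (hcon t ht 0 z0))
    (fun t ht => (hcon t ht 1 z1)) h1 h2 h3 h4 h5

end Snk

namespace Snk
open Filter Topology

lemma deriv_ne_zero_of_inj {f : ℂ → ℂ} {U : Set ℂ} (hU : IsOpen U) (hf : DifferentiableOn ℂ f U)
    (hi : InjOn f U) {w : ℂ} (hw : w ∈ U) : deriv f w ≠ 0 := by
  intro hd
  have hUw : U ∈ 𝓝 w := hU.mem_nhds hw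
  have hfa : AnalyticAt ℂ f w := hf.analyticAt hUw
  have hfa' : AnalyticAt ℂ (fun z => f z - f w) w := hfa.sub analyticAt_const
  have hnz : ¬ ∀ᶠ z in 𝓝 w, f z - f w = 0 := by
    intro h
    have h2 : ∀ᶠ z in 𝓝[≠] w, f z - f w = 0 ∧ z ∈ U ∧ z ≠ w :=
      (h.filter_mono nhdsWithin_le_nhds).and
        ((eventually_of_mem (mem_nhdsWithin_of_mem_nhds hUw) (fun _ h => h)).and
          self_mem_nhdsWithin)
    obtain ⟨z, h3, h4, h5⟩ := h2.exists
    exact h5 (hi h4 hw (sub_eq_zero.1 h3))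
  obtain ⟨n, g, hg, hg0, hgeq⟩ := (hfa'.exists_eventuallyEq_pow_smul_nonzero_iff).2 hnz
  have hn0 : n ≠ 0 := by
    rintro rfl
    have := hgeq.self_of_nhds
    simp at this; exact hg0 this.symm
  have hn1 : n ≠ 1 := by
    rintro rfl
    have h1 : deriv (fun z => f z - f w) w = deriv (fun z => (z - w) ^ 1 • g z) w :=
      EventuallyEq.deriv_eq hgeq
    have h2 : HasDerivAt (fun z => (z - w) * g z) (1 * g w + (w - w) * deriv g w) w :=
      ((hasDerivAt_id w).sub_const w).mul hg.differentiableAt.hasDerivAt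
    simp only [pow_one, smul_eq_mul] at h1
    rw [h2.deriv, deriv_sub_const, hd] at h1
    simp at h1; exact hg0 h1.symm
  set h : ℂ → ℂ := fun z => Complex.exp (Complex.log (g z / g w) / n) with hh
  have hha : AnalyticAt ℂ h w := by
    have : AnalyticAt ℂ (fun z => Complex.log (g z / g w)) w := by
      refine (hg.div_const).clog ?_
      rw [div_self hg0]; exact Complex.one_mem_slitPlane
    exact (this.div_const).cexp
  have hn' : (n : ℂ) ≠ 0 := by exact_mod_cast hn0
  have hpow : ∀ᶠ z in 𝓝 w, g z = g w * h z ^ n := by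
    have : ∀ᶠ z in 𝓝 w, g z ≠ 0 := hg.continuousAt.eventually_ne hg0
    filter_upwards [this] with z hz
    rw [hh]; simp only
    rw [← Complex.exp_nat_mul, mul_div_cancel₀ _ hn', Complex.exp_log (div_ne_zero hz hg0)]
    field_simp
  have hhw : h w = 1 := by simp [hh, div_self hg0]
  have hφa : AnalyticAt ℂ (fun z => (z - w) * h z) w := (analyticAt_id.sub analyticAt_const).mul hha
  have hφd : HasDerivAt (fun z => (z - w) * h z) (1 * h w + (w - w) * deriv h w) w :=
    ((hasDerivAt_id w).sub_const w).mul hha.differentiableAt.hasDerivAt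
  have hφs : HasStrictDerivAt (fun z => (z - w) * h z) 1 w := by
    have := hφa.hasStrictDerivAt
    rwa [hφd.deriv, hhw, sub_self, zero_mul, add_zero, mul_one] at this
  have hmap := hφs.map_nhds_eq one_ne_zero
  simp only [sub_self, zero_mul] at hmap
  have hV : {z | z ∈ U ∧ f z - f w = (z - w) ^ n • g z ∧ g z = g w * h z ^ n} ∈ 𝓝 w := by
    filter_upwards [hUw, hgeq, hpow] with z h1 h2 h3 using ⟨h1, h2, h3⟩
  have him := image_mem_map (m := fun z => (z - w) * h z) hV
  rw [hmap] at him
  obtain ⟨ε, hε, hball⟩ := Metric.mem_nhds_iff.1 him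
  have hprim := Complex.isPrimitiveRoot_exp n hn0
  set ω := Complex.exp (2 * Real.pi * Complex.I / n) with hω
  have hω1 : ω ≠ 1 := hprim.ne_one (by omega)
  have hωn : ‖ω‖ = 1 := hprim.norm'_eq_one hn0
  have hε2 : ((ε / 2 : ℝ) : ℂ) ≠ 0 := by exact_mod_cast (by positivity : ε / 2 ≠ 0)
  have m1 : ((ε / 2 : ℝ) : ℂ) ∈ ball (0:ℂ) ε := by
    rw [mem_ball_zero_iff, Complex.norm_real, Real.norm_of_nonneg (by positivity)]; linarith
  have m2 : ω * ((ε / 2 : ℝ) : ℂ) ∈ ball (0:ℂ) ε := by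
    rw [mem_ball_zero_iff, norm_mul, hωn, one_mul, Complex.norm_real,
      Real.norm_of_nonneg (by positivity)]; linarith
  obtain ⟨z1, ⟨a1, a2, a3⟩, a4⟩ := hball m1
  obtain ⟨z2, ⟨b1, b2, b3⟩, b4⟩ := hball m2
  simp only at a4 b4
  have e1 : f z1 - f w = g w * ((ε / 2 : ℝ) : ℂ) ^ n := by
    rw [a2, a3, ← a4, smul_eq_mul, mul_pow]; ring
  have e2 : f z2 - f w = g w * ((ε / 2 : ℝ) : ℂ) ^ n := by
    have : ((ε / 2 : ℝ) : ℂ) ^ n = (ω * ((ε / 2 : ℝ) : ℂ)) ^ n := by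
      rw [mul_pow, hprim.pow_eq_one, one_mul]
    rw [this, b2, b3, ← b4, smul_eq_mul, mul_pow]; ring
  have : z1 = z2 := hi a1 b1 (by linear_combination e1 - e2)
  rw [this, b4] at a4
  exact hω1 (mul_right_cancel₀ hε2 (by rw [a4, one_mul]))

/-- difference quotient -/
def Eq2 (H : ℂ → ℂ) (a b : ℂ) : ℂ := if a = b then deriv H a else (H a - H b) / (a - b)

lemma Eq2_contAt {H : ℂ → ℂ} {U : Set ℂ} (hU : IsOpen U) (hf : DifferentiableOn ℂ H U)
    {w : ℂ} (hw : w ∈ U) : ContinuousAt (fun p : ℂ × ℂ => Eq2 H p.1 p.2) (w, w) := by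
  have hfa : AnalyticAt ℂ H w := hf.analyticAt (hU.mem_nhds hw)
  have hs := hfa.hasStrictDerivAt
  rw [Metric.continuousAt_iff']
  intro ε hε
  have h1 : ∀ᶠ p : ℂ × ℂ in 𝓝 (w, w), dist (deriv H p.1) (deriv H w) < ε :=
    (continuousAt_fst (p := (w, w))).eventually
        (Metric.tendsto_nhds.1 (hfa.deriv.continuousAt.tendsto) ε hε)
  have h2 := hs.isLittleO.bound (show 0 < ε / 2 by positivity)
  filter_upwards [h1, h2] with p hp1 hp2
  simp only [Eq2, if_true]
  split_ifs with hc
  · exact hp1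
  · have hne : p.1 - p.2 ≠ 0 := sub_ne_zero.2 hc
    have hpos : 0 < ‖p.1 - p.2‖ := norm_pos_iff.2 hne
    rw [dist_eq_norm, show (H p.1 - H p.2) / (p.1 - p.2) - deriv H w =
      (H p.1 - H p.2 - (p.1 - p.2) * deriv H w) / (p.1 - p.2) by field_simp, norm_div,
      div_lt_iff₀ hpos]
    simp only [smul_eq_mul, ContinuousLinearMap.toSpanSingleton_apply] at hp2
    nlinarith

lemma chord_norm {a b : ℝ} (h : unitCirc a ≠ unitCirc b) {t : ℝ} (ht : t ∈ Icc (0:ℝ) 1) :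
    ‖(1 - (t:ℂ)) * unitCirc a + t * unitCirc b‖ ≤ 1 ∧
    (‖(1 - (t:ℂ)) * unitCirc a + t * unitCirc b‖ = 1 → t = 0 ∨ t = 1) := by
  have hc := strictConvex_closedBall ℝ (0:ℂ) 1
  have ha : unitCirc a ∈ closedBall (0:ℂ) 1 := by simp [norm_unitCirc]
  have hb : unitCirc b ∈ closedBall (0:ℂ) 1 := by simp [norm_unitCirc]
  by_cases h0 : t = 0
  · simp [h0, norm_unitCirc]
  by_cases h1 : t = 1
  · simp [h1, norm_unitCirc]
  have := hc ha hb h (a := 1 - t) (b := t) (by have := lt_of_le_of_ne ht.2 h1; linarith)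
    (lt_of_le_of_ne ht.1 (Ne.symm h0)) (by ring)
  rw [interior_closedBall _ one_ne_zero, mem_ball_zero_iff] at this
  simp only [Complex.real_smul, Complex.ofReal_sub, Complex.ofReal_one] at this
  exact ⟨this.le, fun h => absurd h this.ne⟩

lemma unitCirc_ne {a b : ℝ} (h : a < b) (h' : b < a + 1) : unitCirc a ≠ unitCirc b := by
  intro he
  have h1 : unitCirc (b - a) = 1 := by rw [unitCirc_sub, he, div_self (unitCirc_ne_zero _)]
  have h2 := arg_one_sub (φ := b - a) (by linarith) (by linarith)
  have h3 := one_sub_unitCirc (b - a)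
  have hp := Real.pi_pos
  have : 0 < Real.sin (Real.pi * (b - a)) :=
    Real.sin_pos_of_pos_of_lt_pi (mul_pos hp (by linarith)) (by nlinarith)
  rw [h1, sub_self] at h3
  have h4 := congrArg norm h3
  rw [norm_zero, norm_mul, ← Complex.exp_mul_I, Complex.norm_exp_ofReal_mul_I, mul_one,
    Complex.norm_real] at h4
  have := norm_eq_zero.1 h4.symm
  nlinarith

/-- Outer crossing. -/
lemma outer_cross {H : ℂ → ℂ} (hHc : ContinuousOn H (closedBall 0 1))
    (hHi : InjOn H (closedBall 0 1)) (hHd : DifferentiableOn ℂ H (ball 0 1))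
    {X Y : ℝ → ℂ} (hX : ContinuousOn X (Icc 0 1)) (hY : ContinuousOn Y (Icc 0 1))
    (nX : ∀ t ∈ Icc (0:ℝ) 1, X t ∉ H '' ball 0 1) (nY : ∀ t ∈ Icc (0:ℝ) 1, Y t ∉ H '' ball 0 1)
    {a b c d : ℝ} (hab : a < b) (hbc : b < c) (hcd : c < d) (hda : d < a + 1)
    (X0 : X 0 = H (unitCirc a)) (X1 : X 1 = H (unitCirc c)) (Y0 : Y 0 = H (unitCirc b))
    (Y1 : Y 1 = H (unitCirc d)) : ∃ s ∈ Icc (0:ℝ) 1, ∃ t ∈ Icc (0:ℝ) 1, X s = Y t := by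
  by_contra hcon
  push Not at hcon
  have z0 : (0:ℝ) ∈ Icc (0:ℝ) 1 := by simp
  have z1 : (1:ℝ) ∈ Icc (0:ℝ) 1 := by simp
  have nac : unitCirc a ≠ unitCirc c := unitCirc_ne (by linarith) (by linarith)
  have nbd : unitCirc b ≠ unitCirc d := unitCirc_ne (by linarith) (by linarith)
  have nab : unitCirc a ≠ unitCirc b := unitCirc_ne (by linarith) (by linarith)
  have nad : unitCirc a ≠ unitCirc d := unitCirc_ne (by linarith) (by linarith)
  have nbc : unitCirc b ≠ unitCirc c := unitCirc_ne (by linarith) (by linarith)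
  have ncd : unitCirc c ≠ unitCirc d := unitCirc_ne (by linarith) (by linarith)
  set S : ℝ → ℂ := fun t => (1 - (t:ℂ)) * unitCirc a + t * unitCirc c with hS
  set T : ℝ → ℂ := fun t => (1 - (t:ℂ)) * unitCirc b + t * unitCirc d with hT
  have S0 : S 0 = unitCirc a := by simp [hS]
  have S1 : S 1 = unitCirc c := by simp [hS]
  have T0 : T 0 = unitCirc b := by simp [hT]
  have T1 : T 1 = unitCirc d := by simp [hT]
  have Sc : Continuous S := by simp only [hS]; fun_prop
  have Tc : Continuous T := by simp only [hT]; fun_prop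
  have Sn : ∀ t ∈ Icc (0:ℝ) 1, ‖S t‖ ≤ 1 := fun t ht => (chord_norm nac ht).1
  have Tn : ∀ t ∈ Icc (0:ℝ) 1, ‖T t‖ ≤ 1 := fun t ht => (chord_norm nbd ht).1
  have Sn' : ∀ t ∈ Icc (0:ℝ) 1, ‖S t‖ = 1 → t = 0 ∨ t = 1 := fun t ht => (chord_norm nac ht).2
  have Tn' : ∀ t ∈ Icc (0:ℝ) 1, ‖T t‖ = 1 → t = 0 ∨ t = 1 := fun t ht => (chord_norm nbd ht).2
  have hne : ∀ s ∈ Icc (0:ℝ) 1, ∀ t ∈ Icc (0:ℝ) 1, S s = T t → ‖S s‖ < 1 := by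
    intro s hs t ht h
    refine lt_of_le_of_ne (Sn s hs) fun h1 => ?_
    have h2 : ‖T t‖ = 1 := by rw [← h, h1]
    rcases Sn' s hs h1 with rfl | rfl <;> rcases Tn' t ht h2 with rfl | rfl
    · rw [S0, T0] at h; exact nab h
    · rw [S0, T1] at h; exact nad h
    · rw [S1, T0] at h; exact nbc h.symm
    · rw [S1, T1] at h; exact ncd h
  have mS : ∀ t ∈ Icc (0:ℝ) 1, S t ∈ closedBall (0:ℂ) 1 := fun t ht => by simpa using Sn t ht
  have mT : ∀ t ∈ Icc (0:ℝ) 1, T t ∈ closedBall (0:ℂ) 1 := fun t ht => by simpa using Tn t ht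
  have HSc : ContinuousOn (fun t => H (S t)) (Icc 0 1) := hHc.comp Sc.continuousOn mS
  have HTc : ContinuousOn (fun t => H (T t)) (Icc 0 1) := hHc.comp Tc.continuousOn mT
  -- three squares
  obtain ⟨dl, dt, db, dr, h1, h2, h3, h4, h5⟩ := square (D := fun s t => X s - Y t)
    (sub_sq_cont hX hY) (fun s hs t ht => sub_ne_zero.2 (hcon s hs t ht))
  have XT : ∀ s ∈ Icc (0:ℝ) 1, ∀ t ∈ Icc (0:ℝ) 1, X s ≠ H (T t) := by
    intro s hs t ht h
    rcases lt_or_eq_of_le (Tn t ht) with h1 | h1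
    · exact nX s hs (h ▸ ⟨T t, by simpa using h1, rfl⟩)
    · rcases Tn' t ht h1 with rfl | rfl
      · exact hcon s hs 0 z0 (by rw [h, T0, Y0])
      · exact hcon s hs 1 z1 (by rw [h, T1, Y1])
  have SY : ∀ s ∈ Icc (0:ℝ) 1, ∀ t ∈ Icc (0:ℝ) 1, H (S s) ≠ Y t := by
    intro s hs t ht h
    rcases lt_or_eq_of_le (Sn s hs) with h1 | h1
    · exact nY t ht (h ▸ ⟨S s, by simpa using h1, rfl⟩)
    · rcases Sn' s hs h1 with rfl | rfl
      · exact hcon 0 z0 t ht (by rw [← h, S0, X0])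
      · exact hcon 1 z1 t ht (by rw [← h, S1, X1])
  obtain ⟨dl', dt', db', dr', h1', h2', h3', h4', h5'⟩ := square (D := fun s t => X s - H (T t))
    (sub_sq_cont hX HTc) (fun s hs t ht => sub_ne_zero.2 (XT s hs t ht))
  obtain ⟨dl'', dt'', db'', dr'', h1'', h2'', h3'', h4'', h5''⟩ :=
    square (D := fun s t => H (S s) - Y t)
    (sub_sq_cont HSc hY) (fun s hs t ht => sub_ne_zero.2 (SY s hs t ht))
  have ea : dt = dt' := h2.unique (h2'.congr (by simp [T1, Y1]))
  have eb : db = db' := h3.unique (h3'.congr (by simp [T0, Y0]))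
  have ec : dl = dl'' := h1.unique (h1''.congr (by simp [S0, X0]))
  have ed : dr = dr'' := h4.unique (h4''.congr (by simp [S1, X1]))
  -- the relation for `H ∘ S`, `H ∘ T`
  have key : dl' + dt'' = db'' + dr' := by
    rw [← ea, ← eb] at h5'; rw [← ec, ← ed] at h5''
    linear_combination h5' + h5'' - h5
  -- difference quotient square
  have Ec : ContinuousOn (fun p : ℝ × ℝ => Eq2 H (S p.1) (T p.2)) (Icc 0 1 ×ˢ Icc 0 1) := by
    rintro ⟨s, t⟩ ⟨hs, ht⟩
    simp only at hs ht
    by_cases he : S s = T t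
    · have hb : S s ∈ ball (0:ℂ) 1 := by simpa using hne s hs t ht he
      have h1 : ContinuousAt (fun p : ℂ × ℂ => Eq2 H p.1 p.2) (S s, T t) := by
        rw [← he]; exact Eq2_contAt isOpen_ball hHd hb
      have h2 : ContinuousAt (fun p : ℝ × ℝ => (S p.1, T p.2)) (s, t) := by
        apply Continuous.continuousAt; fun_prop
      exact (ContinuousAt.comp (f := fun p : ℝ × ℝ => (S p.1, T p.2)) (x := (s, t)) h1
        h2).continuousWithinAt
    · have h1 : ContinuousWithinAt (fun p : ℝ × ℝ => (H (S p.1) - H (T p.2)) / (S p.1 - T p.2))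
          (Icc 0 1 ×ˢ Icc 0 1) (s, t) := by
        refine ContinuousWithinAt.div ((sub_sq_cont HSc HTc) (s, t) ⟨hs, ht⟩) ?_ (sub_ne_zero.2 he)
        exact ((Sc.comp continuous_fst).sub (Tc.comp continuous_snd)).continuousWithinAt
      have h2 : ∀ᶠ p : ℝ × ℝ in 𝓝 (s, t), S p.1 ≠ T p.2 := by
        have : ContinuousAt (fun p : ℝ × ℝ => S p.1 - T p.2) (s, t) :=
          ((Sc.comp continuous_fst).sub (Tc.comp continuous_snd)).continuousAt
        filter_upwards [this.eventually_ne (sub_ne_zero.2 he)] with p hp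
        exact sub_ne_zero.1 hp
      refine h1.congr_of_eventuallyEq ?_ ?_
      · filter_upwards [h2.filter_mono nhdsWithin_le_nhds] with p hp
        simp [Eq2, hp]
      · simp [Eq2, he]
  have E0 : ∀ s ∈ Icc (0:ℝ) 1, ∀ t ∈ Icc (0:ℝ) 1, Eq2 H (S s) (T t) ≠ 0 := by
    intro s hs t ht
    unfold Eq2
    split_ifs with he
    · exact deriv_ne_zero_of_inj isOpen_ball hHd (hHi.mono ball_subset_closedBall)
        (by simpa using hne s hs t ht he)
    · exact div_ne_zero (sub_ne_zero.2 fun h => he (hHi (mS s hs) (mT t ht) h)) (sub_ne_zero.2 he)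
  obtain ⟨el, et, eb', er, k1, k2, k3, k4, k5⟩ := square (D := fun s t => Eq2 H (S s) (T t)) Ec E0
  have prod : ∀ x y, H x - H y = (x - y) * Eq2 H x y := by
    intro x y
    unfold Eq2
    split_ifs with h
    · simp [h]
    · field_simp [sub_ne_zero.2 h]
  have T_a : ∀ t ∈ Icc (0:ℝ) 1, T t ≠ S 0 := fun t ht h => by
    have := hne 0 z0 t ht h.symm; rw [S0, norm_unitCirc] at this; exact lt_irrefl _ this
  have T_c : ∀ t ∈ Icc (0:ℝ) 1, T t ≠ S 1 := fun t ht h => by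
    have := hne 1 z1 t ht h.symm; rw [S1, norm_unitCirc] at this; exact lt_irrefl _ this
  have S_b : ∀ t ∈ Icc (0:ℝ) 1, S t ≠ T 0 := fun t ht h => by
    have := hne t ht 0 z0 h; rw [h, T0, norm_unitCirc] at this; exact lt_irrefl _ this
  have S_d : ∀ t ∈ Icc (0:ℝ) 1, S t ≠ T 1 := fun t ht h => by
    have := hne t ht 1 z1 h; rw [h, T1, norm_unitCirc] at this; exact lt_irrefl _ this
  obtain ⟨fl, gl⟩ := HasInc.exists (f := fun t => S 0 - T t)
    (continuous_const.sub Tc).continuousOn (fun t ht => sub_ne_zero.2 (T_a t ht).symm)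
  obtain ⟨fr, gr⟩ := HasInc.exists (f := fun t => S 1 - T t)
    (continuous_const.sub Tc).continuousOn (fun t ht => sub_ne_zero.2 (T_c t ht).symm)
  obtain ⟨fb, gb⟩ := HasInc.exists (f := fun t => S t - T 0)
    (Sc.sub continuous_const).continuousOn (fun t ht => sub_ne_zero.2 (S_b t ht))
  obtain ⟨ft, gt⟩ := HasInc.exists (f := fun t => S t - T 1)
    (Sc.sub continuous_const).continuousOn (fun t ht => sub_ne_zero.2 (S_d t ht))
  have r1 : dl' = fl + el := h1'.unique ((gl.mul k1).congr fun t _ => by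
    rw [← prod, S0, X0])
  have r2 : dt'' = ft + et := h2''.unique ((gt.mul k2).congr fun t _ => by
    rw [← prod, T1, Y1])
  have r3 : db'' = fb + eb' := h3''.unique ((gb.mul k3).congr fun t _ => by
    rw [← prod, T0, Y0])
  have r4 : dr' = fr + er := h4'.unique ((gr.mul k4).congr fun t _ => by
    rw [← prod, S1, X1])
  refine inc_contra Sc.continuousOn Tc.continuousOn Sn Tn hab hbc hcd hda S0 S1 T0 T1 T_a T_c
    S_b S_d gl gt gb gr ?_
  rw [r1, r2, r3, r4] at key
  linear_combination key - k5

end Snk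

namespace Snk
section P4
open Filter Topology

lemma len_le {w : ℝ → ℂ} {a b : ℝ} (hab : a < b) (hc : ContinuousOn w (Icc a b))
    (hd : ContDiffOn ℝ 1 w (Ioo a b)) : ‖w b - w a‖ₑ ≤ ∫⁻ t in Ioo a b, ‖deriv w t‖ₑ := by
  have key : ∀ a' b', a < a' → a' ≤ b' → b' < b →
      ‖w b' - w a'‖ₑ ≤ ∫⁻ t in Ioo a b, ‖deriv w t‖ₑ := by
    intro a' b' h1 h2 h3
    have hs : Icc a' b' ⊆ Ioo a b := Icc_subset_Ioo h1 h3
    exact (enorm_sub_le_lintegral_deriv_of_contDiffOn_Icc (hd.mono hs) h2).trans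
      (lintegral_mono_set hs)
  set m := (a + b) / 2 with hm
  have hma : a < m := by rw [hm]; linarith
  have hmb : m < b := by rw [hm]; linarith
  have key2 : ∀ b', m ≤ b' → b' < b → ‖w b' - w a‖ₑ ≤ ∫⁻ t in Ioo a b, ‖deriv w t‖ₑ := by
    intro b' h1 h2
    have ht : Tendsto (fun x => ‖w b' - w x‖ₑ) (𝓝[>] a) (𝓝 ‖w b' - w a‖ₑ) := by
      have h0 : Tendsto w (𝓝[>] a) (𝓝 (w a)) :=
        ((hc a ⟨le_rfl, hab.le⟩).mono_of_mem_nhdsWithin (by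
          exact mem_of_superset (Ioo_mem_nhdsGT hab) Ioo_subset_Icc_self))
      exact (continuous_enorm.tendsto _).comp (tendsto_const_nhds.sub h0)
    refine le_of_tendsto ht ?_
    filter_upwards [Ioo_mem_nhdsGT hma] with x hx
    exact key x b' hx.1 (hx.2.le.trans h1) h2
  have ht : Tendsto (fun x => ‖w x - w a‖ₑ) (𝓝[<] b) (𝓝 ‖w b - w a‖ₑ) := by
    have h0 : Tendsto w (𝓝[<] b) (𝓝 (w b)) :=
      ((hc b ⟨hab.le, le_rfl⟩).mono_of_mem_nhdsWithin (by
        exact mem_of_superset (Ioo_mem_nhdsLT hab) Ioo_subset_Icc_self))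
    exact (continuous_enorm.tendsto _).comp (h0.sub tendsto_const_nhds)
  refine le_of_tendsto ht ?_
  filter_upwards [Ioo_mem_nhdsLT hmb] with x hx
  exact key2 x hx.1.le hx.2

/-- lower bound of the length when the density is at least k -/
lemma Lr_ge {ρ : ℂ → ℝ≥0∞} {γ : ℝ → ℂ} {a b : ℝ} (hab : a < b) (hc : ContinuousOn γ (Icc a b))
    (hd : ContDiffOn ℝ 1 γ (Ioo a b)) {k : ℝ≥0∞} (hk : k ≠ ∞) (h : ∀ t ∈ Ioo a b, k ≤ ρ (γ t)) :
    k * ‖γ b - γ a‖ₑ ≤ Lr ρ γ a b := by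
  calc k * ‖γ b - γ a‖ₑ ≤ k * ∫⁻ t in Ioo a b, ‖deriv γ t‖ₑ := by
        gcongr; exact len_le hab hc hd
    _ = ∫⁻ t in Ioo a b, k * ‖deriv γ t‖ₑ := (lintegral_const_mul' _ _ hk).symm
    _ ≤ Lr ρ γ a b := by
        refine setLIntegral_mono' measurableSet_Ioo fun t ht => ?_
        gcongr
        · exact h t ht
        · exact le_rfl

/-- Exit lemma -/
lemma exit_lemma {f : ℝ → ℝ} {t0 t1 r R : ℝ} (h01 : t0 ≤ t1) (hf : ContinuousOn f (Icc t0 t1))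
    (h0 : f t0 ≤ r) (hrR : r < R) (h1 : R ≤ f t1) :
    ∃ s0 s1, t0 ≤ s0 ∧ s0 < s1 ∧ s1 ≤ t1 ∧ f s0 = r ∧ f s1 = R ∧
      ∀ t ∈ Ioo s0 s1, r < f t ∧ f t < R := by
  -- s1 = first time with f ≥ R
  set A := Icc t0 t1 ∩ f ⁻¹' (Ici R) with hA
  have hAc : IsClosed A := hf.preimage_isClosed_of_isClosed isClosed_Icc isClosed_Ici
  have hAcomp : IsCompact A := isCompact_Icc.of_isClosed_subset hAc inter_subset_left
  obtain ⟨s1, hs1, hmin⟩ := hAcomp.exists_isLeast ⟨t1, ⟨h01, le_rfl⟩, h1⟩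
  have hs1R : ∀ t, t0 ≤ t → t < s1 → f t < R := by
    intro t ht hts
    by_contra hcon
    push Not at hcon
    exact absurd (hmin ⟨⟨ht, hts.le.trans hs1.1.2⟩, hcon⟩) (not_le.2 hts)
  have hf1 : ContinuousOn f (Icc t0 s1) := hf.mono (Icc_subset_Icc le_rfl hs1.1.2)
  set B := Icc t0 s1 ∩ f ⁻¹' (Iic r) with hB
  have hBc : IsClosed B := hf1.preimage_isClosed_of_isClosed isClosed_Icc isClosed_Iic
  have hBcomp : IsCompact B := isCompact_Icc.of_isClosed_subset hBc inter_subset_left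
  obtain ⟨s0, hs0, hmax⟩ := hBcomp.exists_isGreatest ⟨t0, ⟨le_rfl, hs1.1.1⟩, h0⟩
  have hs1' : R ≤ f s1 := hs1.2
  have hs0' : f s0 ≤ r := hs0.2
  have hlt : s0 < s1 := lt_of_le_of_ne hs0.1.2 (fun h => by rw [h] at hs0'; linarith)
  have hgt : ∀ t, s0 < t → t ≤ s1 → r < f t := by
    intro t ht hts
    by_contra hcon
    push Not at hcon
    exact absurd (hmax ⟨⟨hs0.1.1.trans ht.le, hts⟩, hcon⟩) (not_le.2 ht)
  have hf2 : ContinuousOn f (Icc s0 s1) := hf1.mono (Icc_subset_Icc hs0.1.1 le_rfl)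
  have e1 : f s1 = R := by
    by_contra hne
    have hlt' : R < f s1 := lt_of_le_of_ne hs1' (Ne.symm hne)
    obtain ⟨t, ht, hft⟩ := intermediate_value_Icc hlt.le hf2 (show R ∈ Icc (f s0) (f s1) from
      ⟨by linarith, hs1'⟩)
    have : t < s1 := lt_of_le_of_ne ht.2 (fun h => by rw [h] at hft; linarith)
    have := hs1R t (hs0.1.1.trans ht.1) this
    linarith
  have e0 : f s0 = r := by
    by_contra hne
    have hlt' : f s0 < r := lt_of_le_of_ne hs0' hne
    obtain ⟨t, ht, hft⟩ := intermediate_value_Icc hlt.le hf2 (show r ∈ Icc (f s0) (f s1) from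
      ⟨hs0', by linarith⟩)
    have : s0 < t := lt_of_le_of_ne ht.1 (fun h => by rw [← h] at hft; linarith)
    have := hgt t this ht.2
    linarith
  exact ⟨s0, s1, hs0.1.1, hlt, hs1.1.2, e0, e1, fun t ht =>
    ⟨hgt t ht.1 ht.2.le, hs1R t (hs0.1.1.trans ht.1.le) ht.2⟩⟩

/-- change of variables -/
lemma Lr_comp (ρ : ℂ → ℝ≥0∞) {γ σ : ℝ → ℂ} {φ φ' : ℝ → ℝ} {a b : ℝ} {c d : ℝ}
    (hφ : ∀ t ∈ Ioo a b, HasDerivAt φ (φ' t) t) (hpos : ∀ t ∈ Ioo a b, 0 ≤ φ' t)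
    (hm : MonotoneOn φ (Ioo a b)) (him : φ '' Ioo a b = Ioo c d)
    (hγ : ∀ t ∈ Ioo c d, DifferentiableAt ℝ γ t)
    (hσ : ∀ t ∈ Ioo a b, σ t = γ (φ t)) : Lr ρ σ a b = Lr ρ γ c d := by
  unfold Lr
  rw [← him, lintegral_image_eq_lintegral_deriv_mul_of_monotoneOn measurableSet_Ioo
    (fun x hx => (hφ x hx).hasDerivWithinAt) hm]
  refine setLIntegral_congr_fun measurableSet_Ioo fun t ht => ?_
  have hd : HasDerivAt σ (φ' t • deriv γ (φ t)) t := by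
    have h1 := (hγ (φ t) (him ▸ mem_image_of_mem φ ht)).hasDerivAt.scomp t (hφ t ht)
    refine h1.congr_of_eventuallyEq ?_
    filter_upwards [isOpen_Ioo.mem_nhds ht] with x hx
    exact hσ x hx
  rw [hd.deriv, hσ t ht, nnnorm_smul, ENNReal.coe_mul]
  have : (‖φ' t‖₊ : ℝ≥0∞) = ENNReal.ofReal (φ' t) :=
    Real.enorm_of_nonneg (hpos t ht)
  rw [this]; ring

lemma curve_diff {γ : ℝ → ℂ} (h : IsCurve γ) {t : ℝ} (ht : t ∈ Ioo (0:ℝ) 1) :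
    DifferentiableAt ℝ γ t :=
  ((h.2.differentiableOn (by norm_num)) t ht).differentiableAt (isOpen_Ioo.mem_nhds ht)

lemma sub_curve {γ : ℝ → ℂ} (h : IsCurve γ) {s0 s1 : ℝ} (h0 : 0 ≤ s0) (h01 : s0 < s1)
    (h1 : s1 ≤ 1) : IsCurve (fun t => γ (s0 + (s1 - s0) * t)) ∧
    ∀ ρ, Lr ρ (fun t => γ (s0 + (s1 - s0) * t)) 0 1 = Lr ρ γ s0 s1 := by
  have hd : 0 < s1 - s0 := by linarith
  refine ⟨⟨?_, ?_⟩, fun ρ => ?_⟩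
  · refine h.1.comp (by fun_prop) fun t ht => ⟨?_, ?_⟩
    · nlinarith [ht.1, ht.2]
    · nlinarith [ht.1, ht.2]
  · refine h.2.comp (by fun_prop) fun t ht => ⟨?_, ?_⟩
    · nlinarith [ht.1, ht.2, mul_pos hd ht.1]
    · nlinarith [ht.1, ht.2]
  · refine Lr_comp ρ (φ := fun t => s0 + (s1 - s0) * t) (φ' := fun _ => s1 - s0) ?_ ?_ ?_ ?_ ?_ ?_
    · intro t _
      simpa using ((hasDerivAt_id t).const_mul (s1 - s0)).const_add s0
    · intro t _; exact hd.le
    · intro x _ y _ hxy; simp only []; nlinarith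
    · ext x; constructor
      · rintro ⟨t, ht, rfl⟩; exact ⟨by nlinarith [ht.1, mul_pos hd ht.1], by nlinarith [ht.2]⟩
      · intro hx
        refine ⟨(x - s0) / (s1 - s0), ⟨div_pos (by linarith [hx.1]) hd, ?_⟩, ?_⟩
        · rw [div_lt_one hd]; linarith [hx.2]
        · simp only []; field_simp; ring
    · intro t ht; exact curve_diff h ⟨by linarith [ht.1], by linarith [ht.2]⟩
    · intro t _; rfl

lemma cube_deriv (x : ℝ) : HasDerivAt (fun x : ℝ => (max x 0) ^ 3) (3 * (max x 0) ^ 2) x := by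
  rcases lt_trichotomy x 0 with h | h | h
  · have : HasDerivAt (fun _ : ℝ => (0:ℝ)) 0 x := hasDerivAt_const _ _
    rw [max_eq_right h.le]
    simp only [ne_eq, OfNat.ofNat_ne_zero, not_false_eq_true, zero_pow, mul_zero]
    refine this.congr_of_eventuallyEq ?_
    filter_upwards [gt_mem_nhds h] with y hy
    rw [max_eq_right hy.le]; norm_num
  · subst h
    rw [hasDerivAt_iff_isLittleO_nhds_zero]
    simp only [zero_add, max_self, ne_eq, OfNat.ofNat_ne_zero, not_false_eq_true, zero_pow,
      mul_zero, smul_zero, sub_zero]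
    have h2 : (fun h : ℝ => (max h 0) ^ 3) =O[𝓝 0] (fun h : ℝ => h ^ 3) := by
      refine Asymptotics.IsBigO.of_bound 1 (Eventually.of_forall fun y => ?_)
      rw [one_mul, norm_pow, norm_pow]
      gcongr
      rw [Real.norm_eq_abs, Real.norm_eq_abs]
      rcases le_total y 0 with hy | hy
      · rw [max_eq_right hy]; simp
      · rw [max_eq_left hy]
    refine h2.trans_isLittleO ?_
    simpa using (Asymptotics.isLittleO_pow_pow (𝕜 := ℝ) (m := 1) (n := 3) (by norm_num))
  · have : HasDerivAt (fun x : ℝ => x ^ 3) (3 * x ^ 2) x := by simpa using hasDerivAt_pow 3 x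
    rw [max_eq_left h.le]
    refine this.congr_of_eventuallyEq ?_
    filter_upwards [lt_mem_nhds h] with y hy
    rw [max_eq_left hy.le]

lemma cube_contDiff : ContDiff ℝ 1 (fun x : ℝ => (max x 0) ^ 3) := by
  rw [contDiff_one_iff_deriv]
  refine ⟨fun x => (cube_deriv x).differentiableAt, ?_⟩
  have : deriv (fun x : ℝ => (max x 0) ^ 3) = fun x => 3 * (max x 0) ^ 2 := by
    ext x; exact (cube_deriv x).deriv
  rw [this]; fun_prop

lemma crt_cube {x : ℝ} (hx : 0 ≤ x) : (x ^ (1/3:ℝ)) ^ 3 = x := by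
  rw [← Real.rpow_natCast, ← Real.rpow_mul hx]; norm_num

lemma crt_cube' {x : ℝ} (hx : 0 ≤ x) : (x ^ 3) ^ (1/3:ℝ) = x := by
  rw [← Real.rpow_natCast, ← Real.rpow_mul hx]; norm_num

/-- Concatenation of `γ0|[0,s]` and `γ|[s',1]`. -/
lemma swap {γ0 γ : ℝ → ℂ} (hγ0 : IsCurve γ0) (hγ : IsCurve γ) {s s' : ℝ} (hs : s ∈ Ioo (0:ℝ) 1)
    (hs' : s' ∈ Ioo (0:ℝ) 1) (h : γ0 s = γ s') :
    ∃ (σ : ℝ → ℂ) (α β : ℝ → ℝ), IsCurve σ ∧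
      (∀ ρ, Lr ρ σ 0 1 = Lr ρ γ0 0 s + Lr ρ γ s' 1) ∧
      StrictMonoOn α (Icc 0 s) ∧ StrictMonoOn β (Icc s' 1) ∧
      α 0 = 0 ∧ α s = 1/2 ∧ β s' = 1/2 ∧ β 1 = 1 ∧
      (∀ r ∈ Icc 0 s, σ (α r) = γ0 r) ∧ (∀ r ∈ Icc s' 1, σ (β r) = γ r) ∧
      (∀ t ∈ Icc (0:ℝ) (1/2), ∃ r ∈ Icc 0 s, α r = t) ∧
      (∀ t ∈ Icc (1/2:ℝ) 1, ∃ r ∈ Icc s' 1, β r = t) := by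
  obtain ⟨hs0, hs1⟩ := hs
  obtain ⟨hs0', hs1'⟩ := hs'
  have h1s' : 0 < 1 - s' := by linarith
  set A : ℝ → ℝ := fun t => s * (1 - (max (1 - 2 * t) 0) ^ 3) with hA
  set B : ℝ → ℝ := fun t => s' + (1 - s') * (max (2 * t - 1) 0) ^ 3 with hB
  have hAc : ContDiff ℝ 1 A :=
    contDiff_const.mul (contDiff_const.sub (cube_contDiff.comp (by fun_prop)))
  have hBc : ContDiff ℝ 1 B :=
    contDiff_const.add (contDiff_const.mul (cube_contDiff.comp (by fun_prop)))
  have hAr : ∀ t, 1/2 ≤ t → A t = s := by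
    intro t ht; simp only [hA]; rw [max_eq_right (by linarith)]; ring
  have hBl : ∀ t, t ≤ 1/2 → B t = s' := by
    intro t ht; simp only [hB]; rw [max_eq_right (by linarith)]; ring
  have hAl : ∀ t, t ≤ 1/2 → A t = s * (1 - (1 - 2 * t) ^ 3) := by
    intro t ht; simp only [hA]; rw [max_eq_left (by linarith)]
  have hBr : ∀ t, 1/2 ≤ t → B t = s' + (1 - s') * (2 * t - 1) ^ 3 := by
    intro t ht; simp only [hB]; rw [max_eq_left (by linarith)]
  have hA0 : ∀ t, 0 ≤ t → 0 ≤ A t ∧ A t ≤ s := by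
    intro t ht
    have e1 : max (1 - 2 * t) 0 ≤ 1 := max_le (by linarith) (by norm_num)
    have e2 : 0 ≤ max (1 - 2 * t) 0 := le_max_right _ _
    have e3 : (max (1 - 2 * t) 0) ^ 3 ≤ 1 := pow_le_one₀ e2 e1
    have e4 : 0 ≤ (max (1 - 2 * t) 0) ^ 3 := by positivity
    simp only [hA]
    constructor <;> nlinarith
  have hA0' : ∀ t, 0 < t → 0 < A t := by
    intro t ht
    have e1 : max (1 - 2 * t) 0 < 1 := max_lt (by linarith) (by norm_num)
    have e2 : 0 ≤ max (1 - 2 * t) 0 := le_max_right _ _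
    have e3 : (max (1 - 2 * t) 0) ^ 3 < 1 := pow_lt_one₀ e2 e1 (by norm_num)
    simp only [hA]
    exact mul_pos hs0 (by linarith)
  have hB1 : ∀ t, t ≤ 1 → s' ≤ B t ∧ B t ≤ 1 := by
    intro t ht
    have e1 : max (2 * t - 1) 0 ≤ 1 := max_le (by linarith) (by norm_num)
    have e2 : 0 ≤ max (2 * t - 1) 0 := le_max_right _ _
    have e3 : (max (2 * t - 1) 0) ^ 3 ≤ 1 := pow_le_one₀ e2 e1
    have e4 : 0 ≤ (max (2 * t - 1) 0) ^ 3 := by positivity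
    simp only [hB]
    constructor <;> nlinarith
  have hB1' : ∀ t, t < 1 → B t < 1 := by
    intro t ht
    have e1 : max (2 * t - 1) 0 < 1 := max_lt (by linarith) (by norm_num)
    have e2 : 0 ≤ max (2 * t - 1) 0 := le_max_right _ _
    have e3 : (max (2 * t - 1) 0) ^ 3 < 1 := pow_lt_one₀ e2 e1 (by norm_num)
    simp only [hB]
    nlinarith
  set σ : ℝ → ℂ := fun t => γ0 (A t) + γ (B t) - γ0 s with hσ
  have hσl : ∀ t, t ≤ 1/2 → σ t = γ0 (A t) := by
    intro t ht; simp only [hσ]; rw [hBl t ht, h]; ring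
  have hσr : ∀ t, 1/2 ≤ t → σ t = γ (B t) := by
    intro t ht; simp only [hσ]; rw [hAr t ht]; ring
  have hcurve : IsCurve σ := by
    refine ⟨?_, ?_⟩
    · refine ((hγ0.1.comp hAc.continuous.continuousOn fun t ht => ?_).add
        (hγ.1.comp hBc.continuous.continuousOn fun t ht => ?_)).sub continuousOn_const
      · exact ⟨(hA0 t ht.1).1, (hA0 t ht.1).2.trans hs1.le⟩
      · exact ⟨hs0'.le.trans (hB1 t ht.2).1, (hB1 t ht.2).2⟩
    · refine ((hγ0.2.comp hAc.contDiffOn fun t ht => ?_).add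
        (hγ.2.comp hBc.contDiffOn fun t ht => ?_)).sub contDiffOn_const
      · exact ⟨hA0' t ht.1, (hA0 t ht.1.le).2.trans_lt hs1⟩
      · exact ⟨hs0'.trans_le (hB1 t ht.2.le).1, hB1' t ht.2⟩
  set α : ℝ → ℝ := fun r => (1 - (1 - r / s) ^ (1/3:ℝ)) / 2 with hα
  set β : ℝ → ℝ := fun r => (1 + ((r - s') / (1 - s')) ^ (1/3:ℝ)) / 2 with hβ
  have hx0 : ∀ r ∈ Icc 0 s, 0 ≤ 1 - r / s := by
    intro r hr
    have : r / s ≤ 1 := (div_le_one hs0).2 hr.2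
    linarith
  have hy0 : ∀ r ∈ Icc s' 1, 0 ≤ (r - s') / (1 - s') := by
    intro r hr
    exact div_nonneg (by linarith [hr.1]) h1s'.le
  have hαA : ∀ r ∈ Icc 0 s, α r ≤ 1/2 ∧ A (α r) = r := by
    intro r hr
    have e1 : 0 ≤ (1 - r / s) ^ (1/3:ℝ) := Real.rpow_nonneg (hx0 r hr) _
    have e2 : α r ≤ 1/2 := by simp only [hα]; linarith
    refine ⟨e2, ?_⟩
    rw [hAl _ e2]
    have : 1 - 2 * α r = (1 - r / s) ^ (1/3:ℝ) := by simp only [hα]; ring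
    rw [this, crt_cube (hx0 r hr)]
    field_simp; ring
  have hβB : ∀ r ∈ Icc s' 1, 1/2 ≤ β r ∧ B (β r) = r := by
    intro r hr
    have e1 : 0 ≤ ((r - s') / (1 - s')) ^ (1/3:ℝ) := Real.rpow_nonneg (hy0 r hr) _
    have e2 : 1/2 ≤ β r := by simp only [hβ]; linarith
    refine ⟨e2, ?_⟩
    rw [hBr _ e2]
    have : 2 * β r - 1 = ((r - s') / (1 - s')) ^ (1/3:ℝ) := by simp only [hβ]; ring
    rw [this, crt_cube (hy0 r hr)]
    field_simp; ring
  have hαsurj : ∀ t ∈ Icc (0:ℝ) (1/2), ∃ r ∈ Icc 0 s, α r = t := by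
    intro t ht
    refine ⟨A t, hA0 t ht.1, ?_⟩
    rw [hAl t ht.2]
    simp only [hα]
    have : 1 - s * (1 - (1 - 2 * t) ^ 3) / s = (1 - 2 * t) ^ 3 := by field_simp; ring
    rw [this, crt_cube' (by linarith [ht.2])]; ring
  have hβsurj : ∀ t ∈ Icc (1/2:ℝ) 1, ∃ r ∈ Icc s' 1, β r = t := by
    intro t ht
    refine ⟨B t, hB1 t ht.2, ?_⟩
    rw [hBr t ht.1]
    simp only [hβ]
    have : (s' + (1 - s') * (2 * t - 1) ^ 3 - s') / (1 - s') = (2 * t - 1) ^ 3 := by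
      field_simp; ring
    rw [this, crt_cube' (by linarith [ht.1])]; ring
  have hαm : StrictMonoOn α (Icc 0 s) := by
    intro x hx y hy hxy
    have : (1 - y / s) ^ (1/3:ℝ) < (1 - x / s) ^ (1/3:ℝ) := by
      refine Real.rpow_lt_rpow (hx0 y hy) ?_ (by norm_num)
      have : x / s < y / s := by gcongr
      linarith
    simp only [hα]; linarith
  have hβm : StrictMonoOn β (Icc s' 1) := by
    intro x hx y hy hxy
    have : ((x - s') / (1 - s')) ^ (1/3:ℝ) < ((y - s') / (1 - s')) ^ (1/3:ℝ) := by
      refine Real.rpow_lt_rpow (hy0 x hx) ?_ (by norm_num)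
      gcongr
    simp only [hβ]; linarith
  have hAder : ∀ t, HasDerivAt A (6 * s * (max (1 - 2 * t) 0) ^ 2) t := by
    intro t
    have e1 : HasDerivAt (fun t : ℝ => 1 - 2 * t) (-2) t := by
      simpa using ((hasDerivAt_id t).const_mul 2).const_sub 1
    have e2 := (cube_deriv (1 - 2 * t)).comp t e1
    have e3 := (e2.const_sub 1).const_mul s
    refine e3.congr_deriv ?_
    ring
  have hBder : ∀ t, HasDerivAt B (6 * (1 - s') * (max (2 * t - 1) 0) ^ 2) t := by
    intro t
    have e1 : HasDerivAt (fun t : ℝ => 2 * t - 1) 2 t := by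
      simpa using ((hasDerivAt_id t).const_mul 2).sub_const 1
    have e2 := (cube_deriv (2 * t - 1)).comp t e1
    have e3 := (e2.const_mul (1 - s')).const_add s'
    refine e3.congr_deriv ?_
    ring
  have hα0 : α 0 = 0 := by simp [hα]
  have hαs : α s = 1/2 := by
    simp only [hα]; rw [div_self hs0.ne', sub_self, Real.zero_rpow (by norm_num)]; norm_num
  have hβs : β s' = 1/2 := by
    simp only [hβ]; rw [sub_self, zero_div, Real.zero_rpow (by norm_num)]; norm_num
  have hβ1 : β 1 = 1 := by
    simp only [hβ]; rw [div_self h1s'.ne', Real.one_rpow]; norm_num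
  refine ⟨σ, α, β, hcurve, fun ρ => ?_, hαm, hβm, hα0, hαs, hβs, hβ1, ?_, ?_, hαsurj, hβsurj⟩
  · rw [Lr_split ρ σ (show (0:ℝ) ≤ 1/2 by norm_num) (by norm_num)]
    congr 1
    · refine Lr_comp ρ (φ := A) (φ' := fun t => 6 * s * (max (1 - 2 * t) 0) ^ 2) (fun t _ => hAder t)
        (fun t _ => by positivity) ?_ ?_ ?_ ?_
      · intro x _ y _ hxy
        simp only [hA]
        gcongr
      · ext x; constructor
        · rintro ⟨t, ht, rfl⟩
          refine ⟨hA0' t ht.1, ?_⟩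
          rw [hAl t ht.2.le]
          have : 0 < (1 - 2 * t) ^ 3 := pow_pos (by linarith [ht.2]) 3
          nlinarith
        · intro hx
          refine ⟨α x, ⟨?_, ?_⟩, (hαA x ⟨hx.1.le, hx.2.le⟩).2⟩
          · rw [← hα0]; exact hαm ⟨le_rfl, hs0.le⟩ ⟨hx.1.le, hx.2.le⟩ hx.1
          · rw [← hαs]; exact hαm ⟨hx.1.le, hx.2.le⟩ ⟨hs0.le, le_rfl⟩ hx.2
      · intro t ht; exact curve_diff hγ0 ⟨ht.1, ht.2.trans hs1⟩
      · intro t ht; exact hσl t ht.2.le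
    · refine Lr_comp ρ (φ := B) (φ' := fun t => 6 * (1 - s') * (max (2 * t - 1) 0) ^ 2)
        (fun t _ => hBder t) (fun t _ => by positivity) ?_ ?_ ?_ ?_
      · intro x _ y _ hxy
        simp only [hB]
        gcongr
      · ext x; constructor
        · rintro ⟨t, ht, rfl⟩
          refine ⟨?_, hB1' t ht.2⟩
          rw [hBr t ht.1.le]
          have : 0 < (2 * t - 1) ^ 3 := pow_pos (by linarith [ht.1]) 3
          nlinarith
        · intro hx
          refine ⟨β x, ⟨?_, ?_⟩, (hβB x ⟨hx.1.le, hx.2.le⟩).2⟩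
          · rw [← hβs]; exact hβm ⟨le_rfl, hs1'.le⟩ ⟨hx.1.le, hx.2.le⟩ hx.1
          · rw [← hβ1]; exact hβm ⟨hx.1.le, hx.2.le⟩ ⟨hs1'.le, le_rfl⟩ hx.2
      · intro t ht; exact curve_diff hγ ⟨hs0'.trans ht.1, ht.2⟩
      · intro t ht; exact hσr t ht.1.le
  · intro r hr
    rw [hσl _ (hαA r hr).1, (hαA r hr).2]
  · intro r hr
    rw [hσr _ (hβB r hr).1, (hβB r hr).2]

end P4
end Snk

namespace Snk
section P5
open Filter Topology

def nrm (ρ : ℂ → ℝ≥0∞) : ℝ≥0∞ := (∫⁻ z, ρ z ^ (2:ℝ)) ^ (1/2:ℝ)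

lemma nrm_sq (ρ : ℂ → ℝ≥0∞) : nrm ρ ^ 2 = mass ρ := by
  unfold nrm mass
  rw [← ENNReal.rpow_natCast, ← ENNReal.rpow_mul]
  norm_num

lemma nrm_add {ρ ρ' : ℂ → ℝ≥0∞} (h : Measurable ρ) (h' : Measurable ρ') :
    nrm (fun z => ρ z + ρ' z) ≤ nrm ρ + nrm ρ' := by
  have := ENNReal.lintegral_Lp_add_le (p := 2) (μ := (volume : Measure ℂ)) h.aemeasurable
    h'.aemeasurable (by norm_num)
  simpa [nrm] using this

lemma nrm_smul {k : ℝ≥0∞} {ρ : ℂ → ℝ≥0∞} (h : Measurable ρ) :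
    nrm (fun z => k * ρ z) = k * nrm ρ := by
  unfold nrm
  have : ∀ z, (k * ρ z) ^ (2:ℝ) = k ^ (2:ℝ) * ρ z ^ (2:ℝ) := fun z =>
    ENNReal.mul_rpow_of_nonneg _ _ (by norm_num)
  simp_rw [this]
  rw [lintegral_const_mul _ (h.pow_const _), ENNReal.mul_rpow_of_nonneg _ _ (by norm_num),
    ← ENNReal.rpow_mul]
  norm_num

lemma tight {F : Set (ℝ → ℂ)} (N : (ℝ → ℂ) → ℝ≥0∞) {ρc : ℂ → ℝ≥0∞} (hρc : Measurable ρc)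
    (hN : ∀ γ ∈ F, N γ ≤ Lr ρc γ 0 1) (hfin : mass ρc ≠ ∞) (hW : extremalWidth F ≠ ∞) :
    ∃ κ : ℝ, 0 < κ ∧ ∀ ε : ℝ, 0 < ε → ∃ ρ : ℂ → ℝ≥0∞, Measurable ρ ∧
      (∀ γ ∈ F, 1 + ENNReal.ofReal κ * N γ ≤ Lr ρ γ 0 1) ∧
      extremalWidth F ≤ extremalWidth
        {γ ∈ F | Lr ρ γ 0 1 < 1 + ENNReal.ofReal κ * N γ + ENNReal.ofReal ε} + 1 := by
  have hAf : nrm ρc ≠ ∞ := by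
    intro h; apply hfin; rw [← nrm_sq, h]; norm_num
  set w : ℝ := Real.sqrt (extremalWidth F).toReal with hw
  have hw0 : 0 ≤ w := Real.sqrt_nonneg _
  have hw2 : w ^ 2 = (extremalWidth F).toReal := Real.sq_sqrt ENNReal.toReal_nonneg
  set A : ℝ := (nrm ρc).toReal with hA
  have hA0 : 0 ≤ A := ENNReal.toReal_nonneg
  have hAe : nrm ρc = ENNReal.ofReal A := (ENNReal.ofReal_toReal hAf).symm
  set D : ℝ := (2 * w + A + 1) * (A + 1) with hD
  have hD0 : 0 < D := by positivity
  set κ : ℝ := min 1 (1 / D) with hκ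
  have hκ0 : 0 < κ := lt_min one_pos (by positivity)
  have hκ1 : κ ≤ 1 := min_le_left _ _
  have hκD : κ * D ≤ 1 := by
    have : κ ≤ 1 / D := min_le_right _ _
    rwa [le_div_iff₀ hD0] at this
  refine ⟨κ, hκ0, fun ε hε => ?_⟩
  set P : Set (ℂ → ℝ≥0∞) := {ρ | Measurable ρ ∧
    ∀ γ ∈ F, 1 + ENNReal.ofReal κ * N γ ≤ Lr ρ γ 0 1} with hP
  set M : ℝ≥0∞ := ⨅ ρ ∈ P, nrm ρ with hM
  have hk : ENNReal.ofReal κ ≠ ∞ := ENNReal.ofReal_ne_top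
  -- M finite
  have hMf : M ≠ ∞ := by
    obtain ⟨ρ0, h1, h2⟩ := exists_adm_of_lt (lt_top_iff_ne_top.2 hW)
    have hmem : (fun z => ρ0 z + ENNReal.ofReal κ * ρc z) ∈ P := by
      refine ⟨h1.1.add (hρc.const_mul _), fun γ hγ => ?_⟩
      refine le_trans (add_le_add (h1.2 γ hγ) ?_) (Lr_add _ _ _ _ _)
      rw [Lr_const_mul hk]
      gcongr
      exact hN γ hγ
    have h3 : M ≤ nrm (fun z => ρ0 z + ENNReal.ofReal κ * ρc z) := iInf₂_le _ hmem
    have h4 : nrm ρ0 ≠ ∞ := by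
      intro h; rw [← nrm_sq, h] at h2; norm_num at h2
    refine ne_top_of_le_ne_top ?_ (h3.trans (nrm_add h1.1 (hρc.const_mul _)))
    rw [nrm_smul hρc]
    exact ENNReal.add_ne_top.2 ⟨h4, ENNReal.mul_ne_top hk hAf⟩
  set Mr : ℝ := M.toReal with hMr
  have hMe : M = ENNReal.ofReal Mr := (ENNReal.ofReal_toReal hMf).symm
  have hMr0 : 0 ≤ Mr := ENNReal.toReal_nonneg
  have hwM : w ≤ Mr := by
    have h1 : extremalWidth F ≤ M ^ 2 := by
      have h2 : ∀ ρ ∈ P, (extremalWidth F) ^ (1/2:ℝ) ≤ nrm ρ := by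
        intro ρ hρ
        have : extremalWidth F ≤ mass ρ := width_le ⟨hρ.1, fun γ hγ =>
          le_self_add.trans (hρ.2 γ hγ)⟩
        calc (extremalWidth F) ^ (1/2:ℝ) ≤ (mass ρ) ^ (1/2:ℝ) := by gcongr
          _ = nrm ρ := by
            rw [← nrm_sq, ← ENNReal.rpow_natCast, ← ENNReal.rpow_mul]; norm_num
      have h3 : (extremalWidth F) ^ (1/2:ℝ) ≤ M := le_iInf₂ h2
      calc extremalWidth F = ((extremalWidth F) ^ (1/2:ℝ)) ^ 2 := by
            rw [← ENNReal.rpow_natCast, ← ENNReal.rpow_mul]; norm_num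
        _ ≤ M ^ 2 := by gcongr
    have h2 : (extremalWidth F).toReal ≤ Mr ^ 2 := by
      have := ENNReal.toReal_mono (ENNReal.pow_ne_top hMf) h1
      rwa [ENNReal.toReal_pow] at this
    rw [hw]; exact (Real.sqrt_le_sqrt h2).trans_eq (Real.sqrt_sq hMr0)
  set s : ℝ := ε / (1 + ε) with hs
  have hs0 : 0 < s := by positivity
  have hs1 : s < 1 := by rw [hs, div_lt_one (by positivity)]; linarith
  have hsε : (1 - s) * (1 + ε) = 1 := by rw [hs]; field_simp; ring
  obtain ⟨ρ, hρP, hρM⟩ : ∃ ρ ∈ P, nrm ρ < M + ENNReal.ofReal (s * κ) := by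
    have : M < M + ENNReal.ofReal (s * κ) :=
      ENNReal.lt_add_right hMf (by simp; positivity)
    rw [hM] at this
    obtain ⟨ρ, h⟩ := iInf_lt_iff.1 this
    obtain ⟨h1, h⟩ := iInf_lt_iff.1 h
    exact ⟨ρ, h1, h⟩
  refine ⟨ρ, hρP.1, hρP.2, ?_⟩
  rw [← tsub_le_iff_right]
  refine le_width fun ρ' hρ' => ?_
  rw [tsub_le_iff_right]
  by_cases hn : nrm ρ' = ∞
  · rw [← nrm_sq, hn]; norm_num
  set n : ℝ := (nrm ρ').toReal with hnr
  have hn0 : 0 ≤ n := ENNReal.toReal_nonneg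
  have hne : nrm ρ' = ENNReal.ofReal n := (ENNReal.ofReal_toReal hn).symm
  set R : ℝ≥0∞ := ENNReal.ofReal (1 - s)
  set S : ℝ≥0∞ := ENNReal.ofReal s
  have hRf : R ≠ ∞ := ENNReal.ofReal_ne_top
  have hSf : S ≠ ∞ := ENNReal.ofReal_ne_top
  have hRS : R + S = 1 := by
    rw [← ENNReal.ofReal_add (by linarith) hs0.le]; simp
  have hRε : R * (1 + ENNReal.ofReal ε) = 1 := by
    rw [← ENNReal.ofReal_one, ← ENNReal.ofReal_add (by norm_num) hε.le,
      ← ENNReal.ofReal_mul (by linarith), hsε]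
  have hmeas' : Measurable (fun z => ρ' z + ENNReal.ofReal κ * ρc z) :=
    hρ'.1.add (hρc.const_mul _)
  have hmem : (fun z => R * ρ z + S * (ρ' z + ENNReal.ofReal κ * ρc z)) ∈ P := by
    refine ⟨(hρP.1.const_mul _).add (hmeas'.const_mul _), fun γ hγ => ?_⟩
    have hL : R * Lr ρ γ 0 1 + S * (Lr ρ' γ 0 1 + ENNReal.ofReal κ * Lr ρc γ 0 1) ≤
        Lr (fun z => R * ρ z + S * (ρ' z + ENNReal.ofReal κ * ρc z)) γ 0 1 := by
      refine le_trans ?_ (Lr_add _ _ _ _ _)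
      rw [Lr_const_mul hRf, Lr_const_mul hSf]
      gcongr
      refine le_trans ?_ (Lr_add _ _ _ _ _)
      rw [Lr_const_mul hk]
    refine le_trans ?_ hL
    by_cases ht : Lr ρ γ 0 1 < 1 + ENNReal.ofReal κ * N γ + ENNReal.ofReal ε
    · have h1 := hρ'.2 γ ⟨hγ, ht⟩
      calc 1 + ENNReal.ofReal κ * N γ = R * (1 + ENNReal.ofReal κ * N γ) +
            S * (1 + ENNReal.ofReal κ * N γ) := by rw [← add_mul, hRS, one_mul]
        _ ≤ _ := by
          gcongr
          · exact hρP.2 γ hγ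
          · exact hN γ hγ
    · push Not at ht
      calc 1 + ENNReal.ofReal κ * N γ = R * (1 + ENNReal.ofReal ε) +
            (R + S) * (ENNReal.ofReal κ * N γ) := by rw [hRS, one_mul, hRε]
        _ = R * (1 + ENNReal.ofReal κ * N γ + ENNReal.ofReal ε) +
            S * (0 + ENNReal.ofReal κ * N γ) := by ring
        _ ≤ _ := by
          gcongr
          · simp
          · exact hN γ hγ
  have hMle : M ≤ R * (M + ENNReal.ofReal (s * κ)) + S * (nrm ρ' + ENNReal.ofReal κ * nrm ρc) := by
    refine (iInf₂_le _ hmem).trans ((nrm_add (hρP.1.const_mul _) (hmeas'.const_mul _)).trans ?_)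
    rw [nrm_smul hρP.1, nrm_smul hmeas']
    gcongr
    refine (nrm_add hρ'.1 (hρc.const_mul _)).trans ?_
    rw [nrm_smul hρc]
  have hreal : Mr ≤ (1 - s) * (Mr + s * κ) + s * (n + κ * A) := by
    rw [hMe, hne, hAe] at hMle
    have h1s : 0 ≤ 1 - s := by linarith
    rw [← ENNReal.ofReal_add hMr0 (by positivity), ← ENNReal.ofReal_mul h1s,
      ← ENNReal.ofReal_mul hκ0.le, ← ENNReal.ofReal_add hn0 (by positivity),
      ← ENNReal.ofReal_mul hs0.le, ← ENNReal.ofReal_add (by positivity) (by positivity)] at hMle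
    exact (ENNReal.ofReal_le_ofReal_iff (by positivity)).1 hMle
  have hMn : Mr ≤ n + κ * (A + 1) := by
    have : s * Mr ≤ s * (n + κ * (A + 1)) := by nlinarith [mul_pos hs0 hκ0, mul_pos hs0 hs0]
    exact le_of_mul_le_mul_left this hs0
  have hfinal : (extremalWidth F).toReal ≤ n ^ 2 + 1 := by
    rw [← hw2]
    rcases le_total w n with h | h
    · nlinarith
    · set ξ := κ * (A + 1) with hξ
      have hξ0 : 0 ≤ ξ := by positivity
      have hξ1 : ξ ≤ A + 1 := by rw [hξ]; nlinarith
      have h5 : ξ * (2 * w + A + 1) ≤ 1 := by rw [hξ]; rw [hD] at hκD; nlinarith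
      have h6 : w ≤ n + ξ := hwM.trans hMn
      nlinarith [mul_nonneg hξ0 (sub_nonneg.2 h), mul_nonneg hξ0 (sub_nonneg.2 hξ1)]
  rw [← nrm_sq, hne, ← ENNReal.ofReal_toReal hW, ← ENNReal.ofReal_pow hn0, ← ENNReal.ofReal_one,
    ← ENNReal.ofReal_add (by positivity) (by norm_num)]
  exact ENNReal.ofReal_le_ofReal hfinal

end P5
end Snk

namespace Snk
section P6
open Filter Topology

structure Cfg where
  H : ℂ → ℂ
  contOn : ContinuousOn H (closedBall 0 1)
  injOn : Set.InjOn H (closedBall 0 1)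
  holo : DifferentiableOn ℂ H (ball 0 1)
  opn : IsOpen (H '' ball 0 1)
  σ : ℝ
  a : ℝ
  l : ℝ
  b : ℝ
  ha : 0 < a
  hl : 0 < l
  hb : 0 < b
  hab : a + l + b ≤ 1 / 2

namespace Cfg
variable (Q : Cfg)

def c (u : ℝ) : ℂ := Q.H (unitCirc (Q.σ + u))
def Z : Set ℂ := Q.H '' ball 0 1
def B : Set ℂ := Q.H '' sphere 0 1
def Zc : Set ℂ := Q.H '' closedBall 0 1
def G : ℂ → ℂ := Function.invFunOn Q.H (closedBall 0 1)

def Fm (p q x y : ℝ) : Set (ℝ → ℂ) :=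
  {γ | IsCurve γ ∧ γ 0 ∈ Q.c '' Icc p q ∧ γ 1 ∈ Q.c '' Icc x y ∧
    (∃ ε > 0, ∀ t ∈ Ioo (0:ℝ) ε, γ t ∉ Q.Z) ∧
    (∃ ε > 0, ∀ t ∈ Ioo (1 - ε) (1:ℝ), γ t ∉ Q.Z) ∧
    ∀ t ∈ Ioo (0:ℝ) 1, γ t ∈ Q.B → γ t ∈ Q.c '' Ioo q x}

def F : Set (ℝ → ℂ) := Q.Fm (-Q.a) 0 Q.l (Q.l + Q.b)

lemma unit_mem (t : ℝ) : unitCirc t ∈ closedBall (0:ℂ) 1 := by simp [norm_unitCirc]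

lemma c_mem (u : ℝ) : Q.c u ∈ Q.B := ⟨_, by simp [norm_unitCirc], rfl⟩

lemma c_cont : Continuous Q.c := by
  unfold c
  refine Q.contOn.comp_continuous (f := fun u => unitCirc (Q.σ + u)) ?_ fun u => unit_mem _
  exact continuous_unitCirc.comp (by fun_prop)

lemma c_inj1 {u v : ℝ} (h1 : |u - v| < 1) (h : Q.c u = Q.c v) : u = v := by
  have h2 := Q.injOn (unit_mem _) (unit_mem _) h
  rw [abs_lt] at h1
  rcases lt_trichotomy u v with h3 | h3 | h3
  · exact absurd h2 (unitCirc_ne (by linarith) (by linarith))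
  · exact h3
  · exact absurd h2.symm (unitCirc_ne (by linarith) (by linarith))

lemma c_inj {u v : ℝ} (hu : u ∈ Icc (-Q.a) (Q.l + Q.b)) (hv : v ∈ Icc (-Q.a) (Q.l + Q.b))
    (h : Q.c u = Q.c v) : u = v := by
  refine Q.c_inj1 ?_ h
  rw [abs_lt]
  have := Q.hab
  constructor <;> linarith [hu.1, hu.2, hv.1, hv.2]

lemma Z_B {z : ℂ} (hz : z ∈ Q.Z) (hb : z ∈ Q.B) : False := by
  obtain ⟨w, hw, rfl⟩ := hz
  obtain ⟨w', hw', he⟩ := hb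
  have := Q.injOn (sphere_subset_closedBall hw') (ball_subset_closedBall hw) he
  subst this
  simp at hw hw'
  linarith

lemma Zc_eq : Q.Zc = Q.Z ∪ Q.B := by
  unfold Zc Z B
  rw [← image_union, ball_union_sphere]

lemma Zc_compact : IsCompact Q.Zc := (isCompact_closedBall 0 1).image_of_continuousOn Q.contOn

lemma B_compact : IsCompact Q.B := (isCompact_sphere 0 1).image_of_continuousOn
  (Q.contOn.mono sphere_subset_closedBall)

lemma Z_open : IsOpen Q.Z := Q.opn

lemma HG {z : ℂ} (hz : z ∈ Q.Zc) : Q.H (Q.G z) = z := Function.invFunOn_eq hz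

lemma G_mem {z : ℂ} (hz : z ∈ Q.Zc) : Q.G z ∈ closedBall (0:ℂ) 1 := Function.invFunOn_mem hz

lemma GH {w : ℂ} (hw : w ∈ closedBall (0:ℂ) 1) : Q.G (Q.H w) = w :=
  Q.injOn (Q.G_mem (mem_image_of_mem _ hw)) hw (Q.HG (mem_image_of_mem _ hw))

lemma G_c (u : ℝ) : Q.G (Q.c u) = unitCirc (Q.σ + u) := Q.GH (unit_mem _)

lemma Z_Zc : Q.Z ⊆ Q.Zc := image_mono ball_subset_closedBall
lemma B_Zc : Q.B ⊆ Q.Zc := image_mono sphere_subset_closedBall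

lemma G_ball {z : ℂ} (hz : z ∈ Q.Z) : Q.G z ∈ ball (0:ℂ) 1 := by
  obtain ⟨w, hw, rfl⟩ := hz
  rw [Q.GH (ball_subset_closedBall hw)]; exact hw

lemma G_cont : ContinuousOn Q.G Q.Zc := by
  rw [continuousOn_iff_isClosed]
  intro t ht
  refine ⟨Q.H '' (closedBall 0 1 ∩ t), ?_, ?_⟩
  · exact (((isCompact_closedBall 0 1).inter_right ht).image_of_continuousOn
      (Q.contOn.mono inter_subset_left)).isClosed
  · ext z; constructor
    · rintro ⟨h1, h2⟩
      exact ⟨⟨Q.G z, ⟨Q.G_mem h2, h1⟩, Q.HG h2⟩, h2⟩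
    · rintro ⟨⟨w, hw, rfl⟩, h2⟩
      refine ⟨?_, h2⟩
      simp only [mem_preimage]
      rw [Q.GH hw.1]; exact hw.2

lemma G_diff : DifferentiableOn ℂ Q.G Q.Z := by
  intro z hz
  have hzn : Q.Z ∈ 𝓝 z := Q.Z_open.mem_nhds hz
  have h1 : ContinuousAt Q.G z := (Q.G_cont.mono Q.Z_Zc).continuousAt hzn
  have hb := Q.G_ball hz
  have h2 : HasDerivAt Q.H (deriv Q.H (Q.G z)) (Q.G z) :=
    ((Q.holo _ hb).differentiableAt (isOpen_ball.mem_nhds hb)).hasDerivAt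
  have h3 := deriv_ne_zero_of_inj isOpen_ball Q.holo (Q.injOn.mono ball_subset_closedBall) hb
  have h4 : ∀ᶠ y in 𝓝 z, Q.H (Q.G y) = y := by
    filter_upwards [hzn] with y hy
    exact Q.HG (Q.Z_Zc hy)
  exact (HasDerivAt.of_local_left_inverse h1 h2 h3 h4).differentiableAt.differentiableWithinAt

/-- uniform separation -/
lemma sep {K : Set (ℝ × ℝ)} (hK : IsCompact K)
    (hne : ∀ p ∈ K, Q.c p.1 ≠ Q.c p.2) : ∃ D > 0, ∀ p ∈ K, D ≤ ‖Q.c p.1 - Q.c p.2‖ := by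
  rcases K.eq_empty_or_nonempty with h | h
  · exact ⟨1, one_pos, by simp [h]⟩
  have hc : ContinuousOn (fun p : ℝ × ℝ => ‖Q.c p.1 - Q.c p.2‖) K := by
    have := Q.c_cont
    fun_prop
  obtain ⟨p, hp, hmin⟩ := hK.exists_isMinOn h hc
  exact ⟨_, norm_pos_iff.2 (sub_ne_zero.2 (hne p hp)), fun q hq => hmin hq⟩

lemma sepIJ : ∃ D > 0, ∀ u ∈ Icc (-Q.a) 0, ∀ v ∈ Icc Q.l (Q.l + Q.b),
    D ≤ ‖Q.c u - Q.c v‖ := by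
  obtain ⟨D, h0, h⟩ := Q.sep (K := Icc (-Q.a) 0 ×ˢ Icc Q.l (Q.l + Q.b))
    (isCompact_Icc.prod isCompact_Icc) (by
      rintro ⟨u, v⟩ ⟨hu, hv⟩ he
      have h1 := Q.ha; have h2 := Q.hl; have h3 := Q.hb
      simp only [mem_Icc] at hu hv
      have := Q.c_inj ⟨hu.1, by linarith⟩ ⟨by linarith, hv.2⟩ he
      linarith [hu.2, hv.1])
  exact ⟨D, h0, fun u hu v hv => h (u, v) ⟨hu, hv⟩⟩

end Cfg

lemma exit2 {f : ℝ → ℝ} {T0 T1 t0 t1 r R : ℝ} (h0 : t0 ∈ Icc T0 T1) (h1 : t1 ∈ Icc T0 T1)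
    (hf : ContinuousOn f (Icc T0 T1)) (hr : f t0 ≤ r) (hrR : r < R) (hR : R ≤ f t1) :
    ∃ s0 s1, T0 ≤ s0 ∧ s0 < s1 ∧ s1 ≤ T1 ∧ |f s1 - f s0| = R - r ∧
      ∀ t ∈ Ioo s0 s1, r < f t ∧ f t < R := by
  rcases le_total t0 t1 with h | h
  · obtain ⟨s0, s1, a1, a2, a3, a4, a5, a6⟩ := exit_lemma h
      (hf.mono (Icc_subset_Icc h0.1 h1.2)) hr hrR hR
    refine ⟨s0, s1, h0.1.trans a1, a2, a3.trans h1.2, ?_, a6⟩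
    rw [a4, a5, abs_of_pos (by linarith)]
  · have hc : ContinuousOn (fun t => f (-t)) (Icc (-t0) (-t1)) := by
      refine hf.comp (by fun_prop) fun t ht => ⟨?_, ?_⟩
      · linarith [ht.2, h1.1]
      · linarith [ht.1, h0.2]
    obtain ⟨s0, s1, a1, a2, a3, a4, a5, a6⟩ := exit_lemma (neg_le_neg h) hc
      (by simpa using hr) hrR (by simpa using hR)
    refine ⟨-s1, -s0, by linarith [h1.1], by linarith, by linarith [h0.2], ?_, fun t ht => ?_⟩
    · rw [a4, a5, abs_sub_comm, abs_of_pos (by linarith)]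
    · have := a6 (-t) ⟨by linarith [ht.2], by linarith [ht.1]⟩
      simpa using this

lemma mass_indicator {s : Set ℂ} (hs : MeasurableSet s) (k : ℝ≥0∞) :
    mass (s.indicator fun _ => k) = k ^ 2 * volume s := by
  unfold mass
  have : ∀ z, (s.indicator (fun _ => k) z) ^ 2 = s.indicator (fun _ => k ^ 2) z := by
    intro z; by_cases h : z ∈ s <;> simp [h]
  simp_rw [this]
  rw [lintegral_indicator_const hs]

lemma curve_sub {γ : ℝ → ℂ} (h : IsCurve γ) {s0 s1 : ℝ} (h0 : 0 ≤ s0) (h1 : s1 ≤ 1) :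
    ContinuousOn γ (Icc s0 s1) ∧ ContDiffOn ℝ 1 γ (Ioo s0 s1) :=
  ⟨h.1.mono (Icc_subset_Icc h0 h1), h.2.mono (Ioo_subset_Ioo h0 h1)⟩

lemma annuli (e : ℂ) {r : ℝ} (hr : 0 < r) (n : ℕ) : ∃ ρ : ℂ → ℝ≥0∞, Measurable ρ ∧
    (∀ z, 2 ^ n * r ≤ ‖z - e‖ → ρ z = 0) ∧ mass ρ ≤ n * ENNReal.ofReal (4 * Real.pi) ∧
    ∀ γ, IsCurve γ → ∀ t0 ∈ Icc (0:ℝ) 1, ∀ t1 ∈ Icc (0:ℝ) 1, ‖γ t0 - e‖ ≤ r →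
      2 ^ n * r ≤ ‖γ t1 - e‖ → n ≤ Lr ρ γ 0 1 := by
  induction n with
  | zero => exact ⟨fun _ => 0, measurable_const, by simp, by simp [mass], by simp⟩
  | succ n ih =>
    obtain ⟨ρ, hm, hz, hmass, hL⟩ := ih
    set R := 2 ^ n * r with hR
    have hR0 : 0 < R := by positivity
    have h2R : 2 ^ (n + 1) * r = 2 * R := by rw [hR]; ring
    rw [h2R]
    set A : Set ℂ := ball e (2 * R) ∩ {z | R < ‖z - e‖} with hA
    have hAo : IsOpen A := isOpen_ball.inter (isOpen_lt continuous_const (by fun_prop))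
    set k : ℝ≥0∞ := ENNReal.ofReal (1 / R) with hk
    have hkf : k ≠ ∞ := ENNReal.ofReal_ne_top
    refine ⟨fun z => ρ z + A.indicator (fun _ => k) z, ?_, ?_, ?_, ?_⟩
    · exact hm.add (measurable_const.indicator hAo.measurableSet)
    · intro z hz'
      show ρ z + A.indicator (fun _ => k) z = 0
      rw [hz z (by linarith), indicator_of_notMem, zero_add]
      rintro ⟨h1, h2⟩
      rw [mem_ball, dist_eq_norm] at h1
      linarith
    · have h1 : mass (fun z => ρ z + A.indicator (fun _ => k) z) =
          mass ρ + mass (A.indicator fun _ => k) := by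
        unfold mass
        rw [← lintegral_add_left (hm.pow_const 2)]
        refine lintegral_congr fun z => ?_
        by_cases h : z ∈ A
        · have h0 : ρ z = 0 := hz z (le_of_lt h.2)
          simp [h0]
        · simp [h]
      rw [h1, mass_indicator hAo.measurableSet]
      push_cast
      rw [add_mul, one_mul]
      gcongr
      calc k ^ 2 * volume A ≤ k ^ 2 * volume (ball e (2 * R)) := by
            gcongr; exact inter_subset_left
        _ ≤ ENNReal.ofReal (4 * Real.pi) := by
            have hpi : (NNReal.pi : ℝ≥0∞) = ENNReal.ofReal Real.pi :=
              (ENNReal.ofReal_eq_coe_nnreal Real.pi_pos.le).symm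
            rw [Complex.volume_ball, hk, hpi, ← ENNReal.ofReal_pow (by positivity),
              ← ENNReal.ofReal_pow (by positivity), ← ENNReal.ofReal_mul (by positivity),
              ← ENNReal.ofReal_mul (by positivity)]
            refine ENNReal.ofReal_le_ofReal (le_of_eq ?_)
            field_simp; norm_num
    · intro γ hγ t0 h0 t1 h1 hs hb
      have hcont : ContinuousOn (fun t => ‖γ t - e‖) (Icc 0 1) :=
        (hγ.1.sub continuousOn_const).norm
      have hnr : r ≤ R := by
        rw [hR]; have : (1:ℝ) ≤ 2 ^ n := one_le_pow₀ (by norm_num)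
        nlinarith
      refine le_trans ?_ (Lr_add _ _ _ _ _)
      push_cast
      refine add_le_add (hL γ hγ t0 h0 t1 h1 hs (by linarith)) ?_
      obtain ⟨s0, s1, b1, b2, b3, b4, b5⟩ := exit2 h0 h1 hcont (hs.trans hnr)
        (show R < 2 * R by linarith) hb
      obtain ⟨hc1, hc2⟩ := curve_sub hγ b1 b3
      refine le_trans ?_ (Lr_mono_set _ _ b1 b3)
      refine le_trans ?_ (Lr_ge b2 hc1 hc2 hkf fun t ht => ?_)
      · have h3 : R ≤ ‖γ s1 - γ s0‖ := by
          have := abs_norm_sub_norm_le (γ s1 - e) (γ s0 - e)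
          rw [b4] at this
          simp only [sub_sub_sub_cancel_right] at this
          linarith
        calc (1:ℝ≥0∞) = k * ENNReal.ofReal R := by
              rw [hk, ← ENNReal.ofReal_mul (by positivity)]
              rw [one_div_mul_cancel hR0.ne']; simp
          _ ≤ _ := by
              gcongr
              rw [← ofReal_norm]
              exact ENNReal.ofReal_le_ofReal h3
      · have h4 : γ t ∈ A := ⟨by rw [mem_ball, dist_eq_norm]; exact (b5 t ht).2, (b5 t ht).1⟩
        simp [h4]

namespace Cfg
variable (Q : Cfg)

def Win (τ δ : ℝ) : Set (ℝ → ℂ) :=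
  {γ ∈ Q.F | ∃ t ∈ Ioo (0:ℝ) 1, ∃ u ∈ Ioo 0 Q.l, γ t = Q.c u ∧ |u - τ| ≤ δ}

lemma windows : ∃ δ1 > 0, ∀ τ ∈ Icc 0 Q.l, extremalWidth (Q.Win τ δ1) ≤ 1 := by
  obtain ⟨D, hD, hsep⟩ := Q.sepIJ
  set r : ℝ := (D / 2) / 2 ^ 13 with hr
  have hr0 : 0 < r := by positivity
  have huc := isCompact_Icc.uniformContinuousOn_of_continuous (s := Icc (0:ℝ) Q.l)
    Q.c_cont.continuousOn
  rw [Metric.uniformContinuousOn_iff] at huc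
  obtain ⟨δ, hδ, hu⟩ := huc r hr0
  refine ⟨δ / 2, by positivity, fun τ hτ => ?_⟩
  obtain ⟨ρ, hm, -, hmass, hL⟩ := annuli (Q.c τ) hr0 13
  have hi0 : (13:ℝ≥0∞) ≠ 0 := by norm_num
  have hi1 : (13:ℝ≥0∞) ≠ ∞ := by norm_num
  have hadm : Adm (Q.Win τ (δ / 2)) (fun z => (13:ℝ≥0∞)⁻¹ * ρ z) := by
    refine ⟨hm.const_mul _, ?_⟩
    rintro γ ⟨hγ, t, ht, u, hu1, he, hd⟩
    rw [Lr_const_mul (ENNReal.inv_ne_top.2 hi0)]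
    have hsm : ‖γ t - Q.c τ‖ ≤ r := by
      rw [he, ← dist_eq_norm]
      exact (hu u ⟨hu1.1.le, hu1.2.le⟩ τ hτ (by rw [Real.dist_eq]; linarith)).le
    obtain ⟨hcur, ⟨u0, hu0, e0⟩, ⟨v0, hv0, e1⟩, -⟩ := hγ
    have hDD := hsep u0 hu0 v0 hv0
    rw [e0, e1] at hDD
    have htri : ‖γ 0 - γ 1‖ ≤ ‖γ 0 - Q.c τ‖ + ‖γ 1 - Q.c τ‖ := by
      have := norm_sub_le (γ 0 - Q.c τ) (γ 1 - Q.c τ)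
      simpa using this
    have hrr : (2:ℝ) ^ 13 * r = D / 2 := by rw [hr]; field_simp
    have h13 : (13:ℝ≥0∞) ≤ Lr ρ γ 0 1 := by
      have htt : t ∈ Icc (0:ℝ) 1 := ⟨ht.1.le, ht.2.le⟩
      rcases le_total (D / 2) ‖γ 0 - Q.c τ‖ with h | h
      · exact_mod_cast hL γ hcur t htt 0 (by simp) hsm (by rw [hrr]; exact h)
      · exact_mod_cast hL γ hcur t htt 1 (by simp) hsm (by rw [hrr]; linarith)
    calc (1:ℝ≥0∞) = (13:ℝ≥0∞)⁻¹ * 13 := (ENNReal.inv_mul_cancel hi0 hi1).symm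
      _ ≤ _ := by gcongr
  refine (width_le hadm).trans ?_
  rw [mass_const_mul _ hm]
  calc (13:ℝ≥0∞)⁻¹ ^ 2 * mass ρ ≤ (13:ℝ≥0∞)⁻¹ ^ 2 * ((13:ℕ) * 13) := by
        gcongr
        refine hmass.trans ?_
        gcongr
        rw [show (13:ℝ≥0∞) = ENNReal.ofReal 13 by simp]
        exact ENNReal.ofReal_le_ofReal (by linarith [Real.pi_lt_d2])
    _ = 1 := by
        push_cast
        rw [← sq, ← mul_pow, ENNReal.inv_mul_cancel hi0 hi1, one_pow]

lemma F_finite : extremalWidth Q.F ≠ ∞ := by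
  obtain ⟨D, hD, hsep⟩ := Q.sepIJ
  -- all starting points in a compact set
  obtain ⟨M, hM⟩ := (Q.B_compact.isBounded).exists_norm_le
  set k : ℝ≥0∞ := ENNReal.ofReal (1 / D) with hk
  have hkf : k ≠ ∞ := ENNReal.ofReal_ne_top
  have hadm : Adm Q.F ((ball (0:ℂ) (M + D + 1)).indicator fun _ => k) := by
    refine ⟨measurable_const.indicator measurableSet_ball, ?_⟩
    rintro γ ⟨hcur, ⟨u0, hu0, e0⟩, ⟨v0, hv0, e1⟩, -⟩
    have hDD := hsep u0 hu0 v0 hv0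
    rw [e0, e1] at hDD
    have h0 : ‖γ 0‖ ≤ M := hM _ (e0 ▸ Q.c_mem u0)
    have hcont : ContinuousOn (fun t => ‖γ t - γ 0‖) (Icc 0 1) :=
        (hcur.1.sub continuousOn_const).norm
    obtain ⟨s0, s1, b1, b2, b3, b4, b5⟩ := exit2 (t0 := 0) (t1 := 1) (r := 0) (R := D) (by simp)
      (by simp) hcont (by simp) hD (by rw [norm_sub_rev]; exact hDD)
    obtain ⟨hc1, hc2⟩ := curve_sub hcur b1 b3
    refine le_trans ?_ (Lr_mono_set _ _ b1 b3)
    refine le_trans ?_ (Lr_ge b2 hc1 hc2 hkf fun t ht => ?_)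
    · have h3 : D ≤ ‖γ s1 - γ s0‖ := by
        have := abs_norm_sub_norm_le (γ s1 - γ 0) (γ s0 - γ 0)
        rw [b4] at this
        simp only [sub_sub_sub_cancel_right] at this
        linarith
      calc (1:ℝ≥0∞) = k * ENNReal.ofReal D := by
            rw [hk, ← ENNReal.ofReal_mul (by positivity)]
            rw [one_div_mul_cancel hD.ne']; simp
        _ ≤ _ := by
            gcongr
            rw [← ofReal_norm]
            exact ENNReal.ofReal_le_ofReal h3
    · have h4 : γ t ∈ ball (0:ℂ) (M + D + 1) := by
        rw [mem_ball_zero_iff]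
        have h5 := (b5 t ht).2
        have h6 := norm_sub_norm_le (γ t) (γ 0)
        linarith
      simp [h4]
  refine ne_top_of_le_ne_top ?_ (width_le hadm)
  rw [mass_indicator measurableSet_ball]
  exact ENNReal.mul_ne_top (ENNReal.pow_ne_top hkf) measure_ball_lt_top.ne

end Cfg
end P6
end Snk

namespace Snk
section P7
open Filter Topology

lemma dist_circ (α : ℝ) {φ : ℝ} (h0 : 0 ≤ φ) (h1 : φ ≤ 1) :
    ‖unitCirc (α + φ) - unitCirc α‖ = 2 * Real.sin (Real.pi * φ) := by
  have e : unitCirc (α + φ) - unitCirc α = - (unitCirc α * (1 - unitCirc φ)) := by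
    rw [unitCirc_add]; ring
  have hs : 0 ≤ Real.sin (Real.pi * φ) :=
    Real.sin_nonneg_of_nonneg_of_le_pi (by positivity) (by nlinarith [Real.pi_pos])
  rw [e, norm_neg, norm_mul, norm_unitCirc, one_mul, one_sub_unitCirc, norm_mul, Complex.norm_real,
    Real.norm_of_nonneg (by linarith), ← Complex.ofReal_cos, ← Complex.ofReal_sin]
  rw [show ∀ x : ℝ, ‖((Real.cos x : ℝ) : ℂ) + ((Real.sin x : ℝ) : ℂ) * Complex.I‖ = 1 from fun x => by
    rw [Complex.ofReal_cos, Complex.ofReal_sin]; exact Complex.norm_cos_add_sin_mul_I x]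
  ring

lemma sin_bounds {y : ℝ} (h0 : 0 ≤ y) (h1 : y ≤ 1/2) :
    4 * y ≤ 2 * Real.sin (Real.pi * y) ∧ 2 * Real.sin (Real.pi * y) ≤ 2 * Real.pi * y := by
  have hp := Real.pi_pos
  constructor
  · have := Real.mul_le_sin (x := Real.pi * y) (by positivity) (by nlinarith)
    have e : 2 / Real.pi * (Real.pi * y) = 2 * y := by field_simp
    rw [e] at this; linarith
  · have := Real.sin_le (x := Real.pi * y) (by positivity)
    linarith

lemma sin_mono {y y' : ℝ} (h0 : 0 ≤ y) (h : y ≤ y') (h1 : y' ≤ 1/2) :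
    Real.sin (Real.pi * y) ≤ Real.sin (Real.pi * y') := by
  have hp := Real.pi_pos
  refine Real.sin_le_sin_of_le_of_le_pi_div_two ?_ ?_ ?_
  · have : 0 ≤ Real.pi * y := by positivity
    linarith
  · nlinarith
  · gcongr

namespace Cfg
variable (Q : Cfg)

def Chord (γ : ℝ → ℂ) (s s' u v : ℝ) : Prop :=
  0 < s ∧ s < s' ∧ s' < 1 ∧ (∀ t ∈ Ioo s s', γ t ∈ Q.Z) ∧ u ∈ Ioo 0 Q.l ∧ v ∈ Ioo 0 Q.l ∧
    γ s = Q.c u ∧ γ s' = Q.c v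

def push (D : Set ℂ) (k : ℝ≥0∞) : ℂ → ℝ≥0∞ :=
  (Q.Z ∩ Q.G ⁻¹' D).indicator fun z => k * ‖deriv Q.G z‖ₑ

lemma push_open {D : Set ℂ} (hD : IsOpen D) : IsOpen (Q.Z ∩ Q.G ⁻¹' D) :=
  (Q.G_cont.mono Q.Z_Zc).isOpen_inter_preimage Q.Z_open hD

lemma push_meas {D : Set ℂ} (hD : IsOpen D) (k : ℝ≥0∞) : Measurable (Q.push D k) :=
  ((measurable_deriv Q.G).enorm.const_mul k).indicator (Q.push_open hD).measurableSet

lemma push_mass {D : Set ℂ} (hD : IsOpen D) (k : ℝ≥0∞) :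
    mass (Q.push D k) ≤ k ^ 2 * volume D := by
  set s := Q.Z ∩ Q.G ⁻¹' D with hs
  have hso : IsOpen s := Q.push_open hD
  have hder : ∀ x ∈ s, HasFDerivWithinAt Q.G
      ((ContinuousLinearMap.toSpanSingleton ℂ (deriv Q.G x)).restrictScalars ℝ) s x := by
    intro x hx
    have : HasDerivAt Q.G (deriv Q.G x) x :=
      ((Q.G_diff x hx.1).differentiableAt (Q.Z_open.mem_nhds hx.1)).hasDerivAt
    exact (this.hasFDerivAt.restrictScalars ℝ).hasFDerivWithinAt
  have hinj : InjOn Q.G s := by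
    intro x hx y hy h
    rw [← Q.HG (Q.Z_Zc hx.1), h, Q.HG (Q.Z_Zc hy.1)]
  have hdet : ∀ d : ℂ, ENNReal.ofReal
      |((ContinuousLinearMap.toSpanSingleton ℂ d).restrictScalars ℝ : ℂ →L[ℝ] ℂ).det| =
      ‖d‖ₑ ^ 2 := by
    intro d
    have : ((ContinuousLinearMap.toSpanSingleton ℂ d).restrictScalars ℝ : ℂ →L[ℝ] ℂ).det =
        ‖d‖ ^ 2 := by
      simp [ContinuousLinearMap.det, LinearMap.det_restrictScalars, Algebra.norm_complex_eq,
        Complex.normSq_eq_norm_sq]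
    rw [this, abs_of_nonneg (by positivity), ENNReal.ofReal_pow (norm_nonneg _), ofReal_norm]
  have harea := lintegral_abs_det_fderiv_eq_addHaar_image volume hso.measurableSet hder hinj
  simp_rw [hdet] at harea
  have hm : mass (Q.push D k) = ∫⁻ z in s, k ^ 2 * ‖deriv Q.G z‖ₑ ^ 2 := by
    unfold mass push
    rw [← lintegral_indicator hso.measurableSet]
    refine lintegral_congr fun z => ?_
    by_cases h : z ∈ s
    · rw [indicator_of_mem h, indicator_of_mem h, mul_pow]
    · rw [indicator_of_notMem h, indicator_of_notMem h]; norm_num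
  rw [hm, lintegral_const_mul _ ((measurable_deriv Q.G).enorm.pow_const 2), harea]
  gcongr
  rintro _ ⟨x, hx, rfl⟩
  exact hx.2

lemma push_Lr {D : Set ℂ} {k : ℝ≥0∞} (hk : k ≠ ∞) {γ : ℝ → ℂ} (hγ : IsCurve γ) {s0 s1 : ℝ}
    (h0 : 0 ≤ s0) (h01 : s0 < s1) (h1 : s1 ≤ 1) (hZc : ∀ t ∈ Icc s0 s1, γ t ∈ Q.Zc)
    (hZ : ∀ t ∈ Ioo s0 s1, γ t ∈ Q.Z ∧ Q.G (γ t) ∈ D) :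
    k * ‖Q.G (γ s1) - Q.G (γ s0)‖ₑ ≤ Lr (Q.push D k) γ s0 s1 := by
  obtain ⟨hc1, hc2⟩ := curve_sub hγ h0 h1
  have hw : ContinuousOn (fun t => Q.G (γ t)) (Icc s0 s1) := Q.G_cont.comp hc1 hZc
  have hGd : ContDiffOn ℝ 1 Q.G Q.Z := (Q.G_diff.contDiffOn Q.Z_open).restrict_scalars ℝ
  have hw2 : ContDiffOn ℝ 1 (fun t => Q.G (γ t)) (Ioo s0 s1) :=
    hGd.comp hc2 fun t ht => (hZ t ht).1
  calc _ ≤ k * ∫⁻ t in Ioo s0 s1, ‖deriv (fun t => Q.G (γ t)) t‖ₑ := by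
        gcongr; exact len_le h01 hw hw2
    _ = ∫⁻ t in Ioo s0 s1, k * ‖deriv (fun t => Q.G (γ t)) t‖ₑ :=
        (lintegral_const_mul' _ _ hk).symm
    _ ≤ _ := by
        refine setLIntegral_mono' measurableSet_Ioo fun t ht => ?_
        have hmem : γ t ∈ Q.Z ∩ Q.G ⁻¹' D := ⟨(hZ t ht).1, (hZ t ht).2⟩
        have hd1 : HasDerivAt Q.G (deriv Q.G (γ t)) (γ t) :=
          ((Q.G_diff _ hmem.1).differentiableAt (Q.Z_open.mem_nhds hmem.1)).hasDerivAt
        have hd2 : HasDerivAt γ (deriv γ t) t :=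
          (curve_diff hγ ⟨by linarith [ht.1], by linarith [ht.2]⟩).hasDerivAt
        have hd := (hd1.comp_of_eq t hd2 rfl).deriv
        simp only [Function.comp_def] at hd
        rw [hd, push, indicator_of_mem hmem, enorm_mul, mul_assoc]
        exact le_rfl

/-- scale families of chords around m -/
def Ch (m y0 : ℝ) : Set (ℝ → ℂ) :=
  {γ | IsCurve γ ∧ ∃ s s' u v, Q.Chord γ s s' u v ∧ u < m ∧ m < v ∧
    ((y0 ≤ m - u ∧ m - u ≤ 2 * y0) ∨ (y0 ≤ v - m ∧ v - m ≤ 2 * y0))}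

lemma Ch_width (m : ℝ) {y0 : ℝ} (hy0 : 0 < y0) :
    extremalWidth (Q.Ch m y0) ≤ ENNReal.ofReal (9 * Real.pi ^ 3) := by
  have hp := Real.pi_pos
  set ζ := unitCirc (Q.σ + m) with hζ
  set D := ball ζ (6 * Real.pi * y0) with hD
  set k : ℝ≥0∞ := ENNReal.ofReal (1 / (2 * y0)) with hk
  have hkf : k ≠ ∞ := ENNReal.ofReal_ne_top
  have hadm : Adm (Q.Ch m y0) (Q.push D k) := by
    refine ⟨Q.push_meas isOpen_ball k, ?_⟩
    rintro γ ⟨hγ, s, s', u, v, ⟨hs0, hss, hs1, hZ, hu, hv, eu, ev⟩, hum, hmv, hy⟩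
    have hlen : v - u ≤ 1 / 2 := by linarith [hu.1, hv.2, Q.hab, Q.ha, Q.hb]
    set w : ℝ → ℂ := fun t => Q.G (γ t) with hw
    have hZc : ∀ t ∈ Icc s s', γ t ∈ Q.Zc := by
      intro t ht
      rcases eq_or_lt_of_le ht.1 with h | h
      · rw [← h, eu]; exact Q.B_Zc (Q.c_mem u)
      rcases eq_or_lt_of_le ht.2 with h' | h'
      · rw [h', ev]; exact Q.B_Zc (Q.c_mem v)
      exact Q.Z_Zc (hZ t ⟨h, h'⟩)
    have hwc : ContinuousOn w (Icc s s') := Q.G_cont.comp (curve_sub hγ hs0.le hs1.le).1 hZc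
    have hw0 : w s = unitCirc (Q.σ + u) := by simp only [hw, eu, Q.G_c]
    have hw1 : w s' = unitCirc (Q.σ + v) := by simp only [hw, ev, Q.G_c]
    have hvu : ‖w s' - w s‖ = 2 * Real.sin (Real.pi * (v - u)) := by
      rw [hw0, hw1, ← dist_circ (Q.σ + u) (φ := v - u) (by linarith) (by linarith)]
      congr 3; ring
    have hmu : ‖ζ - w s‖ = 2 * Real.sin (Real.pi * (m - u)) := by
      rw [hw0, hζ, ← dist_circ (Q.σ + u) (φ := m - u) (by linarith) (by linarith)]
      congr 3; ring
    have hvm : ‖w s' - ζ‖ = 2 * Real.sin (Real.pi * (v - m)) := by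
      rw [hw1, hζ, ← dist_circ (Q.σ + m) (φ := v - m) (by linarith) (by linarith)]
      congr 3; ring
    obtain ⟨y, t0, t1, hyl, hyu, hy12, ht0, ht1, hbase, hfar⟩ : ∃ y t0 t1 : ℝ, y0 ≤ y ∧ y ≤ 2 * y0 ∧
        y ≤ 1 / 2 ∧ t0 ∈ Icc s s' ∧ t1 ∈ Icc s s' ∧ ‖w t0 - ζ‖ = 2 * Real.sin (Real.pi * y) ∧
        2 * Real.sin (Real.pi * y) ≤ ‖w t1 - w t0‖ := by
      rcases hy with ⟨h1, h2⟩ | ⟨h1, h2⟩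
      · refine ⟨m - u, s, s', h1, h2, by linarith, ⟨le_rfl, hss.le⟩, ⟨hss.le, le_rfl⟩, ?_, ?_⟩
        · rw [norm_sub_rev, hmu]
        · rw [hvu]; linarith [sin_mono (y := m - u) (y' := v - u) (by linarith) (by linarith) hlen]
      · refine ⟨v - m, s', s, h1, h2, by linarith, ⟨hss.le, le_rfl⟩, ⟨le_rfl, hss.le⟩, hvm, ?_⟩
        rw [norm_sub_rev, hvu]
        linarith [sin_mono (y := v - m) (y' := v - u) (by linarith) (by linarith) hlen]
    obtain ⟨hx1, hx2⟩ := sin_bounds (y := y) (by linarith) hy12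
    set x := 2 * Real.sin (Real.pi * y) with hx
    have hf : ContinuousOn (fun t => ‖w t - w t0‖) (Icc s s') :=
      (hwc.sub continuousOn_const).norm
    obtain ⟨s0, s1, b1, b2, b3, b4, b5⟩ := exit2 ht0 ht1 hf (r := 0) (R := x / 2) (by simp)
      (by linarith) (by linarith)
    refine le_trans ?_ (Lr_mono_set _ _ (hs0.le.trans b1) (b3.trans hs1.le))
    refine le_trans ?_ (Q.push_Lr hkf hγ (hs0.le.trans b1) b2 (b3.trans hs1.le)
      (fun t ht => hZc t ⟨b1.trans ht.1, ht.2.trans b3⟩)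
      (fun t ht => ⟨hZ t ⟨b1.trans_lt ht.1, ht.2.trans_le b3⟩, ?_⟩))
    · have h3 : 2 * y0 ≤ ‖w s1 - w s0‖ := by
        have := abs_norm_sub_norm_le (w s1 - w t0) (w s0 - w t0)
        rw [b4] at this
        simp only [sub_sub_sub_cancel_right] at this
        linarith
      calc (1:ℝ≥0∞) = k * ENNReal.ofReal (2 * y0) := by
            rw [hk, ← ENNReal.ofReal_mul (by positivity)]
            rw [one_div_mul_cancel (by positivity)]; simp
        _ ≤ _ := by
            gcongr
            rw [← ofReal_norm]
            exact ENNReal.ofReal_le_ofReal h3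
    · rw [hD, mem_ball, dist_eq_norm]
      have h5 := (b5 t ht).2
      have h6 : ‖w t - ζ‖ ≤ ‖w t - w t0‖ + ‖w t0 - ζ‖ := by
        have := norm_add_le (w t - w t0) (w t0 - ζ); simpa using this
      change ‖w t - ζ‖ < _
      rw [hbase] at h6
      have : 2 * Real.pi * y ≤ 2 * Real.pi * (2 * y0) := by gcongr
      linarith
  refine (width_le hadm).trans ((Q.push_mass isOpen_ball k).trans ?_)
  have hpi : (NNReal.pi : ℝ≥0∞) = ENNReal.ofReal Real.pi :=
    (ENNReal.ofReal_eq_coe_nnreal Real.pi_pos.le).symm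
  rw [Complex.volume_ball, hk, hpi, ← ENNReal.ofReal_pow (by positivity),
    ← ENNReal.ofReal_pow (by positivity), ← ENNReal.ofReal_mul (by positivity),
    ← ENNReal.ofReal_mul (by positivity)]
  refine ENNReal.ofReal_le_ofReal (le_of_eq ?_)
  field_simp; norm_num

lemma dyadic {h y : ℝ} {n : ℕ} (hh : 0 < h) (h1 : h ≤ y) (h2 : y < 2 ^ n * h) :
    ∃ k < n, 2 ^ k * h ≤ y ∧ y ≤ 2 * (2 ^ k * h) := by
  obtain ⟨k, hk1, hk2⟩ := exists_nat_pow_near (x := y / h) (y := (2:ℝ))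
    ((one_le_div hh).2 h1) (by norm_num)
  rw [le_div_iff₀ hh] at hk1
  rw [div_lt_iff₀ hh] at hk2
  refine ⟨k, ?_, hk1, ?_⟩
  · by_contra hcon
    push Not at hcon
    have : (2:ℝ) ^ n ≤ 2 ^ k := pow_le_pow_right₀ (by norm_num) hcon
    nlinarith
  · rw [pow_succ] at hk2; nlinarith

/-- curves with a forward chord jumping over `[p, p+d]` -/
def Jump (p d : ℝ) : Set (ℝ → ℂ) :=
  {γ ∈ Q.F | ∃ s s' u v, Q.Chord γ s s' u v ∧ u ≤ p ∧ p + d ≤ v}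

lemma jump_left {p d : ℝ} (hd : 0 < d) {n : ℕ} (hn : p + d / 2 < 2 ^ n * (d / 2)) :
    extremalWidth (Q.Jump p d) ≤ n * ENNReal.ofReal (9 * Real.pi ^ 3) := by
  refine (width_mono ?_).trans (width_biUnion (fun k => Q.Ch (p + d / 2) (2 ^ k * (d / 2))) _
    (fun k => Q.Ch_width _ (by positivity)) n)
  rintro γ ⟨hγ, s, s', u, v, hch, hu, hv⟩
  have hu0 : 0 < u := hch.2.2.2.2.1.1
  obtain ⟨k, hk, h1, h2⟩ := dyadic (h := d / 2) (y := p + d / 2 - u) (n := n) (by linarith)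
    (by linarith) (by linarith)
  simp only [mem_iUnion, Finset.mem_range]
  exact ⟨k, hk, hγ.1, s, s', u, v, hch, by linarith, by linarith, Or.inl ⟨h1, h2⟩⟩

lemma jump_right {p d : ℝ} (hd : 0 < d) {n : ℕ} (hn : Q.l - p - d / 2 < 2 ^ n * (d / 2)) :
    extremalWidth (Q.Jump p d) ≤ n * ENNReal.ofReal (9 * Real.pi ^ 3) := by
  refine (width_mono ?_).trans (width_biUnion (fun k => Q.Ch (p + d / 2) (2 ^ k * (d / 2))) _
    (fun k => Q.Ch_width _ (by positivity)) n)
  rintro γ ⟨hγ, s, s', u, v, hch, hu, hv⟩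
  have hvl : v < Q.l := hch.2.2.2.2.2.1.2
  obtain ⟨k, hk, h1, h2⟩ := dyadic (h := d / 2) (y := v - (p + d / 2)) (n := n) (by linarith)
    (by linarith) (by linarith)
  simp only [mem_iUnion, Finset.mem_range]
  exact ⟨k, hk, hγ.1, s, s', u, v, hch, by linarith, by linarith, Or.inr ⟨h1, h2⟩⟩

end Cfg
end P7
end Snk

namespace Snk
section P8
open Filter Topology

structure Swp (γ0 γ : ℝ → ℂ) (s s' : ℝ) (σ : ℝ → ℂ) (α β : ℝ → ℝ) : Prop where
  hs : s ∈ Ioo (0:ℝ) 1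
  hs' : s' ∈ Ioo (0:ℝ) 1
  cur : IsCurve σ
  len : ∀ ρ, Lr ρ σ 0 1 = Lr ρ γ0 0 s + Lr ρ γ s' 1
  ma : StrictMonoOn α (Icc 0 s)
  mb : StrictMonoOn β (Icc s' 1)
  a0 : α 0 = 0
  as : α s = 1/2
  bs : β s' = 1/2
  b1 : β 1 = 1
  ea : ∀ r ∈ Icc 0 s, σ (α r) = γ0 r
  eb : ∀ r ∈ Icc s' 1, σ (β r) = γ r
  sa : ∀ t ∈ Icc (0:ℝ) (1/2), ∃ r ∈ Icc 0 s, α r = t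
  sb : ∀ t ∈ Icc (1/2:ℝ) 1, ∃ r ∈ Icc s' 1, β r = t

lemma exists_swp {γ0 γ : ℝ → ℂ} (hγ0 : IsCurve γ0) (hγ : IsCurve γ) {s s' : ℝ}
    (hs : s ∈ Ioo (0:ℝ) 1) (hs' : s' ∈ Ioo (0:ℝ) 1) (h : γ0 s = γ s') :
    ∃ σ α β, Swp γ0 γ s s' σ α β := by
  obtain ⟨σ, α, β, h1, h2, h3, h4, h5, h6, h7, h8, h9, h10, h11, h12⟩ := swap hγ0 hγ hs hs' h
  exact ⟨σ, α, β, ⟨hs, hs', h1, h2, h3, h4, h5, h6, h7, h8, h9, h10, h11, h12⟩⟩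

namespace Swp
variable {γ0 γ : ℝ → ℂ} {s s' : ℝ} {σ : ℝ → ℂ} {α β : ℝ → ℝ}

lemma al_mem (W : Swp γ0 γ s s' σ α β) {r : ℝ} (hr : r ∈ Icc 0 s) : α r ∈ Icc (0:ℝ) (1/2) := by
  constructor
  · rw [← W.a0]; exact W.ma.monotoneOn ⟨le_rfl, W.hs.1.le⟩ hr hr.1
  · rw [← W.as]; exact W.ma.monotoneOn hr ⟨W.hs.1.le, le_rfl⟩ hr.2

lemma be_mem (W : Swp γ0 γ s s' σ α β) {r : ℝ} (hr : r ∈ Icc s' 1) : β r ∈ Icc (1/2:ℝ) 1 := by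
  constructor
  · rw [← W.bs]; exact W.mb.monotoneOn ⟨le_rfl, W.hs'.2.le⟩ hr hr.1
  · rw [← W.b1]; exact W.mb.monotoneOn hr ⟨W.hs'.2.le, le_rfl⟩ hr.2

lemma al_pos (W : Swp γ0 γ s s' σ α β) {r : ℝ} (hr : r ∈ Ioc 0 s) : 0 < α r := by
  rw [← W.a0]; exact W.ma ⟨le_rfl, W.hs.1.le⟩ ⟨hr.1.le, hr.2⟩ hr.1

lemma be_lt (W : Swp γ0 γ s s' σ α β) {r : ℝ} (hr : r ∈ Ico s' 1) : β r < 1 := by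
  rw [← W.b1]; exact W.mb ⟨hr.1, hr.2.le⟩ ⟨W.hs'.2.le, le_rfl⟩ hr.2

/-- times in an interval of the left half -/
lemma left_time (W : Swp γ0 γ s s' σ α β) {x y t : ℝ} (hx : x ∈ Icc 0 s) (hy : y ∈ Icc 0 s) (ht : t ∈ Ioo (α x) (α y)) :
    ∃ r ∈ Ioo x y, α r = t := by
  have h1 := W.al_mem hx
  have h2 := W.al_mem hy
  obtain ⟨r, hr, rfl⟩ := W.sa t ⟨h1.1.trans ht.1.le, ht.2.le.trans h2.2⟩
  exact ⟨r, ⟨(W.ma.lt_iff_lt hx hr).1 ht.1, (W.ma.lt_iff_lt hr hy).1 ht.2⟩, rfl⟩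

lemma right_time (W : Swp γ0 γ s s' σ α β) {x y t : ℝ} (hx : x ∈ Icc s' 1) (hy : y ∈ Icc s' 1) (ht : t ∈ Ioo (β x) (β y)) :
    ∃ r ∈ Ioo x y, β r = t := by
  have h1 := W.be_mem hx
  have h2 := W.be_mem hy
  obtain ⟨r, hr, rfl⟩ := W.sb t ⟨h1.1.trans ht.1.le, ht.2.le.trans h2.2⟩
  exact ⟨r, ⟨(W.mb.lt_iff_lt hx hr).1 ht.1, (W.mb.lt_iff_lt hr hy).1 ht.2⟩, rfl⟩

lemma mid_time (W : Swp γ0 γ s s' σ α β) {x y t : ℝ} (hx : x ∈ Icc 0 s) (hy : y ∈ Icc s' 1) (ht : t ∈ Ioo (α x) (β y)) :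
    (∃ r ∈ Ioc x s, α r = t) ∨ ∃ r ∈ Ico s' y, β r = t := by
  have h1 := W.al_mem hx
  have h2 := W.be_mem hy
  rcases le_total t (1/2) with h | h
  · obtain ⟨r, hr, rfl⟩ := W.sa t ⟨h1.1.trans ht.1.le, h⟩
    exact Or.inl ⟨r, ⟨(W.ma.lt_iff_lt hx hr).1 ht.1, hr.2⟩, rfl⟩
  · obtain ⟨r, hr, rfl⟩ := W.sb t ⟨h, ht.2.le.trans h2.2⟩
    exact Or.inr ⟨r, ⟨hr.1, (W.mb.lt_iff_lt hr hy).1 ht.2⟩, rfl⟩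

lemma all_time (W : Swp γ0 γ s s' σ α β) {t : ℝ} (ht : t ∈ Ioo (0:ℝ) 1) :
    (∃ r ∈ Ioc 0 s, α r = t) ∨ ∃ r ∈ Ico s' 1, β r = t :=
  W.mid_time (x := 0) (y := 1) ⟨le_rfl, W.hs.1.le⟩ ⟨W.hs'.2.le, le_rfl⟩ (by rwa [W.a0, W.b1])

end Swp

namespace Cfg
variable (Q : Cfg)

lemma swp_F {γ0 γ σ : ℝ → ℂ} {s s' : ℝ} {α β : ℝ → ℝ} (W : Swp γ0 γ s s' σ α β)
    (h0 : γ0 ∈ Q.F) (h : γ ∈ Q.F) : σ ∈ Q.F := by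
  obtain ⟨c0, i0, -, ⟨ε0, he0, n0⟩, -, hb0⟩ := h0
  obtain ⟨c1, -, j1, -, ⟨ε1, he1, n1⟩, hb1⟩ := h
  have s0 : (0:ℝ) ∈ Icc 0 s := ⟨le_rfl, W.hs.1.le⟩
  have s1 : (1:ℝ) ∈ Icc s' 1 := ⟨W.hs'.2.le, le_rfl⟩
  refine ⟨W.cur, ?_, ?_, ?_, ?_, ?_⟩
  · have := W.ea 0 s0
    rw [W.a0] at this; rw [this]; exact i0
  · have := W.eb 1 s1
    rw [W.b1] at this; rw [this]; exact j1
  · have hm : min (ε0 / 2) s ∈ Ioc 0 s := ⟨lt_min (by linarith) W.hs.1, min_le_right _ _⟩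
    refine ⟨α (min (ε0 / 2) s), W.al_pos hm, fun t ht => ?_⟩
    obtain ⟨r, hr, rfl⟩ := W.left_time s0 ⟨hm.1.le, hm.2⟩ (by rw [W.a0]; exact ht)
    rw [W.ea r ⟨hr.1.le, hr.2.le.trans hm.2⟩]
    exact n0 r ⟨hr.1, by have := hr.2.trans_le (min_le_left _ _); linarith⟩
  · have hm : max (1 - ε1 / 2) s' ∈ Ico s' 1 := ⟨le_max_right _ _, max_lt (by linarith) W.hs'.2⟩
    refine ⟨1 - β (max (1 - ε1 / 2) s'), by linarith [W.be_lt hm], fun t ht => ?_⟩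
    rw [sub_sub_cancel] at ht
    obtain ⟨r, hr, rfl⟩ := W.right_time ⟨hm.1, hm.2.le⟩ s1 (by rw [W.b1]; exact ht)
    rw [W.eb r ⟨hm.1.trans hr.1.le, hr.2.le⟩]
    exact n1 r ⟨by have := (le_max_left _ _).trans_lt hr.1; linarith, hr.2⟩
  · intro t ht
    rcases W.all_time ht with ⟨r, hr, rfl⟩ | ⟨r, hr, rfl⟩
    · rw [W.ea r ⟨hr.1.le, hr.2⟩]; exact hb0 r ⟨hr.1, hr.2.trans_lt W.hs.2⟩
    · rw [W.eb r ⟨hr.1, hr.2.le⟩]; exact hb1 r ⟨W.hs'.1.trans_le hr.1, hr.2⟩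

lemma chord_left {γ0 γ σ : ℝ → ℂ} {s s' : ℝ} {α β : ℝ → ℝ} (W : Swp γ0 γ s s' σ α β)
    {p1 p2 u v : ℝ} (h : Q.Chord γ0 p1 p2 u v) (hp : p2 ≤ s) : Q.Chord σ (α p1) (α p2) u v := by
  obtain ⟨a1, a2, a3, a4, a5, a6, a7, a8⟩ := h
  have m1 : p1 ∈ Icc 0 s := ⟨a1.le, a2.le.trans hp⟩
  have m2 : p2 ∈ Icc 0 s := ⟨a1.le.trans a2.le, hp⟩
  refine ⟨W.al_pos ⟨a1, m1.2⟩, W.ma m1 m2 a2, by linarith [(W.al_mem m2).2], fun t ht => ?_, a5, a6,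
    by rw [W.ea _ m1, a7], by rw [W.ea _ m2, a8]⟩
  obtain ⟨r, hr, rfl⟩ := W.left_time m1 m2 ht
  rw [W.ea r ⟨m1.1.trans hr.1.le, hr.2.le.trans hp⟩]; exact a4 r hr

lemma chord_right {γ0 γ σ : ℝ → ℂ} {s s' : ℝ} {α β : ℝ → ℝ} (W : Swp γ0 γ s s' σ α β)
    {p1 p2 u v : ℝ} (h : Q.Chord γ p1 p2 u v) (hp : s' ≤ p1) : Q.Chord σ (β p1) (β p2) u v := by
  obtain ⟨a1, a2, a3, a4, a5, a6, a7, a8⟩ := h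
  have m1 : p1 ∈ Icc s' 1 := ⟨hp, a2.le.trans a3.le⟩
  have m2 : p2 ∈ Icc s' 1 := ⟨hp.trans a2.le, a3.le⟩
  refine ⟨by linarith [(W.be_mem m1).1], W.mb m1 m2 a2, W.be_lt ⟨m2.1, a3⟩, fun t ht => ?_, a5, a6,
    by rw [W.eb _ m1, a7], by rw [W.eb _ m2, a8]⟩
  obtain ⟨r, hr, rfl⟩ := W.right_time m1 m2 ht
  rw [W.eb r ⟨hp.trans hr.1.le, hr.2.le.trans a3.le⟩]; exact a4 r hr

lemma chord_mid {γ0 γ σ : ℝ → ℂ} {s s' : ℝ} {α β : ℝ → ℝ} (W : Swp γ0 γ s s' σ α β)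
    {x y x' y' u v u' v' : ℝ} (h0 : Q.Chord γ0 x x' u u') (h : Q.Chord γ y' y v' v)
    (hs : s ∈ Ioo x x') (hs' : s' ∈ Ioo y' y) : Q.Chord σ (α x) (β y) u v := by
  obtain ⟨a1, a2, a3, a4, a5, a6, a7, a8⟩ := h0
  obtain ⟨b1, b2, b3, b4, b5, b6, b7, b8⟩ := h
  have m1 : x ∈ Icc 0 s := ⟨a1.le, hs.1.le⟩
  have m2 : y ∈ Icc s' 1 := ⟨hs'.2.le, b3.le⟩
  have l1 : α x < 1/2 := by rw [← W.as]; exact W.ma m1 ⟨W.hs.1.le, le_rfl⟩ hs.1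
  refine ⟨W.al_pos ⟨a1, m1.2⟩, l1.trans_le (W.be_mem m2).1, W.be_lt ⟨m2.1, b3⟩, fun t ht => ?_, a5,
    b6, by rw [W.ea _ m1, a7], by rw [W.eb _ m2, b8]⟩
  rcases W.mid_time m1 m2 ht with ⟨r, hr, rfl⟩ | ⟨r, hr, rfl⟩
  · rw [W.ea r ⟨m1.1.trans hr.1.le, hr.2⟩]; exact a4 r ⟨hr.1, hr.2.trans_lt hs.2⟩
  · rw [W.eb r ⟨hr.1, hr.2.le.trans m2.2⟩]; exact b4 r ⟨hs'.1.trans_le hr.1, hr.2⟩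

/-- first hit -/
def FH (γ : ℝ → ℂ) (t0 τ : ℝ) : Prop :=
  0 < t0 ∧ t0 < 1 ∧ γ t0 = Q.c τ ∧ τ ∈ Ioo 0 Q.l ∧ ∀ t ∈ Ioo 0 t0, γ t ∉ Q.B

def NoHit (γ : ℝ → ℂ) : Prop := ∀ t ∈ Ioo (0:ℝ) 1, γ t ∉ Q.B

def z1 (γ : ℝ → ℂ) : ℝ≥0∞ :=
  max (⨆ p : ℝ × ℝ, ⨆ _ : Q.FH γ p.1 p.2, ENNReal.ofReal p.2) (⨆ _ : Q.NoHit γ, 2)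

lemma Ioo_sub {u : ℝ} (hu : u ∈ Ioo 0 Q.l) : u ∈ Icc (-Q.a) (Q.l + Q.b) := by
  have := Q.ha; have := Q.hb
  exact ⟨by linarith [hu.1], by linarith [hu.2]⟩

lemma FH_unique {γ : ℝ → ℂ} {t0 t1 τ0 τ1 : ℝ} (h0 : Q.FH γ t0 τ0) (h1 : Q.FH γ t1 τ1) :
    t0 = t1 ∧ τ0 = τ1 := by
  have ht : t0 = t1 := by
    rcases lt_trichotomy t0 t1 with h | h | h
    · exact absurd (h0.2.2.1 ▸ Q.c_mem τ0) (h1.2.2.2.2 t0 ⟨h0.1, h⟩)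
    · exact h
    · exact absurd (h1.2.2.1 ▸ Q.c_mem τ1) (h0.2.2.2.2 t1 ⟨h1.1, h⟩)
  subst ht
  exact ⟨rfl, Q.c_inj (Q.Ioo_sub h0.2.2.2.1) (Q.Ioo_sub h1.2.2.2.1)
    (h0.2.2.1.symm.trans h1.2.2.1)⟩

lemma z1_le_of_FH {γ : ℝ → ℂ} {t0 τ0 : ℝ} (h : Q.FH γ t0 τ0) : Q.z1 γ ≤ ENNReal.ofReal τ0 := by
  refine max_le (iSup₂_le fun p hp => ?_) (iSup_le fun hn => ?_)
  · rw [(Q.FH_unique hp h).2]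
  · exact absurd (h.2.2.1 ▸ Q.c_mem τ0) (hn t0 ⟨h.1, h.2.1⟩)

lemma le_z1_of_FH {γ : ℝ → ℂ} {t0 τ0 : ℝ} (h : Q.FH γ t0 τ0) : ENNReal.ofReal τ0 ≤ Q.z1 γ :=
  le_trans (le_iSup₂ (f := fun (p : ℝ × ℝ) (_ : Q.FH γ p.1 p.2) => ENNReal.ofReal p.2) (t0, τ0) h)
    (le_max_left _ _)

lemma le_z1_of_NoHit {γ : ℝ → ℂ} (h : Q.NoHit γ) : 2 ≤ Q.z1 γ :=
  le_trans (le_iSup (f := fun (_ : Q.NoHit γ) => (2:ℝ≥0∞)) h) (le_max_right _ _)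

lemma z1_le_two (γ : ℝ → ℂ) : Q.z1 γ ≤ 2 := by
  refine max_le (iSup₂_le fun p hp => ?_) (iSup_le fun hn => le_rfl)
  rw [show (2:ℝ≥0∞) = ENNReal.ofReal 2 by simp]
  refine ENNReal.ofReal_le_ofReal ?_
  have := hp.2.2.2.1.2
  linarith [Q.hab, Q.ha, Q.hb]

lemma z1_swp {γ0 γ σ : ℝ → ℂ} {s s' : ℝ} {α β : ℝ → ℝ} (W : Swp γ0 γ s s' σ α β)
    {th : ℝ} (hth : th ∈ Ioc 0 s) (hB : γ0 th ∈ Q.B) : Q.z1 γ0 ≤ Q.z1 σ := by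
  refine max_le (iSup₂_le fun p hp => ?_) (iSup_le fun hn => ?_)
  · have hle : p.1 ≤ th := by
      by_contra hcon
      push Not at hcon
      exact hp.2.2.2.2 th ⟨hth.1, hcon⟩ hB
    have hm : p.1 ∈ Icc 0 s := ⟨hp.1.le, hle.trans hth.2⟩
    refine Q.le_z1_of_FH (t0 := α p.1) ⟨W.al_pos ⟨hp.1, hm.2⟩, by linarith [(W.al_mem hm).2],
      by rw [W.ea _ hm, hp.2.2.1], hp.2.2.2.1, fun t ht => ?_⟩
    obtain ⟨r, hr, rfl⟩ := W.left_time ⟨le_rfl, W.hs.1.le⟩ hm (by rw [W.a0]; exact ht)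
    rw [W.ea r ⟨hr.1.le, hr.2.le.trans hm.2⟩]
    exact hp.2.2.2.2 r hr
  · exact absurd hB (hn th ⟨hth.1, hth.2.trans_lt W.hs.2⟩)

lemma FH_swp {γ0 γ σ : ℝ → ℂ} {s s' : ℝ} {α β : ℝ → ℝ} (W : Swp γ0 γ s s' σ α β)
    (h0 : ∀ t ∈ Ioc 0 s, γ0 t ∉ Q.B) {y z : ℝ} (hy : y ∈ Ioo s' 1)
    (h1 : ∀ t ∈ Ico s' y, γ t ∉ Q.B) (hz : γ y = Q.c z) (hzl : z ∈ Ioo 0 Q.l) :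
    Q.FH σ (β y) z := by
  have hm : y ∈ Icc s' 1 := ⟨hy.1.le, hy.2.le⟩
  refine ⟨by linarith [(W.be_mem hm).1], W.be_lt ⟨hm.1, hy.2⟩, by rw [W.eb _ hm, hz], hzl,
    fun t ht => ?_⟩
  rcases W.mid_time ⟨le_rfl, W.hs.1.le⟩ hm (by rw [W.a0]; exact ht) with ⟨r, hr, rfl⟩ | ⟨r, hr, rfl⟩
  · rw [W.ea r ⟨hr.1.le, hr.2⟩]; exact h0 r hr
  · rw [W.eb r ⟨hr.1, hr.2.le.trans hm.2⟩]; exact h1 r hr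

lemma NoHit_swp {γ0 γ σ : ℝ → ℂ} {s s' : ℝ} {α β : ℝ → ℝ} (W : Swp γ0 γ s s' σ α β)
    (h0 : ∀ t ∈ Ioc 0 s, γ0 t ∉ Q.B) (h1 : ∀ t ∈ Ico s' 1, γ t ∉ Q.B) : Q.NoHit σ := by
  intro t ht
  rcases W.all_time ht with ⟨r, hr, rfl⟩ | ⟨r, hr, rfl⟩
  · rw [W.ea r ⟨hr.1.le, hr.2⟩]; exact h0 r hr
  · rw [W.eb r ⟨hr.1, hr.2.le⟩]; exact h1 r hr

/-! chord sums -/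

def wt (δ : ℝ) (γ : ℝ → ℂ) (p : ℝ × ℝ) : ℝ≥0∞ :=
  ⨆ q : ℝ × ℝ, ⨆ _ : Q.Chord γ p.1 p.2 q.1 q.2 ∧ q.1 + δ ≤ q.2, ENNReal.ofReal ((q.2 - q.1) ^ 2)

def Gf (δ : ℝ) (γ : ℝ → ℂ) : ℝ≥0∞ := ∑' p, Q.wt δ γ p

lemma wt_ne {δ : ℝ} {γ : ℝ → ℂ} {p : ℝ × ℝ} (h : Q.wt δ γ p ≠ 0) :
    ∃ u v, Q.Chord γ p.1 p.2 u v ∧ u + δ ≤ v := by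
  by_contra hcon
  apply h
  unfold wt
  simp only [ENNReal.iSup_eq_zero]
  rintro ⟨u, v⟩ hq
  exact absurd ⟨u, v, hq⟩ hcon

lemma wt_trans {δ : ℝ} {γ σ : ℝ → ℂ} {p q : ℝ × ℝ}
    (h : ∀ u v, Q.Chord γ p.1 p.2 u v → Q.Chord σ q.1 q.2 u v) : Q.wt δ γ p ≤ Q.wt δ σ q := by
  refine iSup₂_le fun r hr => ?_
  exact le_iSup₂ (f := fun (r : ℝ × ℝ) (_ : Q.Chord σ q.1 q.2 r.1 r.2 ∧ r.1 + δ ≤ r.2) =>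
    ENNReal.ofReal ((r.2 - r.1) ^ 2)) r ⟨h _ _ hr.1, hr.2⟩

lemma chord_unique {γ : ℝ → ℂ} {s s' u v u' v' : ℝ} (h : Q.Chord γ s s' u v)
    (h' : Q.Chord γ s s' u' v') : u = u' ∧ v = v' := by
  obtain ⟨a1, a2, a3, a4, a5, a6, a7, a8⟩ := h
  obtain ⟨b1, b2, b3, b4, b5, b6, b7, b8⟩ := h'
  exact ⟨Q.c_inj (Q.Ioo_sub a5) (Q.Ioo_sub b5) (a7.symm.trans b7),
    Q.c_inj (Q.Ioo_sub a6) (Q.Ioo_sub b6) (a8.symm.trans b8)⟩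

lemma wt_le {δ : ℝ} {γ : ℝ → ℂ} {s s' u v : ℝ} (h : Q.Chord γ s s' u v) :
    Q.wt δ γ (s, s') ≤ ENNReal.ofReal ((v - u) ^ 2) := by
  refine iSup₂_le fun r hr => ?_
  obtain ⟨e1, e2⟩ := Q.chord_unique h hr.1
  rw [e1, e2]

lemma le_wt {δ : ℝ} {γ : ℝ → ℂ} {s s' u v : ℝ} (h : Q.Chord γ s s' u v) (hd : u + δ ≤ v) :
    ENNReal.ofReal ((v - u) ^ 2) ≤ Q.wt δ γ (s, s') :=
  le_iSup₂ (f := fun (r : ℝ × ℝ) (_ : Q.Chord γ s s' r.1 r.2 ∧ r.1 + δ ≤ r.2) =>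
    ENNReal.ofReal ((r.2 - r.1) ^ 2)) (u, v) ⟨h, hd⟩

lemma chord_nZ_left {γ : ℝ → ℂ} {s s' u v : ℝ} (h : Q.Chord γ s s' u v) : γ s ∉ Q.Z := fun hz =>
  Q.Z_B hz (h.2.2.2.2.2.2.1 ▸ Q.c_mem u)
lemma chord_nZ_right {γ : ℝ → ℂ} {s s' u v : ℝ} (h : Q.Chord γ s s' u v) : γ s' ∉ Q.Z := fun hz =>
  Q.Z_B hz (h.2.2.2.2.2.2.2 ▸ Q.c_mem v)

/-- chords and points outside Z -/
lemma chord_out {γ : ℝ → ℂ} {s s' u v r : ℝ} (h : Q.Chord γ s s' u v) (hr : γ r ∉ Q.Z) :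
    s' ≤ r ∨ r ≤ s := by
  by_contra hcon
  push Not at hcon
  exact hr (h.2.2.2.1 r ⟨hcon.2, hcon.1⟩)

open Classical in
lemma G_split {δ : ℝ} {γ : ℝ → ℂ} {x y : ℝ} (hxy : x ≤ y) (hx : γ x ∉ Q.Z) (hy : γ y ∉ Q.Z)
    (hm : x = y ∨ ∀ t ∈ Ioo x y, γ t ∈ Q.Z) :
    Q.Gf δ γ ≤ (∑' p : ℝ × ℝ, if p.2 ≤ x then Q.wt δ γ p else 0) +
      (∑' p : ℝ × ℝ, if y ≤ p.1 then Q.wt δ γ p else 0) + Q.wt δ γ (x, y) := by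
  have e : Q.wt δ γ (x, y) = ∑' p : ℝ × ℝ, if p = (x, y) then Q.wt δ γ p else 0 :=
    (tsum_ite_eq (x, y) _).symm
  rw [e, ← ENNReal.tsum_add, ← ENNReal.tsum_add]
  refine ENNReal.tsum_le_tsum fun p => ?_
  by_cases h0 : Q.wt δ γ p = 0
  · rw [h0]; exact bot_le
  obtain ⟨u, v, hch, -⟩ := Q.wt_ne h0
  rcases Q.chord_out hch hx with h | h
  · simp only [h, if_true]; exact le_self_add.trans le_self_add
  rcases Q.chord_out hch hy with h' | h'
  · have hpp := hch.2.1
    have hxy' : x < y := by linarith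
    rcases hm with hm | hm
    · exact absurd hm hxy'.ne
    have e1 : p.1 = x := by
      by_contra hne
      have : x < p.1 := lt_of_le_of_ne h (Ne.symm hne)
      exact Q.chord_nZ_left hch (hm p.1 ⟨this, by linarith⟩)
    have e2 : p.2 = y := by
      by_contra hne
      have : p.2 < y := lt_of_le_of_ne h' hne
      exact Q.chord_nZ_right hch (hm p.2 ⟨by linarith, this⟩)
    have : p = (x, y) := Prod.ext e1 e2
    rw [if_pos this]
    exact le_add_self
  · rw [if_pos h']
    exact le_trans le_add_self le_self_add

open Classical in
lemma G_lower {δ : ℝ} {γ0 γ σ : ℝ → ℂ} {s s' : ℝ} {α β : ℝ → ℝ} (W : Swp γ0 γ s s' σ α β)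
    {x y : ℝ} (hx : x ∈ Icc 0 s) (hy : y ∈ Icc s' 1) :
    (∑' p : ℝ × ℝ, if p.2 ≤ x then Q.wt δ γ0 p else 0) +
      (∑' p : ℝ × ℝ, if y ≤ p.1 then Q.wt δ γ p else 0) + Q.wt δ σ (α x, β y) ≤ Q.Gf δ σ := by
  have h1 : (∑' p : ℝ × ℝ, if p.2 ≤ x then Q.wt δ γ0 p else 0) ≤
      ∑' q : ℝ × ℝ, if q.2 ≤ α x then Q.wt δ σ q else 0 := by
    set S : Set (ℝ × ℝ) := {p | 0 ≤ p.1 ∧ p.1 < p.2 ∧ p.2 ≤ x} with hS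
    have hsup : Function.support (fun p : ℝ × ℝ => if p.2 ≤ x then Q.wt δ γ0 p else 0) ⊆ S := by
      intro p hp
      simp only [Function.mem_support, ne_eq, ite_eq_right_iff, Classical.not_imp] at hp
      obtain ⟨u, v, hch, -⟩ := Q.wt_ne hp.2
      exact ⟨hch.1.le, hch.2.1, hp.1⟩
    rw [← tsum_subtype_eq_of_support_subset hsup]
    have hinj : Function.Injective (fun p : S => ((α p.1.1, α p.1.2) : ℝ × ℝ)) := by
      rintro ⟨⟨p1, p2⟩, hp⟩ ⟨⟨q1, q2⟩, hq⟩ he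
      simp only [hS, mem_setOf_eq] at hp hq
      simp only [Prod.mk.injEq] at he
      have e1 := W.ma.injOn ⟨hp.1, by linarith [hx.2]⟩ ⟨hq.1, by linarith [hx.2]⟩ he.1
      have e2 := W.ma.injOn ⟨by linarith, by linarith [hx.2]⟩ ⟨by linarith, by linarith [hx.2]⟩ he.2
      simp [e1, e2]
    refine le_trans (ENNReal.tsum_le_tsum fun p => ?_) (ENNReal.tsum_comp_le_tsum_of_injective hinj
      (fun q : ℝ × ℝ => if q.2 ≤ α x then Q.wt δ σ q else 0))
    obtain ⟨⟨p1, p2⟩, hp⟩ := p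
    simp only [hS, mem_setOf_eq] at hp
    have hle : α p2 ≤ α x := W.ma.monotoneOn ⟨by linarith, by linarith [hx.2]⟩ hx hp.2.2
    simp only [hp.2.2, hle, if_true]
    exact Q.wt_trans fun u v h => Q.chord_left W h (hp.2.2.trans hx.2)
  have h2 : (∑' p : ℝ × ℝ, if y ≤ p.1 then Q.wt δ γ p else 0) ≤
      ∑' q : ℝ × ℝ, if β y ≤ q.1 then Q.wt δ σ q else 0 := by
    set S : Set (ℝ × ℝ) := {p | y ≤ p.1 ∧ p.1 < p.2 ∧ p.2 ≤ 1} with hS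
    have hsup : Function.support (fun p : ℝ × ℝ => if y ≤ p.1 then Q.wt δ γ p else 0) ⊆ S := by
      intro p hp
      simp only [Function.mem_support, ne_eq, ite_eq_right_iff, Classical.not_imp] at hp
      obtain ⟨u, v, hch, -⟩ := Q.wt_ne hp.2
      exact ⟨hp.1, hch.2.1, hch.2.2.1.le⟩
    rw [← tsum_subtype_eq_of_support_subset hsup]
    have hinj : Function.Injective (fun p : S => ((β p.1.1, β p.1.2) : ℝ × ℝ)) := by
      rintro ⟨⟨p1, p2⟩, hp⟩ ⟨⟨q1, q2⟩, hq⟩ he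
      simp only [hS, mem_setOf_eq] at hp hq
      simp only [Prod.mk.injEq] at he
      have e1 := W.mb.injOn ⟨by linarith [hy.1], by linarith⟩ ⟨by linarith [hy.1], by linarith⟩ he.1
      have e2 := W.mb.injOn ⟨by linarith [hy.1], by linarith⟩ ⟨by linarith [hy.1], by linarith⟩ he.2
      simp [e1, e2]
    refine le_trans (ENNReal.tsum_le_tsum fun p => ?_) (ENNReal.tsum_comp_le_tsum_of_injective hinj
      (fun q : ℝ × ℝ => if β y ≤ q.1 then Q.wt δ σ q else 0))
    obtain ⟨⟨p1, p2⟩, hp⟩ := p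
    simp only [hS, mem_setOf_eq] at hp
    have hle : β y ≤ β p1 := W.mb.monotoneOn hy ⟨by linarith [hy.1], by linarith⟩ hp.1
    simp only [hp.1, hle, if_true]
    exact Q.wt_trans fun u v h => Q.chord_right W h (hy.1.trans hp.1)
  have e : Q.wt δ σ (α x, β y) = ∑' p : ℝ × ℝ, if p = (α x, β y) then Q.wt δ σ p else 0 :=
    (tsum_ite_eq (α x, β y) _).symm
  refine (add_le_add (add_le_add h1 h2) le_rfl).trans ?_
  rw [e, ← ENNReal.tsum_add, ← ENNReal.tsum_add]
  refine ENNReal.tsum_le_tsum fun q => ?_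
  by_cases h0 : Q.wt δ σ q = 0
  · simp [h0]
  obtain ⟨u, v, hch, -⟩ := Q.wt_ne h0
  have hlt := hch.2.1
  have hxy : α x ≤ β y := (W.al_mem hx).2.trans (W.be_mem hy).1
  by_cases c1 : q.2 ≤ α x
  · have c2 : ¬ β y ≤ q.1 := by intro h; linarith
    have c3 : q ≠ (α x, β y) := by rintro rfl; simp only [] at c1 hlt; linarith
    simp [c1, c2, c3]
  · by_cases c2 : β y ≤ q.1
    · have c3 : q ≠ (α x, β y) := by rintro rfl; simp only [] at c2 hlt; linarith
      simp [c1, c2, c3]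
    · by_cases c3 : q = (α x, β y)
      · rw [if_neg c1, if_neg c2, if_pos c3]; simp
      · simp [c1, c2, c3]

end Cfg
end P8
end Snk

namespace Snk
section P9
open Filter Topology
namespace Cfg
variable (Q : Cfg)

def Nf (δ : ℝ) (γ : ℝ → ℂ) : ℝ≥0∞ := Q.z1 γ + Q.Gf δ γ

/-- sum over disjoint chord intervals -/
lemma Gf_le {δ : ℝ} {γ : ℝ → ℂ} {ρ : ℂ → ℝ≥0∞}
    (h : ∀ s s' u v, Q.Chord γ s s' u v → u + δ ≤ v → 1 ≤ Lr ρ γ s s') :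
    Q.Gf δ γ ≤ Lr ρ γ 0 1 := by
  classical
  set f : ℝ → ℝ≥0∞ := fun t => ρ (γ t) * (‖deriv γ t‖₊ : ℝ≥0∞) with hf
  set As : ℝ × ℝ → Set ℝ := fun p => if Q.wt δ γ p = 0 then ∅ else Ioo p.1 p.2 with hAs
  set μ : Measure ℝ := (volume.restrict (Ioo (0:ℝ) 1)).withDensity f with hμ
  have hmeas : ∀ p, MeasurableSet (As p) := by
    intro p; simp only [hAs]; split_ifs
    · exact MeasurableSet.empty
    · exact measurableSet_Ioo
  have hdis : Pairwise (fun p q => Disjoint (As p) (As q)) := by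
    intro p q hpq
    simp only [hAs]
    split_ifs with h1 h2 h2
    · simp
    · simp
    · simp
    · obtain ⟨u, v, hc, -⟩ := Q.wt_ne h1
      obtain ⟨u', v', hc', -⟩ := Q.wt_ne h2
      rw [Set.disjoint_left]
      intro t ht ht'
      apply hpq
      have e1 := Q.chord_out hc (Q.chord_nZ_left hc')
      have e2 := Q.chord_out hc (Q.chord_nZ_right hc')
      have e3 := Q.chord_out hc' (Q.chord_nZ_left hc)
      have e4 := Q.chord_out hc' (Q.chord_nZ_right hc)
      have a1 := ht.1; have a2 := ht.2; have a3 := ht'.1; have a4 := ht'.2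
      refine Prod.ext ?_ ?_
      · rcases e1 with e1 | e1 <;> rcases e3 with e3 | e3 <;> linarith
      · rcases e2 with e2 | e2 <;> rcases e4 with e4 | e4 <;> linarith
  have key := tsum_meas_le_meas_iUnion_of_disjoint μ hmeas hdis
  have hle : ∀ p, Q.wt δ γ p ≤ μ (As p) := by
    intro p
    by_cases h0 : Q.wt δ γ p = 0
    · rw [h0]; exact bot_le
    · obtain ⟨u, v, hc, hd⟩ := Q.wt_ne h0
      have e : As p = Ioo p.1 p.2 := by simp only [hAs]; rw [if_neg h0]
      have hsub : Ioo p.1 p.2 ⊆ Ioo (0:ℝ) 1 := Ioo_subset_Ioo hc.1.le hc.2.2.1.le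
      rw [e, hμ, withDensity_apply _ measurableSet_Ioo, Measure.restrict_restrict measurableSet_Ioo,
        inter_eq_self_of_subset_left hsub]
      refine le_trans (Q.wt_le hc) (le_trans ?_ (h _ _ _ _ hc hd))
      rw [← ENNReal.ofReal_one]
      refine ENNReal.ofReal_le_ofReal ?_
      have h1 := hc.2.2.2.2.1; have h2 := hc.2.2.2.2.2.1
      have := Q.hab; have := Q.ha; have := Q.hb
      nlinarith [h1.1, h1.2, h2.1, h2.2]
  calc Q.Gf δ γ ≤ ∑' p, μ (As p) := ENNReal.tsum_le_tsum hle
    _ ≤ μ (⋃ p, As p) := key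
    _ ≤ μ univ := measure_mono (subset_univ _)
    _ = Lr ρ γ 0 1 := by
        rw [hμ, withDensity_apply _ MeasurableSet.univ, Measure.restrict_univ]; rfl

lemma exists_rhoc {δ : ℝ} (hδ : 0 < δ) : ∃ ρc : ℂ → ℝ≥0∞, Measurable ρc ∧ mass ρc ≠ ∞ ∧
    ∀ γ ∈ Q.F, Q.Nf δ γ ≤ Lr ρc γ 0 1 := by
  obtain ⟨ρ0, h0, hm0⟩ := exists_adm_of_lt (lt_of_le_of_ne le_top Q.F_finite)
  obtain ⟨D, hD, hsep⟩ := Q.sep (K := (Icc 0 Q.l ×ˢ Icc 0 Q.l) ∩ {p | p.1 + δ ≤ p.2})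
    ((isCompact_Icc.prod isCompact_Icc).inter_right
      (isClosed_le (by fun_prop) (by fun_prop))) (by
      rintro ⟨u, v⟩ ⟨⟨hu, hv⟩, hd⟩ he
      have := Q.ha; have := Q.hb
      have := Q.c_inj ⟨by linarith [hu.1], by linarith [hu.2]⟩
        ⟨by linarith [hv.1], by linarith [hv.2]⟩ he
      have hd' : u + δ ≤ v := hd
      have h3 : u = v := this
      linarith)
  set ρ1 : ℂ → ℝ≥0∞ := Q.Z.indicator fun _ => ENNReal.ofReal D⁻¹ with hρ1
  have hZm : MeasurableSet Q.Z := Q.Z_open.measurableSet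
  have m1 : Measurable ρ1 := measurable_const.indicator hZm
  have m2 : Measurable fun z => 2 * ρ0 z := h0.1.const_mul 2
  have hvol : volume Q.Z ≠ ∞ := ((measure_mono Q.Z_Zc).trans_lt Q.Zc_compact.measure_lt_top).ne
  refine ⟨fun z => 2 * ρ0 z + ρ1 z, m2.add m1, ?_, fun γ hγ => ?_⟩
  · have e1 : mass (fun z => 2 * ρ0 z + ρ1 z) ≤ 2 ^ 2 * mass (fun z => max (2 * ρ0 z) (ρ1 z)) := by
      rw [← mass_const_mul _ (m2.max m1)]
      unfold mass
      refine lintegral_mono fun z => ?_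
      refine pow_le_pow_left' ?_ 2
      show 2 * ρ0 z + ρ1 z ≤ 2 * max (2 * ρ0 z) (ρ1 z)
      rw [two_mul (max _ _)]
      exact add_le_add (le_max_left _ _) (le_max_right _ _)
    have e2 : mass (fun z => max (2 * ρ0 z) (ρ1 z)) ≤ 2 ^ 2 * mass ρ0 + mass ρ1 := by
      rw [← mass_const_mul _ h0.1]
      unfold mass
      rw [← lintegral_add_right _ (m1.pow_const 2)]
      refine lintegral_mono fun z => ?_
      rcases le_total (2 * ρ0 z) (ρ1 z) with h | h
      · simp only [max_eq_right h]; exact le_add_self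
      · simp only [max_eq_left h]; exact le_self_add
    have e3 : mass ρ1 ≠ ∞ := by
      rw [hρ1, mass_indicator hZm]
      exact ENNReal.mul_ne_top (by finiteness) hvol
    refine ne_top_of_le_ne_top ?_ e1
    refine ENNReal.mul_ne_top (by finiteness) (ne_top_of_le_ne_top ?_ e2)
    exact ENNReal.add_ne_top.2 ⟨ENNReal.mul_ne_top (by finiteness) (ne_of_lt hm0), e3⟩
  · have hc := hγ.1
    have hfm : AEMeasurable (fun t => 2 * ρ0 (γ t) * (‖deriv γ t‖₊ : ℝ≥0∞))
        (volume.restrict (Ioo (0:ℝ) 1)) := by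
      have hγm : AEMeasurable γ (volume.restrict (Ioo (0:ℝ) 1)) :=
        (hc.1.mono Ioo_subset_Icc_self).aemeasurable measurableSet_Ioo
      exact (m2.comp_aemeasurable hγm).mul (measurable_deriv γ).nnnorm.coe_nnreal_ennreal.aemeasurable
    have e : Lr (fun z => 2 * ρ0 z) γ 0 1 + Lr ρ1 γ 0 1 = Lr (fun z => 2 * ρ0 z + ρ1 z) γ 0 1 := by
      unfold Lr
      rw [← lintegral_add_left' hfm]
      simp only [add_mul]
    rw [← e]
    refine add_le_add ((Q.z1_le_two γ).trans ?_) (Q.Gf_le fun s s' u v hch hd => ?_)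
    · rw [Lr_const_mul (k := 2) (by finiteness) ρ0 γ 0 1]
      calc (2:ℝ≥0∞) = 2 * 1 := (mul_one 2).symm
        _ ≤ _ := by gcongr; exact h0.2 γ hγ
    · obtain ⟨a1, a2, a3, a4, a5, a6, a7, a8⟩ := hch
      have hk := Lr_ge (ρ := ρ1) (γ := γ) a2 (hc.1.mono (Icc_subset_Icc a1.le a3.le))
        (hc.2.mono (Ioo_subset_Ioo a1.le a3.le)) (k := ENNReal.ofReal D⁻¹) (by finiteness)
        (fun t ht => by rw [hρ1, indicator_of_mem (a4 t ht)])
      refine le_trans ?_ hk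
      have hs := hsep (u, v) ⟨⟨⟨a5.1.le, a5.2.le⟩, ⟨a6.1.le, a6.2.le⟩⟩, hd⟩
      rw [a7, a8, ← ofReal_norm, ← ENNReal.ofReal_mul (by positivity), ← ENNReal.ofReal_one]
      refine ENNReal.ofReal_le_ofReal ?_
      rw [norm_sub_rev]
      simp only at hs
      rw [inv_mul_eq_div, le_div_iff₀ hD]; linarith

end Cfg
end P9
end Snk

namespace Snk
section PA
open Filter Topology
namespace Cfg
variable (Q : Cfg)

/-- the tight family data -/
structure Tight (δ κ ε : ℝ) (ρ : ℂ → ℝ≥0∞) : Prop where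
  hδ : 0 < δ
  hδ1 : δ ≤ 1
  hκ : 0 < κ
  he : 0 ≤ ε
  e1 : 2 * ε ≤ κ * δ
  e2 : 2 * ε ≤ κ * (3 * δ ^ 2)
  low : ∀ γ ∈ Q.F, 1 + ENNReal.ofReal κ * Q.Nf δ γ ≤ Lr ρ γ 0 1

def Tt (δ κ ε : ℝ) (ρ : ℂ → ℝ≥0∞) : Set (ℝ → ℂ) :=
  {γ ∈ Q.F | Lr ρ γ 0 1 < 1 + ENNReal.ofReal κ * Q.Nf δ γ + ENNReal.ofReal ε}

variable {Q} {δ κ ε : ℝ} {ρ : ℂ → ℝ≥0∞}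

lemma Tight.fin (T : Q.Tight δ κ ε ρ) {γ : ℝ → ℂ} (h : γ ∈ Q.Tt δ κ ε ρ) : Q.Nf δ γ ≠ ∞ := by
  intro hN
  have h1 := T.low γ h.1
  have h2 := h.2
  rw [hN, ENNReal.mul_top (by simpa using T.hκ)] at h1
  simp at h1
  rw [h1] at h2
  exact not_top_lt h2

lemma Tight.swap_contra (T : Q.Tight δ κ ε ρ) {γ0 γ σ σ' : ℝ → ℂ} {s s' : ℝ} {α β α' β' : ℝ → ℝ}
    (h0 : γ0 ∈ Q.Tt δ κ ε ρ) (h : γ ∈ Q.Tt δ κ ε ρ) (W : Swp γ0 γ s s' σ α β)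
    (W' : Swp γ γ0 s' s σ' α' β') {g : ℝ}
    (hg : 2 * ε ≤ κ * g)
    (hN : Q.Nf δ γ0 + Q.Nf δ γ + ENNReal.ofReal g ≤ Q.Nf δ σ + Q.Nf δ σ') : False := by
  have f0 := T.fin h0
  have f1 := T.fin h
  have l1 := T.low σ (Q.swp_F W h0.1 h.1)
  have l2 := T.low σ' (Q.swp_F W' h.1 h0.1)
  have u0 := h0.2
  have u1 := h.2
  have e : Lr ρ σ 0 1 + Lr ρ σ' 0 1 = Lr ρ γ0 0 1 + Lr ρ γ 0 1 := by
    rw [W.len, W'.len, Lr_split ρ γ0 W.hs.1.le W.hs.2.le, Lr_split ρ γ W.hs'.1.le W.hs'.2.le]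
    ring
  have fin : Q.Nf δ γ0 + Q.Nf δ γ ≠ ∞ := ENNReal.add_ne_top.2 ⟨f0, f1⟩
  have key : 2 + ENNReal.ofReal κ * (Q.Nf δ γ0 + Q.Nf δ γ) + ENNReal.ofReal (2 * ε) <
      2 + ENNReal.ofReal κ * (Q.Nf δ γ0 + Q.Nf δ γ) + ENNReal.ofReal (2 * ε) := by
    calc 2 + ENNReal.ofReal κ * (Q.Nf δ γ0 + Q.Nf δ γ) + ENNReal.ofReal (2 * ε)
        ≤ 2 + ENNReal.ofReal κ * (Q.Nf δ γ0 + Q.Nf δ γ) + ENNReal.ofReal (κ * g) := by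
          gcongr
      _ = 2 + ENNReal.ofReal κ * (Q.Nf δ γ0 + Q.Nf δ γ + ENNReal.ofReal g) := by
          rw [ENNReal.ofReal_mul T.hκ.le]; ring
      _ ≤ 2 + ENNReal.ofReal κ * (Q.Nf δ σ + Q.Nf δ σ') := by gcongr
      _ = (1 + ENNReal.ofReal κ * Q.Nf δ σ) + (1 + ENNReal.ofReal κ * Q.Nf δ σ') := by ring
      _ ≤ Lr ρ σ 0 1 + Lr ρ σ' 0 1 := add_le_add l1 l2
      _ = Lr ρ γ0 0 1 + Lr ρ γ 0 1 := e
      _ < (1 + ENNReal.ofReal κ * Q.Nf δ γ0 + ENNReal.ofReal ε) +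
          (1 + ENNReal.ofReal κ * Q.Nf δ γ + ENNReal.ofReal ε) := ENNReal.add_lt_add u0 u1
      _ = 2 + ENNReal.ofReal κ * (Q.Nf δ γ0 + Q.Nf δ γ) + ENNReal.ofReal (2 * ε) := by
          rw [ENNReal.ofReal_mul (by norm_num)]; simp; ring
  exact lt_irrefl _ key

/-- connectivity: an arc avoiding `B` is inside or outside -/
lemma conn {γ : ℝ → ℂ} {x y : ℝ} (hc : ContinuousOn γ (Ioo x y)) (hB : ∀ t ∈ Ioo x y, γ t ∉ Q.B)
    {r : ℝ} (hr : r ∈ Ioo x y) (hz : γ r ∈ Q.Z) : ∀ t ∈ Ioo x y, γ t ∈ Q.Z := by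
  have hp : IsPreconnected (γ '' Ioo x y) := isPreconnected_Ioo.image γ hc
  have hsub : γ '' Ioo x y ⊆ Q.Z ∪ Q.Zcᶜ := by
    rintro _ ⟨t, ht, rfl⟩
    by_cases h : γ t ∈ Q.Zc
    · rw [Q.Zc_eq] at h
      exact Or.inl (h.resolve_right (hB t ht))
    · exact Or.inr h
  have := hp.subset_left_of_subset_union Q.Z_open Q.Zc_compact.isClosed.isOpen_compl
    (disjoint_compl_right_iff_subset.2 Q.Z_Zc) hsub ⟨γ r, ⟨r, hr, rfl⟩, hz⟩
  intro t ht
  exact this ⟨t, ht, rfl⟩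

lemma F_end0 {γ : ℝ → ℂ} (h : γ ∈ Q.F) : ∃ i ∈ Icc (-Q.a) 0, γ 0 = Q.c i := by
  obtain ⟨i, hi, e⟩ := h.2.1
  exact ⟨i, hi, e.symm⟩

lemma F_end1 {γ : ℝ → ℂ} (h : γ ∈ Q.F) : ∃ i ∈ Icc Q.l (Q.l + Q.b), γ 1 = Q.c i := by
  obtain ⟨i, hi, e⟩ := h.2.2.1
  exact ⟨i, hi, e.symm⟩

lemma nZ_of_c {γ : ℝ → ℂ} {t u : ℝ} (h : γ t = Q.c u) : γ t ∉ Q.Z := fun hz =>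
  Q.Z_B hz (h ▸ Q.c_mem u)

/-- before the first hit the curve is outside -/
lemma before_FH {γ : ℝ → ℂ} (h : γ ∈ Q.F) {t0 : ℝ} (h1 : t0 ≤ 1)
    (hB : ∀ t ∈ Ioo 0 t0, γ t ∉ Q.B) : ∀ t ∈ Ioo 0 t0, γ t ∉ Q.Z := by
  intro t ht hz
  obtain ⟨η, hη, hn⟩ := h.2.2.2.1
  have hall := conn (h.1.1.mono (Ioo_subset_Icc_self.trans (Icc_subset_Icc le_rfl h1))) hB ht hz
  have h0 : 0 < t0 := ht.1.trans ht.2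
  have hm : 0 < min η t0 := lt_min hη h0
  have e1 := min_le_left η t0
  have e2 := min_le_right η t0
  exact hn (min η t0 / 2) ⟨by linarith, by linarith⟩ (hall _ ⟨by linarith, by linarith⟩)

lemma wt_self (γ : ℝ → ℂ) (s : ℝ) : Q.wt δ γ (s, s) = 0 := by
  by_contra h
  obtain ⟨u, v, hc, -⟩ := Q.wt_ne h
  exact lt_irrefl _ hc.2.1

lemma Tight.T1 (T : Q.Tight δ κ ε ρ) {γ0 γ : ℝ → ℂ} (h0 : γ0 ∈ Q.Tt δ κ ε ρ)
    (h : γ ∈ Q.Tt δ κ ε ρ) {t0 τ0 sy sz y : ℝ} (hF : Q.FH γ0 t0 τ0) (hsy : 0 < sy) (hyz : sy < sz)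
    (hz1 : sz ≤ 1) (ey : γ sy = Q.c y) (hy : 0 < y) (hyt : y < τ0)
    (hB : ∀ t ∈ Ioo sy sz, γ t ∉ Q.B) (hZ : ∀ t ∈ Ioo sy sz, γ t ∉ Q.Z)
    (hz : sz = 1 ∨ (sz < 1 ∧ ∃ z ∈ Ioo 0 Q.l, γ sz = Q.c z ∧ τ0 + δ ≤ z)) : False := by
  obtain ⟨f1, f2, f3, f4, f5⟩ := hF
  have ha := Q.ha; have hb := Q.hb; have hab := Q.hab; have hδ := T.hδ
  obtain ⟨i0, hi0, ei0⟩ := F_end0 h0.1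
  have hzz : ∃ z ∈ Ioc τ0 (Q.l + Q.b), γ sz = Q.c z := by
    rcases hz with rfl | ⟨-, z, hz, e, hd⟩
    · obtain ⟨z, hz, e⟩ := F_end1 h.1
      exact ⟨z, ⟨by linarith [f4.2, hz.1], hz.2⟩, e⟩
    · exact ⟨z, ⟨by linarith, by linarith [hz.2]⟩, e⟩
  obtain ⟨z, hzr, ez⟩ := hzz
  have nZ0 := before_FH h0.1 f2.le f5
  have hd0 : 0 < sz - sy := by linarith
  have mX : ∀ t ∈ Icc (0:ℝ) 1, t0 * t ∈ Icc 0 t0 := fun t ht =>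
    ⟨by nlinarith [ht.1], by nlinarith [ht.2]⟩
  have mY : ∀ t ∈ Icc (0:ℝ) 1, sy + (sz - sy) * t ∈ Icc sy sz := fun t ht =>
    ⟨by nlinarith [ht.1], by nlinarith [ht.2]⟩
  have nX : ∀ r ∈ Icc 0 t0, γ0 r ∉ Q.Z := by
    intro r hr
    rcases eq_or_lt_of_le hr.1 with e | e
    · rw [← e]; exact nZ_of_c ei0
    rcases eq_or_lt_of_le hr.2 with e' | e'
    · rw [e']; exact nZ_of_c f3
    exact nZ0 r ⟨e, e'⟩
  have nY : ∀ r ∈ Icc sy sz, γ r ∉ Q.Z := by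
    intro r hr
    rcases eq_or_lt_of_le hr.1 with e | e
    · rw [← e]; exact nZ_of_c ey
    rcases eq_or_lt_of_le hr.2 with e' | e'
    · rw [e']; exact nZ_of_c ez
    exact hZ r ⟨e, e'⟩
  obtain ⟨s_, hs_, t_, ht_, hst⟩ := outer_cross Q.contOn Q.injOn Q.holo
    (X := fun t => γ0 (t0 * t)) (Y := fun t => γ (sy + (sz - sy) * t))
    (a := Q.σ + i0) (b := Q.σ + y) (c := Q.σ + τ0) (d := Q.σ + z)
    (h0.1.1.1.comp (by fun_prop) fun t ht => ⟨(mX t ht).1, (mX t ht).2.trans f2.le⟩)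
    (h.1.1.1.comp (by fun_prop) fun t ht => ⟨hsy.le.trans (mY t ht).1, (mY t ht).2.trans hz1⟩)
    (fun t ht => nX _ (mX t ht)) (fun t ht => nY _ (mY t ht))
    (by linarith [hi0.2]) (by linarith) (by linarith [hzr.1]) (by linarith [hi0.1, hzr.2])
    (by simpa [Cfg.c] using ei0) (by simpa [Cfg.c] using f3) (by simpa [Cfg.c] using ey)
    (by simpa [Cfg.c] using ez)
  have hs := mX _ hs_
  have hs' := mY _ ht_
  change γ0 (t0 * s_) = γ (sy + (sz - sy) * t_) at hst
  generalize t0 * s_ = s at hs hst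
  generalize sy + (sz - sy) * t_ = s' at hs' hst
  have memI : i0 ∈ Icc (-Q.a) (Q.l + Q.b) := ⟨hi0.1, by linarith [hi0.2, Q.hl]⟩
  have memy : y ∈ Icc (-Q.a) (Q.l + Q.b) := ⟨by linarith, by linarith [f4.2]⟩
  have memt := Q.Ioo_sub f4
  have memz : z ∈ Icc (-Q.a) (Q.l + Q.b) := ⟨by linarith [hzr.1], hzr.2⟩
  have endB : γ s' ∈ Q.B → γ s' = Q.c y ∨ γ s' = Q.c z := by
    intro hb'
    rcases eq_or_lt_of_le hs'.1 with e | e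
    · left; rw [← e, ey]
    rcases eq_or_lt_of_le hs'.2 with e' | e'
    · right; rw [e', ez]
    exact absurd hb' (hB s' ⟨e, e'⟩)
  have s0 : 0 < s := by
    rcases eq_or_lt_of_le hs.1 with e | e
    · exfalso
      rw [← e, ei0] at hst
      rcases endB (hst ▸ Q.c_mem i0) with e1 | e1
      · have := Q.c_inj memI memy (hst.trans e1); linarith [hi0.2]
      · have := Q.c_inj memI memz (hst.trans e1); linarith [hi0.2, hzr.1]
    · exact e
  have s1 : s < t0 := by
    rcases eq_or_lt_of_le hs.2 with e | e
    · exfalso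
      rw [e, f3] at hst
      rcases endB (hst ▸ Q.c_mem τ0) with e1 | e1
      · have := Q.c_inj memt memy (hst.trans e1); linarith
      · have := Q.c_inj memt memz (hst.trans e1); linarith [hzr.1]
    · exact e
  have nB : γ s' ∉ Q.B := by rw [← hst]; exact f5 s ⟨s0, s1⟩
  have s2 : sy < s' := lt_of_le_of_ne hs'.1 fun e => nB (by rw [← e, ey]; exact Q.c_mem _)
  have s3 : s' < sz := lt_of_le_of_ne hs'.2 fun e => nB (by rw [e, ez]; exact Q.c_mem _)
  have ms : s ∈ Ioo (0:ℝ) 1 := ⟨s0, s1.trans f2⟩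
  have ms' : s' ∈ Ioo (0:ℝ) 1 := ⟨hsy.trans s2, s3.trans_le hz1⟩
  obtain ⟨σ, α, β, W⟩ := exists_swp h0.1.1 h.1.1 ms ms' hst
  obtain ⟨σ', α', β', W'⟩ := exists_swp h.1.1 h0.1.1 ms' ms hst.symm
  have g0 := Q.G_split (δ := δ) (le_refl s) (nX s hs) (nX s hs) (Or.inl rfl)
  have g1 := Q.G_split (δ := δ) (le_refl s') (nY s' hs') (nY s' hs') (Or.inl rfl)
  have l0 := Q.G_lower (δ := δ) W (x := s) (y := s') ⟨s0.le, le_rfl⟩ ⟨le_rfl, ms'.2.le⟩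
  have l1 := Q.G_lower (δ := δ) W' (x := s') (y := s) ⟨ms'.1.le, le_rfl⟩ ⟨le_rfl, ms.2.le⟩
  rw [wt_self, add_zero] at g0 g1
  have l0' := le_trans le_self_add l0
  have l1' := le_trans le_self_add l1
  have zz := Q.z1_swp W' (th := sy) ⟨hsy, s2.le⟩ (ey ▸ Q.c_mem y)
  have z0 := Q.z1_le_of_FH ⟨f1, f2, f3, f4, f5⟩
  have n0 : ∀ t ∈ Ioc 0 s, γ0 t ∉ Q.B := fun t ht => f5 t ⟨ht.1, ht.2.trans_lt s1⟩
  have n1 : ∀ t ∈ Ico s' sz, γ t ∉ Q.B := fun t ht => hB t ⟨s2.trans_le ht.1, ht.2⟩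
  have zσ : ENNReal.ofReal (τ0 + δ) ≤ Q.z1 σ := by
    rcases hz with rfl | ⟨hlt, z', hz', e', hd⟩
    · refine le_trans ?_ (Q.le_z1_of_NoHit (Q.NoHit_swp W n0 n1))
      rw [show (2:ℝ≥0∞) = ENNReal.ofReal 2 by simp]
      exact ENNReal.ofReal_le_ofReal (by linarith [f4.2, T.hδ1])
    · refine le_trans (ENNReal.ofReal_le_ofReal hd)
        (Q.le_z1_of_FH (Q.FH_swp W n0 ⟨s3, hlt⟩ n1 e' hz'))
  refine T.swap_contra h0 h W W' T.e1 ?_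
  unfold Nf
  rw [ENNReal.ofReal_add f4.1.le hδ.le] at zσ
  generalize (∑' p : ℝ × ℝ, if p.2 ≤ s then Q.wt δ γ0 p else 0) = A0 at *
  generalize (∑' p : ℝ × ℝ, if s ≤ p.1 then Q.wt δ γ0 p else 0) = B0 at *
  generalize (∑' p : ℝ × ℝ, if p.2 ≤ s' then Q.wt δ γ p else 0) = A1 at *
  generalize (∑' p : ℝ × ℝ, if s' ≤ p.1 then Q.wt δ γ p else 0) = B1 at *
  calc Q.z1 γ0 + Q.Gf δ γ0 + (Q.z1 γ + Q.Gf δ γ) + ENNReal.ofReal δ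
      ≤ ENNReal.ofReal τ0 + (A0 + B0) + (Q.z1 σ' + (A1 + B1)) + ENNReal.ofReal δ := by gcongr
    _ = (ENNReal.ofReal τ0 + ENNReal.ofReal δ) + (A0 + B1) + (Q.z1 σ' + (A1 + B0)) := by ring
    _ ≤ Q.z1 σ + Q.Gf δ σ + (Q.z1 σ' + Q.Gf δ σ') := by gcongr

lemma chord_Zc {γ : ℝ → ℂ} {s s' u v r : ℝ} (h : Q.Chord γ s s' u v) (hr : r ∈ Icc s s') :
    γ r ∈ Q.Zc := by
  obtain ⟨a1, a2, a3, a4, a5, a6, a7, a8⟩ := h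
  rcases eq_or_lt_of_le hr.1 with e | e
  · rw [← e, a7]; exact Q.B_Zc (Q.c_mem _)
  rcases eq_or_lt_of_le hr.2 with e' | e'
  · rw [e', a8]; exact Q.B_Zc (Q.c_mem _)
  exact Q.Z_Zc (a4 r ⟨e, e'⟩)

lemma chord_B {γ : ℝ → ℂ} {s s' u v r : ℝ} (h : Q.Chord γ s s' u v) (hr : r ∈ Icc s s')
    (hB : γ r ∈ Q.B) : γ r = Q.c u ∨ γ r = Q.c v := by
  obtain ⟨a1, a2, a3, a4, a5, a6, a7, a8⟩ := h
  rcases eq_or_lt_of_le hr.1 with e | e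
  · left; rw [← e, a7]
  rcases eq_or_lt_of_le hr.2 with e' | e'
  · right; rw [e', a8]
  exact absurd hB fun hB => Q.Z_B (a4 r ⟨e, e'⟩) hB

lemma chord_B' {γ : ℝ → ℂ} {s s' u v r : ℝ} (h : Q.Chord γ s s' u v) (hr : r ∈ Icc s s')
    (hB : γ r ∉ Q.B) : r ∈ Ioo s s' := by
  obtain ⟨a1, a2, a3, a4, a5, a6, a7, a8⟩ := h
  exact ⟨lt_of_le_of_ne hr.1 fun e => hB (by rw [← e, a7]; exact Q.c_mem _),
    lt_of_le_of_ne hr.2 fun e => hB (by rw [e, a8]; exact Q.c_mem _)⟩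

lemma Tight.T2 (T : Q.Tight δ κ ε ρ) {γ0 γ : ℝ → ℂ} (h0 : γ0 ∈ Q.Tt δ κ ε ρ)
    (h : γ ∈ Q.Tt δ κ ε ρ) {s0 s0' u0 v0 s3 s3' u3 v3 : ℝ} (C0 : Q.Chord γ0 s0 s0' u0 v0)
    (C3 : Q.Chord γ s3 s3' u3 v3) (h1 : u0 + 2 * δ ≤ u3) (h2 : u3 < v0) (h3 : v0 + δ ≤ v3) :
    False := by
  have ha := Q.ha; have hb := Q.hb; have hab := Q.hab; have hδ := T.hδ
  obtain ⟨a1, a2, a3, a4, a5, a6, a7, a8⟩ := id C0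
  obtain ⟨b1, b2, b3, b4, b5, b6, b7, b8⟩ := id C3
  have d0 : 0 < s0' - s0 := by linarith
  have d3 : 0 < s3' - s3 := by linarith
  have mX : ∀ t ∈ Icc (0:ℝ) 1, s0 + (s0' - s0) * t ∈ Icc s0 s0' := fun t ht =>
    ⟨by nlinarith [ht.1], by nlinarith [ht.2]⟩
  have mY : ∀ t ∈ Icc (0:ℝ) 1, s3 + (s3' - s3) * t ∈ Icc s3 s3' := fun t ht =>
    ⟨by nlinarith [ht.1], by nlinarith [ht.2]⟩
  have cX : ContinuousOn (fun t => γ0 (s0 + (s0' - s0) * t)) (Icc 0 1) :=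
    h0.1.1.1.comp (by fun_prop) fun t ht => ⟨a1.le.trans (mX t ht).1, (mX t ht).2.trans a3.le⟩
  have cY : ContinuousOn (fun t => γ (s3 + (s3' - s3) * t)) (Icc 0 1) :=
    h.1.1.1.comp (by fun_prop) fun t ht => ⟨b1.le.trans (mY t ht).1, (mY t ht).2.trans b3.le⟩
  obtain ⟨s_, hs_, t_, ht_, hst⟩ := disc_cross
    (X := fun t => Q.G (γ0 (s0 + (s0' - s0) * t))) (Y := fun t => Q.G (γ (s3 + (s3' - s3) * t)))
    (a := Q.σ + u0) (b := Q.σ + u3) (c := Q.σ + v0) (d := Q.σ + v3)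
    (Q.G_cont.comp cX fun t ht => chord_Zc C0 (mX t ht))
    (Q.G_cont.comp cY fun t ht => chord_Zc C3 (mY t ht))
    (fun t ht => by simpa using Q.G_mem (chord_Zc C0 (mX t ht)))
    (fun t ht => by simpa using Q.G_mem (chord_Zc C3 (mY t ht)))
    (by linarith) (by linarith) (by linarith) (by linarith [b6.2, a5.1])
    (by simp [a7, Q.G_c]) (by simp [a8, Q.G_c]) (by simp [b7, Q.G_c]) (by simp [b8, Q.G_c])
  have hs := mX _ hs_
  have hs' := mY _ ht_
  change Q.G (γ0 (s0 + (s0' - s0) * s_)) = Q.G (γ (s3 + (s3' - s3) * t_)) at hst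
  generalize s0 + (s0' - s0) * s_ = s at hs hst
  generalize s3 + (s3' - s3) * t_ = s' at hs' hst
  have hst : γ0 s = γ s' := by
    rw [← Q.HG (chord_Zc C0 hs), ← Q.HG (chord_Zc C3 hs'), hst]
  have nB : γ0 s ∉ Q.B := by
    intro hB
    have e1 := chord_B C0 hs hB
    have e2 := chord_B C3 hs' (hst ▸ hB)
    rw [← hst] at e2
    rcases e1 with e1 | e1 <;> rcases e2 with e2 | e2
    · have := Q.c_inj (Q.Ioo_sub a5) (Q.Ioo_sub b5) (e1.symm.trans e2); linarith
    · have := Q.c_inj (Q.Ioo_sub a5) (Q.Ioo_sub b6) (e1.symm.trans e2); linarith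
    · have := Q.c_inj (Q.Ioo_sub a6) (Q.Ioo_sub b5) (e1.symm.trans e2); linarith
    · have := Q.c_inj (Q.Ioo_sub a6) (Q.Ioo_sub b6) (e1.symm.trans e2); linarith
  have is := chord_B' C0 hs nB
  have is' := chord_B' C3 hs' (hst ▸ nB)
  have ms : s ∈ Ioo (0:ℝ) 1 := ⟨a1.trans is.1, is.2.trans a3⟩
  have ms' : s' ∈ Ioo (0:ℝ) 1 := ⟨b1.trans is'.1, is'.2.trans b3⟩
  obtain ⟨σ, α, β, W⟩ := exists_swp h0.1.1 h.1.1 ms ms' hst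
  obtain ⟨σ', α', β', W'⟩ := exists_swp h.1.1 h0.1.1 ms' ms hst.symm
  have g0 := Q.G_split (δ := δ) a2.le (nZ_of_c a7) (nZ_of_c a8) (Or.inr a4)
  have g1 := Q.G_split (δ := δ) b2.le (nZ_of_c b7) (nZ_of_c b8) (Or.inr b4)
  have l0 := Q.G_lower (δ := δ) W (x := s0) (y := s3') ⟨a1.le, is.1.le⟩ ⟨is'.2.le, b3.le⟩
  have l1 := Q.G_lower (δ := δ) W' (x := s3) (y := s0') ⟨b1.le, is'.1.le⟩ ⟨is.2.le, a3.le⟩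
  have w0 := Q.wt_le (δ := δ) C0
  have w1 := Q.wt_le (δ := δ) C3
  have w2 := Q.le_wt (δ := δ) (Q.chord_mid W C0 C3 is is') (by linarith)
  have C4 := Q.chord_mid W' C3 C0 is' is
  have key : ENNReal.ofReal ((v0 - u0) ^ 2) + ENNReal.ofReal ((v3 - u3) ^ 2) +
      ENNReal.ofReal (3 * δ ^ 2) ≤ Q.wt δ σ (α s0, β s3') + Q.wt δ σ' (α' s3, β' s0') := by
    rw [← ENNReal.ofReal_add (by positivity) (by positivity),
      ← ENNReal.ofReal_add (by positivity) (by positivity)]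
    have hpos : 4 * δ ^ 2 ≤ 2 * ((v3 - v0) * (u3 - u0)) := by nlinarith
    by_cases hd : u3 + δ ≤ v0
    · have w3 := Q.le_wt (δ := δ) C4 hd
      refine le_trans ?_ (add_le_add w2 w3)
      rw [← ENNReal.ofReal_add (by positivity) (by positivity)]
      refine ENNReal.ofReal_le_ofReal ?_
      nlinarith [sq_nonneg δ]
    · refine le_trans ?_ (w2.trans le_self_add)
      refine ENNReal.ofReal_le_ofReal ?_
      have : (v0 - u3) ^ 2 ≤ δ ^ 2 := by push Not at hd; nlinarith
      nlinarith [sq_nonneg δ]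
  have zz := Q.z1_swp W' (th := s3) ⟨b1, is'.1.le⟩ (b7 ▸ Q.c_mem _)
  have zz0 := Q.z1_swp W (th := s0) ⟨a1, is.1.le⟩ (a7 ▸ Q.c_mem _)
  refine T.swap_contra h0 h W W' T.e2 ?_
  unfold Nf
  generalize (∑' p : ℝ × ℝ, if p.2 ≤ s0 then Q.wt δ γ0 p else 0) = A0 at *
  generalize (∑' p : ℝ × ℝ, if s0' ≤ p.1 then Q.wt δ γ0 p else 0) = B0 at *
  generalize (∑' p : ℝ × ℝ, if p.2 ≤ s3 then Q.wt δ γ p else 0) = A1 at *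
  generalize (∑' p : ℝ × ℝ, if s3' ≤ p.1 then Q.wt δ γ p else 0) = B1 at *
  calc Q.z1 γ0 + Q.Gf δ γ0 + (Q.z1 γ + Q.Gf δ γ) + ENNReal.ofReal (3 * δ ^ 2)
      ≤ Q.z1 σ + (A0 + B0 + ENNReal.ofReal ((v0 - u0) ^ 2)) +
        (Q.z1 σ' + (A1 + B1 + ENNReal.ofReal ((v3 - u3) ^ 2))) + ENNReal.ofReal (3 * δ ^ 2) := by
        gcongr
        · exact g0.trans (by gcongr)
        · exact g1.trans (by gcongr)
    _ = Q.z1 σ + (A0 + B1) + (Q.z1 σ' + (A1 + B0)) + (ENNReal.ofReal ((v0 - u0) ^ 2) +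
        ENNReal.ofReal ((v3 - u3) ^ 2) + ENNReal.ofReal (3 * δ ^ 2)) := by ring
    _ ≤ Q.z1 σ + (A0 + B1) + (Q.z1 σ' + (A1 + B0)) +
        (Q.wt δ σ (α s0, β s3') + Q.wt δ σ' (α' s3, β' s0')) := by gcongr
    _ = Q.z1 σ + (A0 + B1 + Q.wt δ σ (α s0, β s3')) +
        (Q.z1 σ' + (A1 + B0 + Q.wt δ σ' (α' s3, β' s0'))) := by ring
    _ ≤ Q.z1 σ + Q.Gf δ σ + (Q.z1 σ' + Q.Gf δ σ') := by gcongr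

end Cfg
end PA
end Snk

namespace Snk
section PB
open Filter Topology
namespace Cfg
variable {Q : Cfg} {δ κ ε : ℝ} {ρ : ℂ → ℝ≥0∞}

lemma hit_pos {γ : ℝ → ℂ} (h : γ ∈ Q.F) {t : ℝ} (ht : t ∈ Ioo (0:ℝ) 1) (hB : γ t ∈ Q.B) :
    ∃ u ∈ Ioo 0 Q.l, γ t = Q.c u := by
  obtain ⟨u, hu, e⟩ := h.2.2.2.2.2 t ht hB
  exact ⟨u, hu, e.symm⟩

lemma Win_out {γ : ℝ → ℂ} (h : γ ∈ Q.F) {τ η : ℝ} (hW : γ ∉ Q.Win τ η) {t u : ℝ}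
    (ht : t ∈ Ioo (0:ℝ) 1) (hu : u ∈ Ioo 0 Q.l) (e : γ t = Q.c u) : η < |u - τ| := by
  by_contra hcon
  push Not at hcon
  exact hW ⟨h, t, ht, u, hu, e, hcon⟩

lemma tset_compact {γ : ℝ → ℂ} (hc : ContinuousOn γ (Icc 0 1)) {p r : ℝ} (hp : 0 ≤ p) (hr : r ≤ 1)
    (x y : ℝ) : IsCompact {t | t ∈ Icc p r ∧ γ t ∈ Q.c '' Icc x y} := by
  have hcl : IsClosed (Q.c '' Icc x y) := (isCompact_Icc.image Q.c_cont).isClosed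
  exact isCompact_Icc.of_isClosed_subset
    ((hc.mono (Icc_subset_Icc hp hr)).preimage_isClosed_of_isClosed isClosed_Icc hcl)
    (fun t ht => ht.1)

/-- a position is determined -/
lemma pos_mem {γ : ℝ → ℂ} {t u x y : ℝ} (hu : u ∈ Icc (-Q.a) (Q.l + Q.b)) (e : γ t = Q.c u)
    (hx : -Q.a ≤ x) (hy : y ≤ Q.l + Q.b) : γ t ∈ Q.c '' Icc x y ↔ u ∈ Icc x y := by
  constructor
  · rintro ⟨w, hw, e'⟩
    have := Q.c_inj hu ⟨hx.trans hw.1, hw.2.trans hy⟩ (e.symm.trans e'.symm)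
    rw [this]; exact hw
  · intro h; exact ⟨u, h, e.symm⟩

lemma Tight.land_left (T : Q.Tight δ κ ε ρ) {γ0 γ : ℝ → ℂ} (h0 : γ0 ∈ Q.Tt δ κ ε ρ)
    (h : γ ∈ Q.Tt δ κ ε ρ) {t0 τ x1 : ℝ} (hF : Q.FH γ0 t0 τ) (hx0 : 0 < x1) (hx1 : x1 < τ)
    (hfirst : ∀ t1 τ1, Q.FH γ t1 τ1 → τ1 < τ + δ) (hwt : γ ∉ Q.Win τ (2 * δ))
    (hwx : γ ∉ Q.Win x1 (2 * δ))
    (hchord : ∀ s s' u v, Q.Chord γ s s' u v → u < x1 → x1 < v → False)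
    (hhit : ∃ t ∈ Ioo (0:ℝ) 1, ∃ u ∈ Ioo 0 Q.l, γ t = Q.c u ∧ x1 ≤ u) :
    ∃ s1 ∈ Ioo (0:ℝ) 1, ∃ v ∈ Icc x1 (τ - 2 * δ), γ s1 = Q.c v ∧
      (fun t => γ (0 + (s1 - 0) * t)) ∈ Q.Fm (-Q.a) 0 x1 (τ - 2 * δ) := by
  have ha := Q.ha; have hb := Q.hb; have hl := Q.hl; have hδ := T.hδ
  have hτl := hF.2.2.2.1
  have hγ := h.1
  have hc := hγ.1.1
  obtain ⟨i0, hi0, ei0⟩ := F_end0 hγ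
  obtain ⟨th, hth, uh, huh, eh, hxu⟩ := hhit
  have memI : i0 ∈ Icc (-Q.a) (Q.l + Q.b) := ⟨hi0.1, by linarith [hi0.2, Q.hl]⟩
  obtain ⟨s1, ⟨hs1, hm1⟩, hmin⟩ := (tset_compact (Q := Q) hc le_rfl le_rfl x1 Q.l).exists_isLeast
    ⟨th, ⟨hth.1.le, hth.2.le⟩, uh, ⟨hxu, huh.2.le⟩, eh.symm⟩
  have s1lt : s1 < 1 := (hmin ⟨⟨hth.1.le, hth.2.le⟩, uh, ⟨hxu, huh.2.le⟩, eh.symm⟩).trans_lt hth.2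
  have s1pos : 0 < s1 := by
    rcases eq_or_lt_of_le hs1.1 with e | e
    · exfalso
      rw [← e] at hm1
      have := (pos_mem memI ei0 (by linarith) (by linarith)).1 hm1
      linarith [this.1, hi0.2]
    · exact e
  obtain ⟨v, hv, ev⟩ := hm1
  have ev := ev.symm
  have hv0 : v ∈ Ioo 0 Q.l := by
    obtain ⟨v', hv', e'⟩ := hit_pos hγ ⟨s1pos, s1lt⟩ (ev ▸ Q.c_mem v)
    have := Q.c_inj ⟨by linarith [hv.1], by linarith [hv.2]⟩ (Q.Ioo_sub hv') (ev.symm.trans e')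
    rw [this]; exact hv'
  have w1 := Win_out hγ hwx ⟨s1pos, s1lt⟩ hv0 ev
  have w2 := Win_out hγ hwt ⟨s1pos, s1lt⟩ hv0 ev
  have hvx : x1 < v := by
    rw [abs_of_nonneg (by linarith [hv.1])] at w1; linarith
  -- hits before s1 are left of x1
  have hbefore : ∀ t ∈ Ioo 0 s1, ∀ w ∈ Ioo 0 Q.l, γ t = Q.c w → w < x1 := by
    intro t ht w hw e
    by_contra hcon
    push Not at hcon
    have := hmin ⟨⟨ht.1.le, ht.2.le.trans s1lt.le⟩, w, ⟨hcon, hw.2.le⟩, e.symm⟩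
    linarith [ht.2]
  obtain ⟨s0, ⟨hs0, hm0⟩, hmax⟩ := (tset_compact (Q := Q) hc le_rfl s1lt.le (-Q.a) x1).exists_isGreatest
    ⟨0, ⟨le_rfl, s1pos.le⟩, i0, ⟨hi0.1, by linarith [hi0.2]⟩, ei0.symm⟩
  have s01 : s0 < s1 := by
    refine lt_of_le_of_ne hs0.2 fun e => ?_
    rw [e] at hm0
    have := (pos_mem (Q.Ioo_sub hv0) ev le_rfl (by linarith [hτl.2])).1 hm0
    linarith [this.2]
  have nB : ∀ t ∈ Ioo s0 s1, γ t ∉ Q.B := by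
    intro t ht hB
    obtain ⟨w, hw, e⟩ := hit_pos hγ ⟨hs0.1.trans_lt ht.1, ht.2.trans s1lt⟩ hB
    have := hbefore t ⟨hs0.1.trans_lt ht.1, ht.2⟩ w hw e
    have := hmax ⟨⟨hs0.1.trans ht.1.le, ht.2.le⟩, w, ⟨by linarith [hw.1], this.le⟩, e.symm⟩
    linarith [ht.1]
  have key : v < τ + δ ∧ ∀ t ∈ Ioo s0 s1, γ t ∉ Q.Z := by
    rcases eq_or_lt_of_le hs0.1 with e | e
    · rw [← e] at nB ⊢
      exact ⟨hfirst s1 v ⟨s1pos, s1lt, ev, hv0, nB⟩, before_FH hγ s1lt.le nB⟩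
    · have i0 : s0 ∈ Ioo (0:ℝ) 1 := ⟨e, s01.trans s1lt⟩
      have hB0 : γ s0 ∈ Q.B := by
        obtain ⟨w, -, e⟩ := hm0; rw [← e]; exact Q.c_mem _
      obtain ⟨u, hu, eu⟩ := hit_pos hγ i0 hB0
      have hux := hbefore s0 ⟨e, s01⟩ u hu eu
      have nZ : ∀ t ∈ Ioo s0 s1, γ t ∉ Q.Z := by
        intro t ht hz
        have hall := conn (hc.mono (Ioo_subset_Icc_self.trans (Icc_subset_Icc hs0.1 s1lt.le))) nB ht hz
        exact hchord s0 s1 u v ⟨e, s01, s1lt, hall, hu, hv0, eu, ev⟩ hux hvx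
      refine ⟨?_, nZ⟩
      by_contra hcon
      push Not at hcon
      exact T.T1 h0 h hF e s01 s1lt.le eu hu.1 (by linarith) nB nZ
        (Or.inr ⟨s1lt, v, hv0, ev, hcon⟩)
  have hvt : v < τ - 2 * δ := by
    have := key.1
    rcases lt_abs.1 w2 with h' | h' <;> linarith
  refine ⟨s1, ⟨s1pos, s1lt⟩, v, ⟨hvx.le, hvt.le⟩, ev, ?_⟩
  have hsc := (sub_curve hγ.1 le_rfl s1pos s1lt.le).1
  refine ⟨hsc, ?_, ?_, ?_, ?_, ?_⟩
  · simp only [sub_zero, mul_zero, add_zero]; exact hγ.2.1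
  · simp only [sub_zero, mul_one, zero_add]; rw [ev]; exact ⟨v, ⟨hvx.le, hvt.le⟩, rfl⟩
  · obtain ⟨η, hη, hn⟩ := hγ.2.2.2.1
    refine ⟨min η 1, lt_min hη one_pos, fun t ht => ?_⟩
    have h1 := ht.2.trans_le (min_le_left _ _)
    refine hn _ ⟨by simp only [sub_zero, zero_add]; exact mul_pos s1pos ht.1, ?_⟩
    simp only [sub_zero, zero_add]
    nlinarith [ht.1]
  · refine ⟨(s1 - s0) / s1, div_pos (by linarith) s1pos, fun t ht => key.2 _ ?_⟩
    have e1 : 1 - (s1 - s0) / s1 = s0 / s1 := by field_simp; ring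
    have h1 := ht.1
    rw [e1, div_lt_iff₀ s1pos] at h1
    constructor
    · linarith
    · nlinarith [ht.2]
  · intro t ht hB
    have hm : 0 + (s1 - 0) * t ∈ Ioo 0 s1 := ⟨by nlinarith [ht.1], by nlinarith [ht.2]⟩
    obtain ⟨w, hw, e⟩ := hit_pos hγ ⟨hm.1, hm.2.trans s1lt⟩ hB
    exact ⟨w, ⟨hw.1, hbefore _ hm w hw e⟩, e.symm⟩

lemma Tight.land_right (T : Q.Tight δ κ ε ρ) {γ0 γ : ℝ → ℂ} (h0 : γ0 ∈ Q.Tt δ κ ε ρ)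
    (h : γ ∈ Q.Tt δ κ ε ρ) {t0 τ y : ℝ} (hF : Q.FH γ0 t0 τ) (hy0 : τ + δ ≤ y) (hyl : y < Q.l)
    (hwt : γ ∉ Q.Win τ (2 * δ)) (hwx : γ ∉ Q.Win y (2 * δ))
    (hchord : ∀ s s' u v, Q.Chord γ s s' u v → u < y → y < v → False)
    (hhit : ∃ t ∈ Ioo (0:ℝ) 1, ∃ u ∈ Ioo 0 Q.l, γ t = Q.c u ∧ u ≤ y) :
    ∃ s2 ∈ Ioo (0:ℝ) 1, (∀ t ∈ Ioo (0:ℝ) 1, ∀ u ∈ Icc 0 y, γ t = Q.c u → t ≤ s2) ∧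
      (fun t => γ (s2 + (1 - s2) * t)) ∈ Q.Fm (τ + 2 * δ) y Q.l (Q.l + Q.b) := by
  have ha := Q.ha; have hb := Q.hb; have hl := Q.hl; have hδ := T.hδ
  have hτl := hF.2.2.2.1
  have hγ := h.1
  have hc := hγ.1.1
  obtain ⟨k0, hk0, ek0⟩ := F_end1 hγ
  obtain ⟨th, hth, uh, huh, eh, hxu⟩ := hhit
  have memK : k0 ∈ Icc (-Q.a) (Q.l + Q.b) := ⟨by linarith [hk0.1], hk0.2⟩
  have y0 : 0 < y := by linarith [hτl.1]
  obtain ⟨s2, ⟨hs2, hm2⟩, hmax⟩ := (tset_compact (Q := Q) hc le_rfl le_rfl 0 y).exists_isGreatest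
    ⟨th, ⟨hth.1.le, hth.2.le⟩, uh, ⟨huh.1.le, hxu⟩, eh.symm⟩
  have s2pos : 0 < s2 := hth.1.trans_le
    (hmax ⟨⟨hth.1.le, hth.2.le⟩, uh, ⟨huh.1.le, hxu⟩, eh.symm⟩)
  have s2lt : s2 < 1 := by
    refine lt_of_le_of_ne hs2.2 fun e => ?_
    rw [e] at hm2
    have := (pos_mem memK ek0 (by linarith) (by linarith)).1 hm2
    linarith [this.2, hk0.1]
  obtain ⟨u2, hu2', eu2⟩ := hm2
  have eu2 := eu2.symm
  have hu2 : u2 ∈ Ioo 0 Q.l := by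
    obtain ⟨v', hv', e'⟩ := hit_pos hγ ⟨s2pos, s2lt⟩ (eu2 ▸ Q.c_mem u2)
    have := Q.c_inj ⟨by linarith [hu2'.1], by linarith [hu2'.2]⟩ (Q.Ioo_sub hv') (eu2.symm.trans e')
    rw [this]; exact hv'
  have w1 := Win_out hγ hwx ⟨s2pos, s2lt⟩ hu2 eu2
  have w2 := Win_out hγ hwt ⟨s2pos, s2lt⟩ hu2 eu2
  have hu2y : u2 < y := by
    rw [abs_of_nonpos (by linarith [hu2'.2])] at w1; linarith
  have hafter : ∀ t ∈ Ioo s2 1, ∀ w ∈ Ioo 0 Q.l, γ t = Q.c w → y < w := by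
    intro t ht w hw e
    by_contra hcon
    push Not at hcon
    have := hmax ⟨⟨s2pos.le.trans ht.1.le, ht.2.le⟩, w, ⟨hw.1.le, hcon⟩, e.symm⟩
    linarith [ht.1]
  obtain ⟨s3, ⟨hs3, hm3⟩, hmin⟩ :=
    (tset_compact (Q := Q) hc s2pos.le le_rfl y (Q.l + Q.b)).exists_isLeast
    ⟨1, ⟨s2lt.le, le_rfl⟩, k0, ⟨by linarith [hk0.1], hk0.2⟩, ek0.symm⟩
  have s23 : s2 < s3 := by
    refine lt_of_le_of_ne hs3.1 fun e => ?_
    rw [← e] at hm3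
    have := (pos_mem (Q.Ioo_sub hu2) eu2 (by linarith) le_rfl).1 hm3
    linarith [this.1]
  have nB : ∀ t ∈ Ioo s2 s3, γ t ∉ Q.B := by
    intro t ht hB
    obtain ⟨w, hw, e⟩ := hit_pos hγ ⟨s2pos.trans ht.1, ht.2.trans_le hs3.2⟩ hB
    have := hafter t ⟨ht.1, ht.2.trans_le hs3.2⟩ w hw e
    have := hmin ⟨⟨ht.1.le, ht.2.le.trans hs3.2⟩, w, ⟨this.le, by linarith [hw.2]⟩, e.symm⟩
    linarith [ht.2]
  have hend : s3 < 1 → ∃ w ∈ Ioo 0 Q.l, γ s3 = Q.c w ∧ y < w := by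
    intro h3
    have hB3 : γ s3 ∈ Q.B := by
      obtain ⟨w, -, e⟩ := hm3; rw [← e]; exact Q.c_mem _
    obtain ⟨w, hw, e⟩ := hit_pos hγ ⟨s2pos.trans s23, h3⟩ hB3
    exact ⟨w, hw, e, hafter s3 ⟨s23, h3⟩ w hw e⟩
  have nZ : ∀ t ∈ Ioo s2 s3, γ t ∉ Q.Z := by
    intro t ht hz
    have hall := conn (hc.mono (Ioo_subset_Icc_self.trans (Icc_subset_Icc s2pos.le hs3.2))) nB ht hz
    rcases eq_or_lt_of_le hs3.2 with e | e
    · obtain ⟨η, hη, hn⟩ := hγ.2.2.2.2.1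
      have hm : 0 < min η (1 - s2) := lt_min hη (by linarith)
      have e1 := min_le_left η (1 - s2)
      have e2 := min_le_right η (1 - s2)
      exact hn (1 - min η (1 - s2) / 2) ⟨by linarith, by linarith⟩
        (hall _ ⟨by linarith, by linarith⟩)
    · obtain ⟨w, hw, ew, hyw⟩ := hend e
      exact hchord s2 s3 u2 w ⟨s2pos, s23, e, hall, hu2, hw, eu2, ew⟩ hu2y hyw
  have hτu : τ + 2 * δ < u2 := by
    have : τ ≤ u2 := by
      by_contra hcon
      push Not at hcon
      refine T.T1 h0 h hF s2pos s23 hs3.2 eu2 hu2.1 hcon nB nZ ?_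
      rcases eq_or_lt_of_le hs3.2 with e | e
      · exact Or.inl e
      · obtain ⟨w, hw, ew, hyw⟩ := hend e
        exact Or.inr ⟨e, w, hw, ew, by linarith⟩
    rw [abs_of_nonneg (by linarith)] at w2
    linarith
  refine ⟨s2, ⟨s2pos, s2lt⟩, fun t ht u hu e => hmax ⟨⟨ht.1.le, ht.2.le⟩, u, hu, e.symm⟩, ?_⟩
  have hsc := (sub_curve hγ.1 s2pos.le s2lt le_rfl).1
  have d0 : 0 < 1 - s2 := by linarith
  refine ⟨hsc, ?_, ?_, ?_, ?_, ?_⟩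
  · simp only [mul_zero, add_zero]; rw [eu2]; exact ⟨u2, ⟨hτu.le, hu2y.le⟩, rfl⟩
  · have e : s2 + (1 - s2) * 1 = 1 := by ring
    simp only [e]; exact hγ.2.2.1
  · refine ⟨(s3 - s2) / (1 - s2), div_pos (by linarith) d0, fun t ht => nZ _ ?_⟩
    have h1 := ht.2
    rw [lt_div_iff₀ d0] at h1
    exact ⟨by nlinarith [ht.1], by linarith⟩
  · obtain ⟨η, hη, hn⟩ := hγ.2.2.2.2.1
    refine ⟨min η 1, lt_min hη one_pos, fun t ht => hn _ ?_⟩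
    have h1 := ht.1
    have h2 := min_le_left η 1
    exact ⟨by nlinarith [ht.2], by nlinarith [ht.2]⟩
  · intro t ht hB
    have hm : s2 + (1 - s2) * t ∈ Ioo s2 1 := ⟨by nlinarith [ht.1], by nlinarith [ht.2]⟩
    obtain ⟨w, hw, e⟩ := hit_pos hγ ⟨s2pos.trans hm.1, hm.2⟩ hB
    exact ⟨w, ⟨hafter _ hm w hw e, hw.2⟩, e.symm⟩

end Cfg
end PB
end Snk

namespace Snk
section PC
open Filter Topology
namespace Cfg
variable {Q : Cfg} {δ κ ε : ℝ} {ρ : ℂ → ℝ≥0∞}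

lemma Tight.choose_left (T : Q.Tight δ κ ε ρ) {P : Set (ℝ → ℂ)} (hP : P ⊆ Q.Tt δ κ ε ρ) {q d : ℝ}
    (hd : 0 ≤ d) : ∃ x1 ∈ Icc q (q + d + δ), ∀ γ ∈ P, γ ∉ Q.Win q (2 * δ) → γ ∉ Q.Jump q d →
      γ ∉ Q.Win x1 (2 * δ) → ∀ s s' u v, Q.Chord γ s s' u v → u < x1 → x1 < v → False := by
  have hδ := T.hδ
  set S : Set ℝ := {v | ∃ γ ∈ P, γ ∉ Q.Win q (2 * δ) ∧ γ ∉ Q.Jump q d ∧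
    ∃ s s' u, Q.Chord γ s s' u v ∧ u < q ∧ q < v} with hS
  rcases S.eq_empty_or_nonempty with hE | hne
  · refine ⟨q, ⟨le_rfl, by linarith⟩, fun γ hγ n1 n2 n3 s s' u v hc h1 h2 => ?_⟩
    have : v ∈ S := ⟨γ, hγ, n1, n2, s, s', u, hc, h1, h2⟩
    rw [hE] at this; exact this
  · have hub : ∀ v ∈ S, v ≤ q + d := by
      rintro v ⟨γ, hγ, n1, n2, s, s', u, hc, h1, h2⟩
      by_contra hcon
      push Not at hcon
      exact n2 ⟨(hP hγ).1, s, s', u, v, hc, h1.le, hcon.le⟩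
    have hbdd : BddAbove S := ⟨q + d, hub⟩
    obtain ⟨v0, hv0, hsup⟩ := exists_lt_of_lt_csSup hne (sub_lt_self (sSup S) hδ)
    have hub0 := hub v0 hv0
    obtain ⟨γ0, hγ0, m1, m2, s0, s0', u0, hc0, k1, k2⟩ := hv0
    refine ⟨v0 + δ, ⟨by linarith, by linarith⟩, fun γ hγ n1 n2 n3 s s' u v hc h1 h2 => ?_⟩
    obtain ⟨a1, a2, a3, a4, a5, a6, a7, a8⟩ := id hc
    have t1 : s ∈ Ioo (0:ℝ) 1 := ⟨a1, a2.trans a3⟩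
    have t2 : s' ∈ Ioo (0:ℝ) 1 := ⟨a1.trans a2, a3⟩
    have w1 := Win_out (hP hγ).1 n3 t2 a6 a8
    have w2 := Win_out (hP hγ).1 n3 t1 a5 a7
    have w3 := Win_out (hP hγ).1 n1 t1 a5 a7
    rw [abs_of_nonneg (by linarith)] at w1
    rw [abs_of_nonpos (by linarith)] at w2
    by_cases huq : u < q
    · have : v ∈ S := ⟨γ, hγ, n1, n2, s, s', u, hc, huq, by linarith⟩
      have := le_csSup hbdd this
      linarith
    · push Not at huq
      rw [abs_of_nonneg (by linarith)] at w3
      exact T.T2 (hP hγ0) (hP hγ) hc0 hc (by linarith) (by linarith) (by linarith)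

lemma Tight.choose_right (T : Q.Tight δ κ ε ρ) {P : Set (ℝ → ℂ)} (hP : P ⊆ Q.Tt δ κ ε ρ) {q d : ℝ}
    (hd : 0 ≤ d) : ∃ y ∈ Icc (q - d - δ) q, ∀ γ ∈ P, γ ∉ Q.Win q (2 * δ) →
      γ ∉ Q.Jump (q - d) d →
      γ ∉ Q.Win y (2 * δ) → ∀ s s' u v, Q.Chord γ s s' u v → u < y → y < v → False := by
  have hδ := T.hδ
  set S : Set ℝ := {u | ∃ γ ∈ P, γ ∉ Q.Win q (2 * δ) ∧ γ ∉ Q.Jump (q - d) d ∧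
    ∃ s s' v, Q.Chord γ s s' u v ∧ u < q ∧ q < v} with hS
  rcases S.eq_empty_or_nonempty with hE | hne
  · refine ⟨q, ⟨by linarith, le_rfl⟩, fun γ hγ n1 n2 n3 s s' u v hc h1 h2 => ?_⟩
    have : u ∈ S := ⟨γ, hγ, n1, n2, s, s', v, hc, h1, h2⟩
    rw [hE] at this; exact this
  · have hub : ∀ u ∈ S, q - d ≤ u := by
      rintro u ⟨γ, hγ, n1, n2, s, s', v, hc, h1, h2⟩
      by_contra hcon
      push Not at hcon
      exact n2 ⟨(hP hγ).1, s, s', u, v, hc, hcon.le, by linarith⟩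
    have hbdd : BddBelow S := ⟨q - d, hub⟩
    obtain ⟨u0, hu0, hsup⟩ := exists_lt_of_csInf_lt hne (lt_add_of_pos_right (sInf S) hδ)
    have hub0 := hub u0 hu0
    obtain ⟨γ0, hγ0, m1, m2, s0, s0', v0, hc0, k1, k2⟩ := hu0
    refine ⟨u0 - δ, ⟨by linarith, by linarith⟩, fun γ hγ n1 n2 n3 s s' u v hc h1 h2 => ?_⟩
    obtain ⟨a1, a2, a3, a4, a5, a6, a7, a8⟩ := id hc
    have t1 : s ∈ Ioo (0:ℝ) 1 := ⟨a1, a2.trans a3⟩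
    have t2 : s' ∈ Ioo (0:ℝ) 1 := ⟨a1.trans a2, a3⟩
    have w1 := Win_out (hP hγ).1 n3 t2 a6 a8
    have w2 := Win_out (hP hγ).1 n3 t1 a5 a7
    have w3 := Win_out (hP hγ).1 n1 t2 a6 a8
    rw [abs_of_nonneg (by linarith)] at w1
    rw [abs_of_nonpos (by linarith)] at w2
    by_cases hvq : q < v
    · have : u ∈ S := ⟨γ, hγ, n1, n2, s, s', v, hc, by linarith, hvq⟩
      have := csInf_le hbdd this
      linarith
    · push Not at hvq
      rw [abs_of_nonpos (by linarith)] at w3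
      exact T.T2 (hP hγ) (hP hγ0) hc hc0 (by linarith) (by linarith) (by linarith)

lemma not_NoHit {γ : ℝ → ℂ} (h : γ ∈ Q.F) {t : ℝ} (ht : t ∈ Icc (0:ℝ) 1) (hz : γ t ∈ Q.Z) :
    ¬ Q.NoHit γ := by
  intro hn
  obtain ⟨i0, -, e0⟩ := F_end0 h
  obtain ⟨k0, -, e1⟩ := F_end1 h
  have t0 : 0 < t := lt_of_le_of_ne ht.1 fun e => nZ_of_c e0 (e ▸ hz)
  have t1 : t < 1 := lt_of_le_of_ne ht.2 fun e => nZ_of_c e1 (e ▸ hz)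
  exact before_FH h le_rfl hn t ⟨t0, t1⟩ hz

section hits
variable {γ : ℝ → ℂ} {δ1 : ℝ}

lemma hit_range (h : γ ∈ Q.F) (n0 : γ ∉ Q.Win 0 δ1) (nl : γ ∉ Q.Win Q.l δ1) {t u : ℝ}
    (ht : t ∈ Ioo (0:ℝ) 1) (hu : u ∈ Ioo 0 Q.l) (e : γ t = Q.c u) : u ∈ Ioo δ1 (Q.l - δ1) := by
  have w1 := Win_out h n0 ht hu e
  have w2 := Win_out h nl ht hu e
  rw [sub_zero, abs_of_pos hu.1] at w1
  rw [abs_of_neg (by linarith [hu.2])] at w2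
  exact ⟨w1, by linarith⟩

lemma exists_FH (h : γ ∈ Q.F) (hδ1 : 0 < δ1) (n0 : γ ∉ Q.Win 0 δ1) (nl : γ ∉ Q.Win Q.l δ1)
    (hn : ¬ Q.NoHit γ) : ∃ t0 τ0, Q.FH γ t0 τ0 := by
  unfold NoHit at hn
  push Not at hn
  obtain ⟨t, ht, hB⟩ := hn
  obtain ⟨u, hu, e⟩ := hit_pos h ht hB
  have hr := hit_range h n0 nl ht hu e
  have ha := Q.ha; have hb := Q.hb
  obtain ⟨t0, ⟨ht0, hm⟩, hmin⟩ := (tset_compact (Q := Q) h.1.1 le_rfl le_rfl δ1 (Q.l - δ1)).exists_isLeast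
    ⟨t, ⟨ht.1.le, ht.2.le⟩, u, ⟨hr.1.le, hr.2.le⟩, e.symm⟩
  have hle := hmin ⟨⟨ht.1.le, ht.2.le⟩, u, ⟨hr.1.le, hr.2.le⟩, e.symm⟩
  have t0pos : 0 < t0 := by
    refine lt_of_le_of_ne ht0.1 fun e0 => ?_
    obtain ⟨i0, hi0, ei0⟩ := F_end0 h
    rw [← e0] at hm
    have := (pos_mem ⟨hi0.1, by linarith [hi0.2, Q.hl]⟩ ei0 (by linarith) (by linarith)).1 hm
    linarith [this.1, hi0.2]
  have t0lt : t0 < 1 := hle.trans_lt ht.2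
  have hB0 : γ t0 ∈ Q.B := by
    obtain ⟨w, -, e⟩ := hm; rw [← e]; exact Q.c_mem _
  obtain ⟨τ0, hτ0, eτ⟩ := hit_pos h ⟨t0pos, t0lt⟩ hB0
  refine ⟨t0, τ0, t0pos, t0lt, eτ, hτ0, fun r hr' hB' => ?_⟩
  have hri : r ∈ Ioo (0:ℝ) 1 := ⟨hr'.1, hr'.2.trans t0lt⟩
  obtain ⟨w, hw, ew⟩ := hit_pos h hri hB'
  have hwr := hit_range h n0 nl hri hw ew
  have := hmin ⟨⟨hri.1.le, hri.2.le⟩, w, ⟨hwr.1.le, hwr.2.le⟩, ew.symm⟩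
  linarith [hr'.2]

lemma exists_LH (h : γ ∈ Q.F) (hδ1 : 0 < δ1) (n0 : γ ∉ Q.Win 0 δ1) (nl : γ ∉ Q.Win Q.l δ1)
    (hn : ¬ Q.NoHit γ) : ∃ t0 ∈ Ioo (0:ℝ) 1, ∃ u ∈ Ioo 0 Q.l, γ t0 = Q.c u ∧
      (∀ t ∈ Ioo t0 1, γ t ∉ Q.B) ∧ ∀ t ∈ Ioo t0 1, γ t ∉ Q.Z := by
  unfold NoHit at hn
  push Not at hn
  obtain ⟨t, ht, hB⟩ := hn
  obtain ⟨u, hu, e⟩ := hit_pos h ht hB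
  have hr := hit_range h n0 nl ht hu e
  have ha := Q.ha; have hb := Q.hb
  obtain ⟨t0, ⟨ht0, hm⟩, hmax⟩ :=
    (tset_compact (Q := Q) h.1.1 le_rfl le_rfl δ1 (Q.l - δ1)).exists_isGreatest
    ⟨t, ⟨ht.1.le, ht.2.le⟩, u, ⟨hr.1.le, hr.2.le⟩, e.symm⟩
  have hle := hmax ⟨⟨ht.1.le, ht.2.le⟩, u, ⟨hr.1.le, hr.2.le⟩, e.symm⟩
  have t0pos : 0 < t0 := ht.1.trans_le hle
  have t0lt : t0 < 1 := by
    refine lt_of_le_of_ne ht0.2 fun e0 => ?_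
    obtain ⟨i0, hi0, ei0⟩ := F_end1 h
    rw [e0] at hm
    have := (pos_mem ⟨by linarith [hi0.1, Q.hl], hi0.2⟩ ei0 (by linarith) (by linarith)).1 hm
    linarith [this.2, hi0.1]
  have hB0 : γ t0 ∈ Q.B := by
    obtain ⟨w, -, e⟩ := hm; rw [← e]; exact Q.c_mem _
  obtain ⟨τ0, hτ0, eτ⟩ := hit_pos h ⟨t0pos, t0lt⟩ hB0
  have nB : ∀ t ∈ Ioo t0 1, γ t ∉ Q.B := by
    intro r hr' hB'
    have hri : r ∈ Ioo (0:ℝ) 1 := ⟨t0pos.trans hr'.1, hr'.2⟩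
    obtain ⟨w, hw, ew⟩ := hit_pos h hri hB'
    have hwr := hit_range h n0 nl hri hw ew
    have := hmax ⟨⟨hri.1.le, hri.2.le⟩, w, ⟨hwr.1.le, hwr.2.le⟩, ew.symm⟩
    linarith [hr'.1]
  refine ⟨t0, ⟨t0pos, t0lt⟩, τ0, hτ0, eτ, nB, fun r hr' hz => ?_⟩
  have hall := conn (h.1.1.mono (Ioo_subset_Icc_self.trans (Icc_subset_Icc t0pos.le le_rfl))) nB hr' hz
  obtain ⟨η, hη, hn⟩ := h.2.2.2.2.1
  have hm : 0 < min η (1 - t0) := lt_min hη (by linarith)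
  have e1 := min_le_left η (1 - t0)
  have e2 := min_le_right η (1 - t0)
  exact hn (1 - min η (1 - t0) / 2) ⟨by linarith, by linarith⟩
    (hall _ ⟨by linarith, by linarith⟩)

end hits

end Cfg
end PC
end Snk

namespace Snk
section PD
open Filter Topology
namespace Cfg
variable (Q : Cfg)

def Fp : Set (ℝ → ℂ) := {γ ∈ Q.F | ∀ t ∈ Icc (0:ℝ) 1, γ t ∉ Q.Z}

lemma Win_mono {τ η η' : ℝ} (h : η ≤ η') : Q.Win τ η ⊆ Q.Win τ η' := by
  rintro γ ⟨hγ, t, ht, u, hu, e, hd⟩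
  exact ⟨hγ, t, ht, u, hu, e, hd.trans h⟩

lemma exists_tight {δ : ℝ} (hδ : 0 < δ) (hδ1 : δ ≤ 1) : ∃ κ ε ρ, Q.Tight δ κ ε ρ ∧
    extremalWidth Q.F ≤ extremalWidth (Q.Tt δ κ ε ρ) + 1 := by
  obtain ⟨ρc, m, hf, hN⟩ := Q.exists_rhoc hδ
  obtain ⟨κ, hκ, hall⟩ := tight (Q.Nf δ) m hN hf Q.F_finite
  have he0 : 0 < κ * δ ^ 2 / 2 := by positivity
  obtain ⟨ρ, hm, hlow, hw⟩ := hall (κ * δ ^ 2 / 2) he0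
  refine ⟨κ, κ * δ ^ 2 / 2, ρ, ⟨hδ, hδ1, hκ, he0.le, ?_, ?_, hlow⟩, hw⟩
  · have : δ ^ 2 ≤ δ := by nlinarith
    nlinarith
  · nlinarith [sq_nonneg δ, mul_pos hκ (pow_pos hδ 2)]

theorem main {lam : ℝ} (hlam : 2 < lam) {n : ℕ} (hn : 16 * lam < 2 ^ n) :
    extremalWidth Q.F ≤ extremalWidth Q.Fp + 3 ∨
    ∃ x₁ j x₂ i : ℝ,
      0 ≤ x₁ ∧ 0 < j ∧ x₁ + j < x₂ ∧ 0 < i ∧ x₂ + i ≤ Q.l ∧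
      j < x₁ / lam ∧ i < (Q.l - (x₂ + i)) / lam ∧
      extremalWidth Q.F ≤ extremalWidth Q.Fp + (8 + 2 * (n * ENNReal.ofReal (9 * Real.pi ^ 3))) +
        hsum (extremalWidth (Q.Fm (-Q.a) 0 x₁ (x₁ + j)))
          (extremalWidth (Q.Fm x₂ (x₂ + i) Q.l (Q.l + Q.b))) := by
  obtain ⟨δ1, hδ1, hδ1', hwin⟩ : ∃ δ1 > 0, δ1 ≤ 1 ∧
      ∀ τ ∈ Icc 0 Q.l, extremalWidth (Q.Win τ δ1) ≤ 1 := by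
    obtain ⟨δ', h0, h⟩ := Q.windows
    exact ⟨min δ' 1, lt_min h0 one_pos, min_le_right _ _, fun τ hτ =>
      (width_mono (Q.Win_mono (min_le_left _ _))).trans (h τ hτ)⟩
  have hl := Q.hl
  have hlam0 : 0 < lam := by linarith
  set δ : ℝ := δ1 / (1000 * lam) with hδdef
  have hδ : 0 < δ := by positivity
  have hδe : 1000 * lam * δ = δ1 := by rw [hδdef]; field_simp
  have hδs : 2 * δ ≤ δ1 := by nlinarith
  have hwin2 : ∀ τ ∈ Icc 0 Q.l, extremalWidth (Q.Win τ (2 * δ)) ≤ 1 := fun τ hτ =>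
    (width_mono (Q.Win_mono hδs)).trans (hwin τ hτ)
  obtain ⟨κ, ε, ρ, T, hT⟩ := Q.exists_tight hδ (by linarith)
  set P : Set (ℝ → ℂ) := {γ ∈ Q.Tt δ κ ε ρ | γ ∉ Q.Win 0 δ1 ∧ γ ∉ Q.Win Q.l δ1 ∧ ¬ Q.NoHit γ}
    with hPdef
  have hPT : P ⊆ Q.Tt δ κ ε ρ := fun γ h => h.1
  have hsplit : extremalWidth Q.F ≤ extremalWidth Q.Fp + 3 + extremalWidth P := by
    have hsub : Q.Tt δ κ ε ρ ⊆ Q.Fp ∪ (Q.Win 0 δ1 ∪ (Q.Win Q.l δ1 ∪ P)) := by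
      intro γ hγ
      by_cases h1 : γ ∈ Q.Fp
      · exact Or.inl h1
      by_cases h2 : γ ∈ Q.Win 0 δ1
      · exact Or.inr (Or.inl h2)
      by_cases h3 : γ ∈ Q.Win Q.l δ1
      · exact Or.inr (Or.inr (Or.inl h3))
      refine Or.inr (Or.inr (Or.inr ⟨hγ, h2, h3, ?_⟩))
      have : ∃ t ∈ Icc (0:ℝ) 1, γ t ∈ Q.Z := by
        by_contra hcon
        push Not at hcon
        exact h1 ⟨hγ.1, hcon⟩
      obtain ⟨t, ht, hz⟩ := this
      exact not_NoHit hγ.1 ht hz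
    have w0 := hwin 0 ⟨le_rfl, hl.le⟩
    have wl := hwin Q.l ⟨hl.le, le_rfl⟩
    calc extremalWidth Q.F ≤ extremalWidth (Q.Tt δ κ ε ρ) + 1 := hT
      _ ≤ extremalWidth (Q.Fp ∪ (Q.Win 0 δ1 ∪ (Q.Win Q.l δ1 ∪ P))) + 1 := by
          gcongr; exact width_mono hsub
      _ ≤ (extremalWidth Q.Fp + (extremalWidth (Q.Win 0 δ1) + (extremalWidth (Q.Win Q.l δ1) +
          extremalWidth P))) + 1 := by
          gcongr
          refine (width_union _ _).trans (add_le_add le_rfl ?_)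
          refine (width_union _ _).trans (add_le_add le_rfl ?_)
          exact width_union _ _
      _ ≤ (extremalWidth Q.Fp + (1 + (1 + extremalWidth P))) + 1 := by gcongr
      _ = _ := by ring
  rcases P.eq_empty_or_nonempty with hE | ⟨γe, hγe⟩
  · left
    rw [hE, width_empty, add_zero] at hsplit
    exact hsplit
  right
  -- choice of τ
  set S : Set ℝ := {τ | ∃ γ ∈ P, ∃ t, Q.FH γ t τ} with hS
  have hSne : S.Nonempty := by
    obtain ⟨t, τ, h⟩ := exists_FH hγe.1.1 hδ1 hγe.2.1 hγe.2.2.1 hγe.2.2.2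
    exact ⟨τ, γe, hγe, t, h⟩
  have hSb : BddAbove S := ⟨Q.l, by rintro τ ⟨γ, -, t, h⟩; exact h.2.2.2.1.2.le⟩
  obtain ⟨τ, hτS, hτsup⟩ := exists_lt_of_lt_csSup hSne (sub_lt_self (sSup S) hδ)
  obtain ⟨γ0, hγ0, t0, hF⟩ := hτS
  have hfirst : ∀ γ ∈ P, ∀ t1 τ1, Q.FH γ t1 τ1 → τ1 < τ + δ := by
    intro γ hγ t1 τ1 h1
    have := le_csSup hSb (show τ1 ∈ S from ⟨γ, hγ, t1, h1⟩)
    linarith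
  have hτr : τ ∈ Ioo δ1 (Q.l - δ1) :=
    hit_range hγ0.1.1 hγ0.2.1 hγ0.2.2.1 ⟨hF.1, hF.2.1⟩ hF.2.2.2.1 hF.2.2.1
  set d : ℝ := τ / (8 * lam) with hd
  set d' : ℝ := (Q.l - τ) / (8 * lam) with hd'
  have hde : 8 * lam * d = τ := by rw [hd]; field_simp
  have hde' : 8 * lam * d' = Q.l - τ := by rw [hd']; field_simp
  have hτ0 : 0 < τ := by linarith [hτr.1]
  have hτ1 : 0 < Q.l - τ := by linarith [hτr.2]
  have hd0 : 0 < d := by positivity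
  have hd0' : 0 < d' := by positivity
  have hdδ : 100 * δ < d := by
    have : 8 * lam * (100 * δ) < 8 * lam * d := by rw [hde]; nlinarith [hτr.1]
    exact lt_of_mul_lt_mul_left this (by positivity)
  have hdδ' : 100 * δ < d' := by
    have : 8 * lam * (100 * δ) < 8 * lam * d' := by rw [hde']; nlinarith [hτr.2]
    exact lt_of_mul_lt_mul_left this (by positivity)
  have hd16 : 16 * d < τ := by nlinarith
  have hd16' : 16 * d' < Q.l - τ := by nlinarith
  obtain ⟨x1, hx1, hxch⟩ := T.choose_left hPT (q := τ - 2 * d) hd0.le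
  obtain ⟨y, hy, hych⟩ := T.choose_right hPT (q := τ + 2 * d') hd0'.le
  have hx1a := hx1.1; have hx1b := hx1.2; have hya := hy.1; have hyb := hy.2
  refine ⟨x1, τ - 2 * δ - x1, τ + 2 * δ, y - (τ + 2 * δ), by linarith, by linarith, by linarith,
    by linarith, by linarith, ?_, ?_, ?_⟩
  · rw [lt_div_iff₀ hlam0]
    have h1 : τ - 2 * δ - x1 < 2 * d := by linarith
    have h2 : (τ - 2 * δ - x1) * lam < 2 * d * lam := by gcongr
    nlinarith
  · rw [lt_div_iff₀ hlam0]
    have h1 : y - (τ + 2 * δ) < 2 * d' := by linarith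
    have h2 : (y - (τ + 2 * δ)) * lam < 2 * d' * lam := by gcongr
    nlinarith
  rw [show x1 + (τ - 2 * δ - x1) = τ - 2 * δ by ring,
    show τ + 2 * δ + (y - (τ + 2 * δ)) = y by ring]
  set X := hsum (extremalWidth (Q.Fm (-Q.a) 0 x1 (τ - 2 * δ)))
          (extremalWidth (Q.Fm (τ + 2 * δ) y Q.l (Q.l + Q.b))) with hX
  set E1 := Q.Win τ (2 * δ)
  set E2 := Q.Win (τ - 2 * d) (2 * δ)
  set E3 := Q.Win x1 (2 * δ)
  set E4 := Q.Win (τ + 2 * d') (2 * δ)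
  set E5 := Q.Win y (2 * δ)
  set J1 := Q.Jump (τ - 2 * d) d
  set J2 := Q.Jump (τ + 2 * d' - d') d'
  set F1 : Set (ℝ → ℂ) := {γ ∈ P | γ ∉ E1 ∧ γ ∉ E2 ∧ γ ∉ E3 ∧ γ ∉ E4 ∧ γ ∉ E5 ∧ γ ∉ J1 ∧ γ ∉ J2}
    with hF1
  have hPsub : P ⊆ E1 ∪ (E2 ∪ (E3 ∪ (E4 ∪ (E5 ∪ (J1 ∪ (J2 ∪ F1)))))) := by
    intro γ hγ
    simp only [mem_union, hF1]
    by_contra hcon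
    push Not at hcon
    obtain ⟨c1, c2, c3, c4, c5, c6, c7, c8⟩ := hcon
    exact c8 ⟨hγ, c1, c2, c3, c4, c5, c6, c7⟩
  have b1 : extremalWidth E1 ≤ 1 := hwin2 _ ⟨by linarith, by linarith⟩
  have b2 : extremalWidth E2 ≤ 1 := hwin2 _ ⟨by linarith, by linarith⟩
  have b3 : extremalWidth E3 ≤ 1 := hwin2 _ ⟨by linarith, by linarith⟩
  have b4 : extremalWidth E4 ≤ 1 := hwin2 _ ⟨by linarith, by linarith⟩
  have b5 : extremalWidth E5 ≤ 1 := hwin2 _ ⟨by linarith, by linarith⟩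
  have b6 : extremalWidth J1 ≤ n * ENNReal.ofReal (9 * Real.pi ^ 3) := by
    refine Q.jump_left hd0 ?_
    nlinarith
  have b7 : extremalWidth J2 ≤ n * ENNReal.ofReal (9 * Real.pi ^ 3) := by
    refine Q.jump_right hd0' ?_
    nlinarith
  have b8 : extremalWidth F1 ≤ X := by
    refine width_series fun γ hγ => ?_
    obtain ⟨hγP, e1, e2, e3, e4, e5, e6, e7⟩ := hγ
    have hγF := hγP.1.1
    -- a first hit on the left
    obtain ⟨tf, τf, hf⟩ := exists_FH hγF hδ1 hγP.2.1 hγP.2.2.1 hγP.2.2.2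
    have hf1 := hfirst γ hγP tf τf hf
    have hleft : τf < τ - 2 * δ := by
      have := Win_out hγF e1 ⟨hf.1, hf.2.1⟩ hf.2.2.2.1 hf.2.2.1
      rcases lt_abs.1 this with h' | h' <;> linarith
    -- a hit on the right
    obtain ⟨tl, htl, ul, hul, el, nB, nZ⟩ := exists_LH hγF hδ1 hγP.2.1 hγP.2.2.1 hγP.2.2.2
    have hright : τ ≤ ul := by
      by_contra hcon
      push Not at hcon
      exact T.T1 (hPT hγ0) (hPT hγP) hF htl.1 htl.2 le_rfl el hul.1 hcon nB nZ (Or.inl rfl)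
    obtain ⟨s1, hs1, v, hv, ev, hA⟩ := T.land_left (hPT hγ0) (hPT hγP) hF (x1 := x1) (by linarith)
      (by linarith) (hfirst γ hγP) e1 e3 (hxch γ hγP e2 e6 e3)
      ⟨tl, htl, ul, hul, el, by linarith⟩
    obtain ⟨s2, hs2, hmax, hBm⟩ := T.land_right (hPT hγ0) (hPT hγP) hF (y := y) (by linarith)
      (by linarith) e1 e5 (hych γ hγP e4 e7 e5)
      ⟨tf, ⟨hf.1, hf.2.1⟩, τf, hf.2.2.2.1, hf.2.2.1, by linarith⟩
    refine ⟨s1, s2, hs1.1.le, hmax s1 hs1 v ⟨by linarith [hv.1], by linarith [hv.2]⟩ ev, hs2.2.le,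
      fun r hr => ?_, fun r hr => ?_⟩
    · rw [← (sub_curve hγF.1 le_rfl hs1.1 hs1.2.le).2]; exact hr.2 _ hA
    · rw [← (sub_curve hγF.1 hs2.1.le hs2.2 le_rfl).2]; exact hr.2 _ hBm
  set M : ℝ≥0∞ := n * ENNReal.ofReal (9 * Real.pi ^ 3)
  have hPw : extremalWidth P ≤ 1 + (1 + (1 + (1 + (1 + (M + (M + X)))))) := by
    refine (width_mono hPsub).trans ?_
    refine (width_union _ _).trans (add_le_add b1 ?_)
    refine (width_union _ _).trans (add_le_add b2 ?_)
    refine (width_union _ _).trans (add_le_add b3 ?_)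
    refine (width_union _ _).trans (add_le_add b4 ?_)
    refine (width_union _ _).trans (add_le_add b5 ?_)
    refine (width_union _ _).trans (add_le_add b6 ?_)
    exact (width_union _ _).trans (add_le_add b7 b8)
  calc extremalWidth Q.F ≤ extremalWidth Q.Fp + 3 + extremalWidth P := hsplit
    _ ≤ extremalWidth Q.Fp + 3 + (1 + (1 + (1 + (1 + (1 + (M + (M + X))))))) := by gcongr
    _ = extremalWidth Q.Fp + (8 + 2 * M) + X := by ring

end Cfg
end PD
end Snk

namespace Snk
section PE
open Filter Topology

lemma isOpen_siegelDisk (θ : ℝ) : IsOpen (siegelDisk θ) :=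
  isOpen_interior.connectedComponentIn

/-- the configuration attached to Siegel data -/
def mkCfg (θ : ℝ) (S : SiegelData θ) (s a l b : ℝ) (ha : 0 < a) (hl : 0 < l) (hb : 0 < b)
    (hab : a + l + b ≤ 1 / 2) : Cfg where
  H := S.H
  contOn := S.contOn
  injOn := S.injOn
  holo := S.holo
  opn := by rw [S.image_ball]; exact isOpen_siegelDisk θ
  σ := s + a
  a := a
  l := l
  b := b
  ha := ha
  hl := hl
  hb := hb
  hab := hab

section
variable {θ : ℝ} {S : SiegelData θ} {s a l b : ℝ} {ha : 0 < a} {hl : 0 < l} {hb : 0 < b}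
    {hab : a + l + b ≤ 1 / 2}

lemma mk_Z : (mkCfg θ S s a l b ha hl hb hab).Z = siegelDisk θ := S.image_ball

lemma mk_B : (mkCfg θ S s a l b ha hl hb hab).B = bdryZ θ := by
  have h1 : (mkCfg θ S s a l b ha hl hb hab).Zc = closure (siegelDisk θ) := S.image_closedBall
  have h2 := (mkCfg θ S s a l b ha hl hb hab).Zc_eq
  unfold bdryZ
  rw [← h1, h2, ← mk_Z (S := S) (s := s) (ha := ha) (hl := hl) (hb := hb) (hab := hab)]
  ext z
  constructor
  · intro h
    exact ⟨Or.inr h, fun h' => Cfg.Z_B _ h' h⟩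
  · rintro ⟨h | h, h'⟩
    · exact absurd h h'
    · exact h

lemma mk_arc {u v p q : ℝ} (hu : u = s + a + p) (hv : v = s + a + q) :
    arcOn θ S u v = (mkCfg θ S s a l b ha hl hb hab).c '' Icc p q := by
  unfold arcOn
  rw [image_image]
  ext z
  constructor
  · rintro ⟨t, ht, rfl⟩
    refine ⟨t - (s + a), ⟨by linarith [ht.1], by linarith [ht.2]⟩, ?_⟩
    show S.H (unitCirc (s + a + (t - (s + a)))) = _
    congr 2; ring
  · rintro ⟨t, ht, rfl⟩
    exact ⟨s + a + t, ⟨by linarith [ht.1], by linarith [ht.2]⟩, rfl⟩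

lemma mk_circ {p q x y : ℝ} (h1 : -a ≤ p) (h2 : p ≤ q) (h3 : q ≤ x) (h4 : x ≤ y) (h5 : y ≤ l + b)
    {I L J : Set ℂ} (hI : I = (mkCfg θ S s a l b ha hl hb hab).c '' Icc p q)
    (hL : L = (mkCfg θ S s a l b ha hl hb hab).c '' Icc q x)
    (hJ : J = (mkCfg θ S s a l b ha hl hb hab).c '' Icc x y) :
    circFam θ I L J = (mkCfg θ S s a l b ha hl hb hab).Fm p q x y := by
  subst hI hL hJ
  unfold circFam Cfg.Fm
  rw [← mk_B (S := S) (s := s) (ha := ha) (hl := hl) (hb := hb) (hab := hab),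
    ← mk_Z (S := S) (s := s) (ha := ha) (hl := hl) (hb := hb) (hab := hab)]
  set Q := mkCfg θ S s a l b ha hl hb hab with hQ
  have key : ∀ z : ℂ, z ∉ Q.c '' Icc p q ∪ Q.c '' Icc x y ∪
      (Q.B \ (Q.c '' Icc p q ∪ Q.c '' Icc q x ∪ Q.c '' Icc x y)) ↔
      (z ∈ Q.B → z ∈ Q.c '' Ioo q x) := by
    intro z
    constructor
    · intro h hB
      have hI : z ∉ Q.c '' Icc p q := fun h' => h (Or.inl (Or.inl h'))
      have hJ : z ∉ Q.c '' Icc x y := fun h' => h (Or.inl (Or.inr h'))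
      have hL : z ∈ Q.c '' Icc q x := by
        by_contra hn
        refine h (Or.inr ⟨hB, ?_⟩)
        rintro ((h' | h') | h')
        · exact hI h'
        · exact hn h'
        · exact hJ h'
      obtain ⟨u, hu, rfl⟩ := hL
      refine ⟨u, ⟨lt_of_le_of_ne hu.1 ?_, lt_of_le_of_ne hu.2 ?_⟩, rfl⟩
      · rintro rfl; exact hI ⟨_, ⟨h2, le_rfl⟩, rfl⟩
      · rintro rfl; exact hJ ⟨_, ⟨le_rfl, h4⟩, rfl⟩
    · rintro h ((⟨u, hu, rfl⟩ | ⟨u, hu, rfl⟩) | ⟨hB, hn⟩)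
      · obtain ⟨v, hv, he⟩ := h (Q.c_mem u)
        have := Q.c_inj (u := v) (v := u)
          ⟨show -a ≤ v by linarith [hv.1], show v ≤ l + b by linarith [hv.2]⟩
          ⟨show -a ≤ u by linarith [hu.1], show u ≤ l + b by linarith [hu.2]⟩ he
        linarith [hv.1, hu.2]
      · obtain ⟨v, hv, he⟩ := h (Q.c_mem u)
        have := Q.c_inj (u := v) (v := u)
          ⟨show -a ≤ v by linarith [hv.1], show v ≤ l + b by linarith [hv.2]⟩
          ⟨show -a ≤ u by linarith [hu.1], show u ≤ l + b by linarith [hu.2]⟩ he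
        linarith [hv.2, hu.1]
      · obtain ⟨v, hv, he⟩ := h hB
        exact hn (Or.inl (Or.inr ⟨v, ⟨hv.1.le, hv.2.le⟩, he⟩))
  simp only [key]

end

lemma exists_n {lam : ℝ} (hlam : 2 < lam) : ∃ n : ℕ, 16 * lam < 2 ^ n ∧
    (n : ℝ) ≤ 11 * Real.log lam ∧ 2 / 3 < Real.log lam := by
  have l2 : 0.6931471803 < Real.log 2 := Real.log_two_gt_d9
  have l2' : Real.log 2 < Real.log lam := Real.log_lt_log (by norm_num) hlam
  refine ⟨⌈Real.log (16 * lam) / Real.log 2⌉₊ + 1, ?_, ?_, by linarith⟩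
  · have h := Nat.le_ceil (Real.log (16 * lam) / Real.log 2)
    rw [div_le_iff₀ (by linarith)] at h
    rw [← Real.log_lt_log_iff (by linarith) (by positivity), Real.log_pow]
    push_cast
    nlinarith
  · have h0 : 0 ≤ Real.log (16 * lam) / Real.log 2 :=
      div_nonneg (Real.log_nonneg (by linarith)) (by linarith)
    have h := Nat.ceil_lt_add_one h0
    have h16 : Real.log (16 * lam) = 4 * Real.log 2 + Real.log lam := by
      rw [Real.log_mul (by norm_num) (by linarith), show (16:ℝ) = 2 ^ 4 by norm_num, Real.log_pow]
      norm_num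
    have h3 : Real.log (16 * lam) / Real.log 2 ≤ 4 + 1.5 * Real.log lam := by
      rw [div_le_iff₀ (by linarith), h16]
      nlinarith
    push_cast
    linarith

end PE
end Snk

/-- **Snake Lemma** for the Siegel disk. -/
theorem snake_lemma :
    ∃ C : ℝ, 0 < C ∧
      ∀ lam : ℝ, 2 < lam →
        ∀ θ : ℝ, BoundedType θ →
          ∀ (S : SiegelData θ) (s a l b : ℝ),
            0 < a → 0 < l → 0 < b → a + l + b ≤ 1 / 2 →
            ∀ K : ℝ≥0∞,
              K = circWidth θ (arcOn θ S s (s + a)) (arcOn θ S (s + a) (s + a + l))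
                    (arcOn θ S (s + a + l) (s + a + l + b))
                  - wPlus θ (arcOn θ S s (s + a)) (arcOn θ S (s + a + l) (s + a + l + b)) →
              ENNReal.ofReal (C * Real.log lam) ≤ K →
              ∃ x₁ j x₂ i : ℝ,
                0 ≤ x₁ ∧ 0 < j ∧ x₁ + j < x₂ ∧ 0 < i ∧ x₂ + i ≤ l ∧
                j < x₁ / lam ∧ i < (l - (x₂ + i)) / lam ∧
                K - ENNReal.ofReal (C * Real.log lam) ≤
                  hsum
                    (circWidth θ (arcOn θ S s (s + a)) (arcOn θ S (s + a) (s + a + x₁))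
                      (arcOn θ S (s + a + x₁) (s + a + x₁ + j)))
                    (circWidth θ (arcOn θ S (s + a + x₂) (s + a + x₂ + i))
                      (arcOn θ S (s + a + x₂ + i) (s + a + l))
                      (arcOn θ S (s + a + l) (s + a + l + b))) := by
  refine ⟨12 + 198 * Real.pi ^ 3, by positivity, ?_⟩
  intro lam hlam θ _ S s a l b ha hl hb hab K hK hCK
  obtain ⟨n, hn, hn2, hlog⟩ := Snk.exists_n hlam
  have hpi : 0 < Real.pi ^ 3 := by positivity
  set Q := Snk.mkCfg θ S s a l b ha hl hb hab with hQ
  have arc : ∀ {u v p q : ℝ}, u = s + a + p → v = s + a + q → arcOn θ S u v = Q.c '' Icc p q :=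
    fun hu hv => Snk.mk_arc hu hv
  have e0 : circWidth θ (arcOn θ S s (s + a)) (arcOn θ S (s + a) (s + a + l))
      (arcOn θ S (s + a + l) (s + a + l + b)) = extremalWidth Q.F := by
    unfold circWidth
    rw [Snk.mk_circ (S := S) (s := s) (ha := ha) (hl := hl) (hb := hb) (hab := hab)
      (p := -a) (q := 0) (x := l) (y := l + b) le_rfl (by linarith) hl.le (by linarith) le_rfl
      (arc (by ring) (by ring)) (arc (by ring) (by ring)) (arc (by ring) (by ring))]
    rfl
  have e1 : extremalWidth Q.Fp ≤
      wPlus θ (arcOn θ S s (s + a)) (arcOn θ S (s + a + l) (s + a + l + b)) := by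
    unfold wPlus widthIn
    refine Snk.width_mono ?_
    rintro γ ⟨hγ, hZ⟩
    rw [arc (u := s) (v := s + a) (p := -a) (q := 0) (by ring) (by ring),
      arc (u := s + a + l) (v := s + a + l + b) (p := l) (q := l + b) (by ring) (by ring)]
    refine ⟨hγ.1, fun t ht => ?_, hγ.2.1, hγ.2.2.1⟩
    have := hZ t ht
    rwa [hQ, Snk.mk_Z] at this
  rw [e0] at hK
  set wp := wPlus θ (arcOn θ S s (s + a)) (arcOn θ S (s + a + l) (s + a + l + b)) with hwp
  set C : ℝ := 12 + 198 * Real.pi ^ 3 with hC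
  rcases Q.main hlam hn with h | ⟨x₁, j, x₂, i, h1, h2, h3, h4, h5, h6, h7, h8⟩
  · exfalso
    have hK3 : K ≤ 3 := by
      rw [hK, tsub_le_iff_left]
      exact h.trans (by gcongr)
    have := hCK.trans hK3
    rw [show (3 : ℝ≥0∞) = ENNReal.ofReal 3 by simp, ENNReal.ofReal_le_ofReal_iff (by norm_num)]
      at this
    nlinarith [mul_pos hpi (show (0:ℝ) < Real.log lam by linarith)]
  · have h5' : x₂ + i ≤ l := h5
    refine ⟨x₁, j, x₂, i, h1, h2, h3, h4, h5, h6, h7, ?_⟩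
    have c1 : circWidth θ (arcOn θ S s (s + a)) (arcOn θ S (s + a) (s + a + x₁))
        (arcOn θ S (s + a + x₁) (s + a + x₁ + j)) =
        extremalWidth (Q.Fm (-Q.a) 0 x₁ (x₁ + j)) := by
      unfold circWidth
      rw [Snk.mk_circ (S := S) (s := s) (ha := ha) (hl := hl) (hb := hb) (hab := hab)
        (p := -a) (q := 0) (x := x₁) (y := x₁ + j) le_rfl (by linarith) h1 (by linarith)
        (by linarith)
        (arc (by ring) (by ring)) (arc (by ring) (by ring)) (arc (by ring) (by ring))]
      rfl
    have c2 : circWidth θ (arcOn θ S (s + a + x₂) (s + a + x₂ + i))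
        (arcOn θ S (s + a + x₂ + i) (s + a + l))
        (arcOn θ S (s + a + l) (s + a + l + b)) =
        extremalWidth (Q.Fm x₂ (x₂ + i) Q.l (Q.l + Q.b)) := by
      unfold circWidth
      rw [Snk.mk_circ (S := S) (s := s) (ha := ha) (hl := hl) (hb := hb) (hab := hab)
        (p := x₂) (q := x₂ + i) (x := l) (y := l + b) (by linarith) (by linarith) h5'
        (by linarith) le_rfl
        (arc (by ring) (by ring)) (arc (by ring) (by ring)) (arc (by ring) (by ring))]
      rfl
    rw [c1, c2, hK, tsub_le_iff_left, tsub_le_iff_left, ← add_assoc]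
    refine h8.trans ?_
    refine add_le_add (add_le_add e1 ?_) le_rfl
    have h9 : (8 + 2 * ((n : ℝ≥0∞) * ENNReal.ofReal (9 * Real.pi ^ 3))) =
        ENNReal.ofReal (8 + 2 * ((n : ℝ) * (9 * Real.pi ^ 3))) := by
      rw [ENNReal.ofReal_add (by norm_num) (by positivity), ENNReal.ofReal_mul (by norm_num),
        ENNReal.ofReal_mul (by positivity)]
      simp
    rw [h9]
    refine ENNReal.ofReal_le_ofReal ?_
    nlinarith [mul_le_mul_of_nonneg_right hn2 hpi.le]
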